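/- Every countable graph with no K_{3,3} minor is a minor of a countable graph which has no K_{3,3} minor and has maximum degree at most 9. -/

import Mathlib

/-- `H` is a minor of `G`: pairwise disjoint nonempty connected branch sets, one for each
vertex of `H`, with a `G`-edge between the branch sets of any two `H`-adjacent vertices. -/
def IsMinor {V : Type*} {W : Type*} (H : SimpleGraph V) (G : SimpleGraph W) : Prop :=
  ∃ B : V → Set W,
    (∀ v : V, (G.induce (B v)).Connected) ∧
    (∀ u v : V, u ≠ v → Disjoint (B u) (B v)) ∧
    (∀ u v : V, H.Adj u v → ∃ x ∈ B u, ∃ y ∈ B v, G.Adj x y)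

namespace K33Free

open Set SimpleGraph

section Connectivity

variable {U W : Type*} {G H : SimpleGraph U} {A B C D : Set U} {a b c u v w x y z : U}

/-- No nonempty proper subset of `A` is closed under adjacency inside `A`. -/
def ConnOn (G : SimpleGraph U) (A : Set U) : Prop :=
  ∀ C ⊆ A, C.Nonempty → (∀ c ∈ C, ∀ d ∈ A, G.Adj c d → d ∈ C) → A ⊆ C

/-- Every subset of `A` that contains `a` and is closed under adjacency contains `b`. -/
def ReachIn (G : SimpleGraph U) (A : Set U) (a b : U) : Prop :=
  ∀ C ⊆ A, a ∈ C → (∀ c ∈ C, ∀ d ∈ A, G.Adj c d → d ∈ C) → b ∈ C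

/-- The vertices of `A` reachable from `a` inside `A`. -/
def comp (G : SimpleGraph U) (A : Set U) (a : U) : Set U := {b ∈ A | ReachIn G A a b}

lemma comp_subset : comp G A a ⊆ A := fun _ h => h.1

lemma comp_closed : ∀ c ∈ comp G A a, ∀ d ∈ A, G.Adj c d → d ∈ comp G A a :=
  fun c hc d hd h => ⟨hd, fun C hC ha hcl => hcl c (hc.2 C hC ha hcl) d hd h⟩

lemma ReachIn.refl : ReachIn G A a a := fun _ _ h _ => h

lemma ReachIn.trans (h : ReachIn G A a b) (h' : ReachIn G A b c) : ReachIn G A a c :=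
  fun C hC ha hcl => h' C hC (h C hC ha hcl) hcl

lemma ReachIn.mem (ha : a ∈ A) (h : ReachIn G A a b) : b ∈ A :=
  h A Subset.rfl ha fun _ _ _ hd _ => hd

lemma ReachIn.symm (ha : a ∈ A) (h : ReachIn G A a b) : ReachIn G A b a := by
  intro C hC hb hcl
  by_contra hn
  exact (h (A \ C) sdiff_subset ⟨ha, hn⟩ fun c hc d hd hcd =>
    ⟨hd, fun hdC => hc.2 (hcl d hdC c hc.1 hcd.symm)⟩).2 hb

lemma ReachIn.of_adj (hb : b ∈ A) (h : G.Adj a b) : ReachIn G A a b :=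
  fun _ _ ha hcl => hcl a ha b hb h

lemma ReachIn.mono (hGH : ∀ c ∈ A, ∀ d ∈ A, G.Adj c d → H.Adj c d) (hAB : A ⊆ B) (ha : a ∈ A)
    (h : ReachIn G A a b) : ReachIn H B a b := fun C _ haC hcl =>
  (h (C ∩ A) inter_subset_right ⟨haC, ha⟩ fun c hc d hd hcd =>
    ⟨hcl c hc.1 d (hAB hd) (hGH c hc.2 d hd hcd), hd⟩).1

lemma mem_comp_self (ha : a ∈ A) : a ∈ comp G A a := ⟨ha, ReachIn.refl⟩

lemma comp_connOn (ha : a ∈ A) : ConnOn G (comp G A a) := by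
  rintro C hC ⟨c, hc⟩ hcl b hb
  have hCA : ∀ c ∈ C, ∀ d ∈ A, G.Adj c d → d ∈ C := fun c hc d hd hcd =>
    hcl c hc d (comp_closed c (hC hc) d hd hcd) hcd
  exact (((hC hc).2.symm ha).trans hb.2) C (hC.trans comp_subset) hc hCA

lemma ConnOn.reachIn (h : ConnOn G A) (hb : b ∈ A) : ReachIn G A a b :=
  fun C hC ha hcl => h C hC ⟨a, ha⟩ hcl hb

lemma connOn_of_reachIn (h : ∀ b ∈ A, ReachIn G A a b) (ha : a ∈ A) : ConnOn G A := by
  have : comp G A a = A := subset_antisymm comp_subset fun b hb => ⟨hb, h b hb⟩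
  exact this ▸ comp_connOn ha

lemma connOn_of_reachIn' (h : ∀ a ∈ A, ∀ b ∈ A, ReachIn G A a b) : ConnOn G A := by
  rintro C hC ⟨c, hc⟩ hcl b hb
  exact h c (hC hc) b hb C hC hc hcl

lemma ConnOn.mono (hGH : ∀ c ∈ A, ∀ d ∈ A, G.Adj c d → H.Adj c d) (h : ConnOn G A) :
    ConnOn H A := fun C hC hne hcl =>
  h C hC hne fun c hc d hd hcd => hcl c hc d hd (hGH c (hC hc) d hd hcd)

lemma connOn_singleton : ConnOn G {a} := by
  rintro C hC ⟨c, hc⟩ -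
  have := hC hc
  simp only [mem_singleton_iff] at this
  simpa [← this] using hc

lemma ConnOn.union_of_reach (hA : ConnOn G A) (hB : ConnOn G B) (ha : a ∈ A) (hb : b ∈ B)
    (h : ReachIn G (A ∪ B) a b) : ConnOn G (A ∪ B) := by
  refine connOn_of_reachIn (a := a) ?_ (Or.inl ha)
  rintro c (hc | hc)
  · exact (hA.reachIn hc).mono (fun _ _ _ _ h => h) subset_union_left ha
  · exact h.trans ((hB.reachIn hc).mono (fun _ _ _ _ h => h) subset_union_right hb)

lemma ConnOn.union_adj (hA : ConnOn G A) (hB : ConnOn G B) (ha : a ∈ A) (hb : b ∈ B)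
    (h : G.Adj a b) : ConnOn G (A ∪ B) :=
  hA.union_of_reach hB ha hb (.of_adj (Or.inr hb) h)

lemma ConnOn.union_inter (hA : ConnOn G A) (hB : ConnOn G B) (ha : a ∈ A) (hb : a ∈ B) :
    ConnOn G (A ∪ B) :=
  hA.union_of_reach hB ha hb .refl

lemma ConnOn.insert_adj (hA : ConnOn G A) (ha : a ∈ A) (h : G.Adj b a) :
    ConnOn G (insert b A) := by
  rw [insert_eq]
  exact connOn_singleton.union_adj hA rfl ha h

lemma connOn_pair (h : G.Adj a b) : ConnOn G {a, b} :=
  connOn_singleton.insert_adj rfl h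

lemma ReachIn.exists_finite (ha : a ∈ A) (h : ReachIn G A a b) :
    ∃ F : Set U, F.Finite ∧ F ⊆ A ∧ ConnOn G F ∧ a ∈ F ∧ b ∈ F := by
  refine h {b | b ∈ A ∧ ∃ F : Set U, F.Finite ∧ F ⊆ A ∧ ConnOn G F ∧ a ∈ F ∧ b ∈ F}
    (fun _ h => h.1) ⟨ha, {a}, by simp, by simpa, connOn_singleton, rfl, rfl⟩ ?_ |>.2
  rintro c ⟨hcA, F, hF, hFA, hFc, haF, hcF⟩ d hd hcd
  exact ⟨hd, insert d F, hF.insert d, insert_subset hd hFA, hFc.insert_adj hcF hcd.symm,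
    Or.inr haF, Or.inl rfl⟩

lemma ConnOn.exists_finite (hA : ConnOn G A) (hne : A.Nonempty) {t : Set U} (ht : t.Finite)
    (htA : t ⊆ A) : ∃ F : Set U, F.Finite ∧ F ⊆ A ∧ ConnOn G F ∧ F.Nonempty ∧ t ⊆ F := by
  obtain ⟨a, ha⟩ := hne
  suffices ∃ F : Set U, F.Finite ∧ F ⊆ A ∧ ConnOn G F ∧ a ∈ F ∧ t ⊆ F by
    obtain ⟨F, h1, h2, h3, h4, h5⟩ := this
    exact ⟨F, h1, h2, h3, ⟨a, h4⟩, h5⟩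
  induction t, ht using Set.Finite.induction_on with
  | empty => exact ⟨{a}, by simp, by simpa, connOn_singleton, rfl, by simp⟩
  | @insert b t _ _ ih =>
    obtain ⟨F, h1, h2, h3, h4, h5⟩ := ih ((subset_insert _ _).trans htA)
    obtain ⟨F', g1, g2, g3, g4, g5⟩ :=
      (hA.reachIn (htA (mem_insert b t)) : ReachIn G A a b).exists_finite ha
    exact ⟨F ∪ F', h1.union g1, union_subset h2 g2, h3.union_inter g3 h4 g4, Or.inl h4,
      insert_subset (Or.inr g5) (h5.trans subset_union_left)⟩

lemma ConnOn.exists_walk (h : ConnOn G A) (ha : a ∈ A) (hb : b ∈ A) :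
    ∃ p : G.Walk a b, ∀ v ∈ p.support, v ∈ A := by
  have := h {b | b ∈ A ∧ ∃ p : G.Walk a b, ∀ v ∈ p.support, v ∈ A} (fun _ h => h.1)
    ⟨a, ha, .nil, by simpa⟩ ?_ hb
  · exact this.2
  rintro c ⟨hc, p, hp⟩ d hd hcd
  refine ⟨hd, p.concat hcd, ?_⟩
  simp only [Walk.support_concat, List.mem_append, List.mem_singleton]
  rintro v (hv | rfl)
  · exact hp v hv
  · exact hd

lemma induce_connected_iff : (G.induce A).Connected ↔ A.Nonempty ∧ ConnOn G A := by
  constructor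
  · intro h
    obtain ⟨⟨a, ha⟩⟩ := h.nonempty
    refine ⟨⟨a, ha⟩, ?_⟩
    rintro C hC ⟨c, hc⟩ hcl b hb
    obtain ⟨p⟩ := h.preconnected ⟨c, hC hc⟩ ⟨b, hb⟩
    have : ∀ (s t : A) (p : (G.induce A).Walk s t), s.1 ∈ C → t.1 ∈ C := by
      intro s t p
      induction p with
      | nil => exact id
      | @cons u v w h p ih => exact fun hu => ih (hcl u hu v v.2 h)
    exact this _ _ p hc
  · rintro ⟨⟨a, ha⟩, h⟩
    rw [connected_iff_exists_forall_reachable]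
    refine ⟨⟨a, ha⟩, ?_⟩
    rintro ⟨b, hb⟩
    have := h {b | ∃ hb : b ∈ A, (G.induce A).Reachable ⟨a, ha⟩ ⟨b, hb⟩} (fun _ h => h.1)
      ⟨a, ha, .refl _⟩ ?_ hb
    · exact this.2
    rintro c ⟨hc, hr⟩ d hd hcd
    exact ⟨hd, hr.trans (Adj.reachable (G := G.induce A) hcd)⟩

lemma ConnOn.preimage {H : SimpleGraph W} {f : U → W} {T : Set W} (hT : ConnOn H T)
    (hfib : ∀ t ∈ T, ConnOn G (f ⁻¹' {t}))
    (hadj : ∀ s ∈ T, ∀ t ∈ T, H.Adj s t → ∃ a b, f a = s ∧ f b = t ∧ G.Adj a b) :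
    ConnOn G (f ⁻¹' T) := by
  rintro C hC ⟨c, hc⟩ hcl
  have hfull : ∀ c ∈ C, f ⁻¹' {f c} ⊆ C := by
    intro c hc d hd
    have hcT : f c ∈ T := hC hc
    have := hfib (f c) hcT (C ∩ f ⁻¹' {f c}) inter_subset_right ⟨c, hc, rfl⟩
      (fun x hx y hy hxy => ⟨hcl x hx.1 y (by rw [mem_preimage, show f y = f c from hy]; exact hcT)
        hxy, hy⟩) hd
    exact this.1
  have := hT {t | t ∈ T ∧ f ⁻¹' {t} ⊆ C} (fun _ h => h.1) ⟨f c, hC hc, hfull c hc⟩ ?_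
  · exact fun b hb => (this hb).2 rfl
  rintro s ⟨hs, hsC⟩ t ht hst
  obtain ⟨a, b, ha, rfl, hab⟩ := hadj s hs t ht hst
  have hbC : b ∈ C := hcl a (hsC ha) b ht hab
  exact ⟨ht, hfull b hbC⟩

lemma ConnOn.image {H : SimpleGraph W} {f : U → W} (hA : ConnOn G A)
    (hadj : ∀ s ∈ A, ∀ t ∈ A, G.Adj s t → f s = f t ∨ H.Adj (f s) (f t)) :
    ConnOn H (f '' A) := by
  rintro C hC ⟨c, hc⟩ hcl
  have := hA (A ∩ f ⁻¹' C) inter_subset_left ?_ ?_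
  · rintro _ ⟨a, ha, rfl⟩; exact (this ha).2
  · obtain ⟨a, ha, rfl⟩ := hC hc; exact ⟨a, ha, hc⟩
  · rintro s ⟨hs, hsC⟩ t ht hst
    refine ⟨ht, ?_⟩
    rcases hadj s hs t ht hst with h | h
    · rw [mem_preimage, ← h]; exact hsC
    · exact hcl _ hsC _ ⟨t, ht, rfl⟩ h

end Connectivity

section Minor

variable {U W : Type*} {G H : SimpleGraph U}

/-- `G` has a `K_{3,3}` minor. -/
def HasK33 (G : SimpleGraph U) : Prop :=
  ∃ B : Bool × Fin 3 → Set U, (∀ p, (B p).Nonempty) ∧ (∀ p, ConnOn G (B p)) ∧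
    (∀ p q, p ≠ q → Disjoint (B p) (B q)) ∧
    ∀ p q, p.1 ≠ q.1 → ∃ x ∈ B p, ∃ y ∈ B q, G.Adj x y

/-- `G` has no `K_{3,3}` minor. -/
def KF (G : SimpleGraph U) : Prop := ¬ HasK33 G

lemma isMinor_iff_hasK33 : IsMinor (completeBipartiteGraph (Fin 3) (Fin 3)) G ↔ HasK33 G := by
  constructor
  · rintro ⟨B, h1, h2, h3⟩
    let e : Bool × Fin 3 → Fin 3 ⊕ Fin 3 := fun p => if p.1 then .inl p.2 else .inr p.2
    have he : ∀ p q, e p = e q → p = q := by decide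
    have he' : ∀ p q, p.1 ≠ q.1 → (completeBipartiteGraph (Fin 3) (Fin 3)).Adj (e p) (e q) := by
      rintro ⟨_ | _, i⟩ ⟨_ | _, j⟩ h <;> simp_all [e]
    refine ⟨fun p => B (e p), fun p => (induce_connected_iff.1 (h1 _)).1,
      fun p => (induce_connected_iff.1 (h1 _)).2, fun p q h => h2 _ _ fun h' => h (he _ _ h'),
      fun p q h => h3 _ _ (he' p q h)⟩
  · rintro ⟨B, h0, h1, h2, h3⟩
    refine ⟨Sum.elim (fun i => B (true, i)) (fun i => B (false, i)), ?_, ?_, ?_⟩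
    · rintro (i | i) <;> exact induce_connected_iff.2 ⟨h0 _, h1 _⟩
    · rintro (i | i) (j | j) h <;> apply h2 <;> simp_all
    · rintro (i | i) (j | j) h <;> first | (simp at h; done) | exact h3 _ _ (by simp)

lemma HasK33.mk {X Y : Fin 3 → Set U} (hX : ∀ i, (X i).Nonempty) (hY : ∀ i, (Y i).Nonempty)
    (cX : ∀ i, ConnOn G (X i)) (cY : ∀ i, ConnOn G (Y i))
    (dX : ∀ i j, i < j → Disjoint (X i) (X j)) (dY : ∀ i j, i < j → Disjoint (Y i) (Y j))
    (dXY : ∀ i j, Disjoint (X i) (Y j)) (h : ∀ i j, ∃ x ∈ X i, ∃ y ∈ Y j, G.Adj x y) :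
    HasK33 G := by
  refine ⟨fun p => if p.1 then X p.2 else Y p.2, ?_, ?_, ?_, ?_⟩
  · rintro ⟨_ | _, i⟩ <;> simp [hX, hY]
  · rintro ⟨_ | _, i⟩ <;> simp [cX, cY]
  · rintro ⟨_ | _, i⟩ ⟨_ | _, j⟩ hne <;> simp only [Bool.false_eq_true, if_false, if_true]
    · rcases lt_trichotomy i j with hij | hij | hij
      · exact dY _ _ hij
      · simp [hij] at hne
      · exact (dY _ _ hij).symm
    · exact (dXY _ _).symm
    · exact dXY _ _
    · rcases lt_trichotomy i j with hij | hij | hij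
      · exact dX _ _ hij
      · simp [hij] at hne
      · exact (dX _ _ hij).symm
  · rintro ⟨_ | _, i⟩ ⟨_ | _, j⟩ hne <;> simp at hne ⊢
    · obtain ⟨x, hx, y, hy, hxy⟩ := h j i
      exact ⟨y, hy, x, hx, hxy.symm⟩
    · exact h i j

lemma HasK33.mk6 {X₀ X₁ X₂ Y₀ Y₁ Y₂ : Set U}
    (hX : X₀.Nonempty ∧ X₁.Nonempty ∧ X₂.Nonempty) (hY : Y₀.Nonempty ∧ Y₁.Nonempty ∧ Y₂.Nonempty)
    (cX : ConnOn G X₀ ∧ ConnOn G X₁ ∧ ConnOn G X₂) (cY : ConnOn G Y₀ ∧ ConnOn G Y₁ ∧ ConnOn G Y₂)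
    (dX : Disjoint X₀ X₁ ∧ Disjoint X₀ X₂ ∧ Disjoint X₁ X₂)
    (dY : Disjoint Y₀ Y₁ ∧ Disjoint Y₀ Y₂ ∧ Disjoint Y₁ Y₂)
    (d0 : Disjoint X₀ Y₀ ∧ Disjoint X₀ Y₁ ∧ Disjoint X₀ Y₂)
    (d1 : Disjoint X₁ Y₀ ∧ Disjoint X₁ Y₁ ∧ Disjoint X₁ Y₂)
    (d2 : Disjoint X₂ Y₀ ∧ Disjoint X₂ Y₁ ∧ Disjoint X₂ Y₂)
    (h00 : ∃ x ∈ X₀, ∃ y ∈ Y₀, G.Adj x y) (h01 : ∃ x ∈ X₀, ∃ y ∈ Y₁, G.Adj x y)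
    (h02 : ∃ x ∈ X₀, ∃ y ∈ Y₂, G.Adj x y) (h10 : ∃ x ∈ X₁, ∃ y ∈ Y₀, G.Adj x y)
    (h11 : ∃ x ∈ X₁, ∃ y ∈ Y₁, G.Adj x y) (h12 : ∃ x ∈ X₁, ∃ y ∈ Y₂, G.Adj x y)
    (h20 : ∃ x ∈ X₂, ∃ y ∈ Y₀, G.Adj x y) (h21 : ∃ x ∈ X₂, ∃ y ∈ Y₁, G.Adj x y)
    (h22 : ∃ x ∈ X₂, ∃ y ∈ Y₂, G.Adj x y) : HasK33 G := by
  apply HasK33.mk (X := ![X₀, X₁, X₂]) (Y := ![Y₀, Y₁, Y₂])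
  · intro i; fin_cases i; exacts [hX.1, hX.2.1, hX.2.2]
  · intro i; fin_cases i; exacts [hY.1, hY.2.1, hY.2.2]
  · intro i; fin_cases i; exacts [cX.1, cX.2.1, cX.2.2]
  · intro i; fin_cases i; exacts [cY.1, cY.2.1, cY.2.2]
  · intro i j hij
    fin_cases i <;> fin_cases j <;> first | (simp at hij; done) | skip
    exacts [dX.1, dX.2.1, dX.2.2]
  · intro i j hij
    fin_cases i <;> fin_cases j <;> first | (simp at hij; done) | skip
    exacts [dY.1, dY.2.1, dY.2.2]
  · intro i j
    fin_cases i <;> fin_cases j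
    exacts [d0.1, d0.2.1, d0.2.2, d1.1, d1.2.1, d1.2.2, d2.1, d2.2.1, d2.2.2]
  · intro i j
    fin_cases i <;> fin_cases j
    exacts [h00, h01, h02, h10, h11, h12, h20, h21, h22]

lemma HasK33.mem_support {B : Bool × Fin 3 → Set U}
    (hc : ∀ p, ConnOn G (B p))
    (he : ∀ p q, p.1 ≠ q.1 → ∃ x ∈ B p, ∃ y ∈ B q, G.Adj x y) (p : Bool × Fin 3) {a : U}
    (ha : a ∈ B p) : a ∈ G.support := by
  by_contra hn
  rw [SimpleGraph.mem_support] at hn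
  push Not at hn
  have := hc p {a} (by simpa) (by simp) (fun c hc d _ hcd => by
    rw [mem_singleton_iff.1 hc] at hcd; exact absurd hcd (hn d))
  obtain ⟨x, hx, y, hy, hxy⟩ := he p (!p.1, 0) (by simp)
  rw [mem_singleton_iff.1 (this hx)] at hxy
  exact hn _ hxy

lemma KF.of_hom {Q : SimpleGraph W} (hG : KF G) (f : W → U) (hinj : InjOn f Q.support)
    (hf : ∀ a b, Q.Adj a b → G.Adj (f a) (f b)) : KF Q := by
  rintro ⟨B, hne, hc, hd, he⟩
  have hs := fun p a => HasK33.mem_support hc he p (a := a)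
  refine hG ⟨fun p => f '' B p, fun p => (hne p).image f,
    fun p => (hc p).image fun s _ t _ h => Or.inr (hf s t h), fun p q hpq => ?_, fun p q hpq => ?_⟩
  · exact (hd p q hpq).image hinj (hs p) (hs q)
  · obtain ⟨x, hx, y, hy, hxy⟩ := he p q hpq
    exact ⟨f x, ⟨x, hx, rfl⟩, f y, ⟨y, hy, rfl⟩, hf x y hxy⟩

lemma KF.mono (hG : KF G) (h : H ≤ G) : KF H :=
  hG.of_hom id (injOn_id _) fun _ _ hab => h hab

/-- The quotient of `G` by the fibres of `ρ`. -/
def quot (G : SimpleGraph U) (ρ : U → W) : SimpleGraph W where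
  Adj a b := a ≠ b ∧ ∃ a' b', ρ a' = a ∧ ρ b' = b ∧ G.Adj a' b'
  symm := ⟨fun _ _ h => ⟨h.1.symm, by
    obtain ⟨-, a', b', h1, h2, h3⟩ := h; exact ⟨b', a', h2, h1, h3.symm⟩⟩⟩
  loopless := ⟨fun _ h => h.1 rfl⟩

lemma KF.quot (hG : KF G) {ρ : U → W} (hρ : ∀ w, ConnOn G (ρ ⁻¹' {w})) : KF (quot G ρ) := by
  rintro ⟨B, hne, hc, hd, he⟩
  have hs := fun p a => HasK33.mem_support hc he p (a := a)
  have hfib : ∀ p, ∀ t ∈ B p, (ρ ⁻¹' {t}).Nonempty := by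
    intro p t ht
    obtain ⟨b, h⟩ := (SimpleGraph.mem_support _).1 (hs p t ht)
    obtain ⟨-, a', b', h1, h2, h3⟩ := h
    exact ⟨a', h1⟩
  refine hG ⟨fun p => ρ ⁻¹' B p, fun p => ?_, fun p => ?_, fun p q hpq => (hd p q hpq).preimage ρ,
    fun p q hpq => ?_⟩
  · obtain ⟨t, ht⟩ := hne p
    obtain ⟨a, ha⟩ := hfib p t ht
    exact ⟨a, by rw [mem_preimage, show ρ a = t from ha]; exact ht⟩
  · exact (hc p).preimage (fun t _ => hρ t) fun s _ t _ h => h.2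
  · obtain ⟨x, hx, y, hy, -, a, b, rfl, rfl, hab⟩ := he p q hpq
    exact ⟨a, hx, b, hy, hab⟩

/-- The edges of `G` inside `S`. -/
def restr (G : SimpleGraph U) (S : Set U) : SimpleGraph U where
  Adj a b := G.Adj a b ∧ a ∈ S ∧ b ∈ S
  symm := ⟨fun _ _ h => ⟨h.1.symm, h.2.2, h.2.1⟩⟩
  loopless := ⟨fun _ h => h.1.ne rfl⟩

lemma restr_adj {S : Set U} {a b : U} : (restr G S).Adj a b ↔ G.Adj a b ∧ a ∈ S ∧ b ∈ S := Iff.rfl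

lemma restr_le {S : Set U} : restr G S ≤ G := fun _ _ h => h.1

lemma KF.restr_sup_edge (hG : KF G) {S C : Set U} {u w : U} (hC : ConnOn G C)
    (hd : Disjoint C S) (hu : u ∈ S) (hw : w ∈ S) (huw : u ≠ w)
    (hcu : ∃ c ∈ C, G.Adj u c) (hcw : ∃ c ∈ C, G.Adj c w) : KF (restr G S ⊔ edge u w) := by
  classical
  let G' := restr G (S ∪ C)
  let ρ : U → U := fun a => if a ∈ C then u else a
  have hdis : ∀ a ∈ S, a ∉ C := fun a ha hc => hd.le_bot ⟨hc, ha⟩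
  have hG' : KF G' := hG.mono restr_le
  obtain ⟨c, hc, huc⟩ := hcu
  obtain ⟨c', hc', hcw⟩ := hcw
  have hρ : ∀ t, ConnOn G' (ρ ⁻¹' {t}) := by
    intro t
    by_cases ht : t = u
    · have : ρ ⁻¹' {t} = insert u C := by
        ext a
        simp only [mem_preimage, mem_singleton_iff, ρ, mem_insert_iff, ht]
        by_cases ha : a ∈ C <;> simp [ha]
      rw [this]
      refine ConnOn.insert_adj (a := c) (hC.mono fun a ha b hb hab => ⟨hab, Or.inr ha, Or.inr hb⟩)
        hc ⟨huc, Or.inl hu, Or.inr hc⟩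
    · intro D hD ⟨d, hdD⟩ _ a ha
      have h1 := hD hdD
      simp only [mem_preimage, mem_singleton_iff, ρ] at h1 ha
      split_ifs at h1 ha <;> simp_all
  refine (hG'.quot hρ).mono ?_
  intro a b hab
  rcases hab with hab | hab
  · obtain ⟨hab, ha, hb⟩ := hab
    refine ⟨hab.ne, a, b, ?_, ?_, hab, Or.inl ha, Or.inl hb⟩ <;> simp [ρ, hdis a ha, hdis b hb]
  · rw [edge_adj] at hab
    obtain ⟨⟨rfl, rfl⟩ | ⟨rfl, rfl⟩, hne⟩ := hab
    · exact ⟨hne, c', b, by simp [ρ, hc'], by simp [ρ, hdis b hw], hcw, Or.inr hc', Or.inl hw⟩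
    · exact ⟨hne, a, c', by simp [ρ, hdis a hw], by simp [ρ, hc'], hcw.symm, Or.inl hw, Or.inr hc'⟩

lemma HasK33.exists_finite (h : HasK33 G) : ∃ F : Set U, F.Finite ∧ HasK33 (restr G F) := by
  classical
  obtain ⟨B, hne, hc, hd, he⟩ := h
  have he' : ∀ p q : Bool × Fin 3, ∃ x y, p.1 ≠ q.1 → x ∈ B p ∧ y ∈ B q ∧ G.Adj x y := by
    intro p q
    obtain ⟨a, ha⟩ := hne p
    by_cases h : p.1 = q.1
    · exact ⟨a, a, fun h' => absurd h h'⟩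
    · obtain ⟨x, hx, y, hy, hxy⟩ := he p q h
      exact ⟨x, y, fun _ => ⟨hx, hy, hxy⟩⟩
  choose X Y hXY using he'
  have hF : ∀ p, ∃ F : Set U, F.Finite ∧ F ⊆ B p ∧ ConnOn G F ∧ F.Nonempty ∧
      {a | ∃ q, p.1 ≠ q.1 ∧ (a = X p q ∨ a = Y q p)} ⊆ F := by
    intro p
    refine (hc p).exists_finite (hne p) ?_ ?_
    · refine (Set.finite_range (fun q => X p q) |>.union (Set.finite_range fun q => Y q p)).subset ?_
      rintro a ⟨q, -, rfl | rfl⟩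
      · exact Or.inl ⟨q, rfl⟩
      · exact Or.inr ⟨q, rfl⟩
    · rintro a ⟨q, hq, rfl | rfl⟩
      · exact (hXY p q hq).1
      · exact (hXY q p hq.symm).2.1
  choose F h1 h2 h3 h4 h5 using hF
  refine ⟨⋃ p, F p, Set.finite_iUnion h1, F, h4, fun p => (h3 p).mono fun c hc d hd hcd =>
    ⟨hcd, mem_iUnion.2 ⟨p, hc⟩, mem_iUnion.2 ⟨p, hd⟩⟩, fun p q h => (hd p q h).mono (h2 p) (h2 q),
    fun p q hpq => ?_⟩
  have hx : X p q ∈ F p := h5 p ⟨q, hpq, Or.inl rfl⟩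
  have hy : Y p q ∈ F q := h5 q ⟨p, hpq.symm, Or.inr rfl⟩
  exact ⟨X p q, hx, Y p q, hy, (hXY p q hpq).2.2, mem_iUnion.2 ⟨p, hx⟩, mem_iUnion.2 ⟨q, hy⟩⟩

lemma kf_of_finite (h : ∀ F : Set U, F.Finite → KF (restr G F)) : KF G := fun hG => by
  obtain ⟨F, hF, h'⟩ := hG.exists_finite
  exact h F hF h'

end Minor

section TwoSum

variable {U W : Type*} {G H : SimpleGraph U}

lemma HasK33.restrict_side {V₁ V₂ : Set U} {u w : U} {B : Bool × Fin 3 → Set U}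
    (hc : ∀ p, ConnOn G (B p)) (hd : ∀ p q, p ≠ q → Disjoint (B p) (B q))
    (he : ∀ p q, p.1 ≠ q.1 → ∃ x ∈ B p, ∃ y ∈ B q, G.Adj x y)
    (hi : V₁ ∩ V₂ ⊆ {u, w}) (hu : u ∈ V₁) (hw : w ∈ V₁)
    (hG : ∀ a b, G.Adj a b → (a ∈ V₁ ∧ b ∈ V₁) ∨ (a ∈ V₂ ∧ b ∈ V₂))
    (hB : ∀ p, (B p ∩ V₁).Nonempty) : HasK33 (restr G V₁ ⊔ edge u w) := by
  have key : ∀ p x, x ∈ B p → x ∈ V₂ → u ∈ B p ∨ w ∈ B p := by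
    intro p x hx hx2
    by_contra! hn
    have hnot : ∀ d ∈ B p, d ∈ V₂ → d ∉ V₁ := by
      intro d hd h2 h1
      rcases hi ⟨h1, h2⟩ with rfl | rfl
      · exact hn.1 hd
      · exact hn.2 hd
    obtain ⟨z, hz, hz1⟩ := hB p
    have := hc p (B p ∩ V₂) inter_subset_left ⟨x, hx, hx2⟩ (fun c hc d hd hcd => ?_) hz
    · exact hnot z hz this.2 hz1
    · rcases hG c d hcd with h | h
      · exact absurd h.1 (hnot c hc.1 hc.2)
      · exact ⟨hd, h.2⟩
  refine ⟨fun p => B p ∩ V₁, hB, fun p => ?_, fun p q h => (hd p q h).mono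
    inter_subset_left inter_subset_left, fun p q hpq => ?_⟩
  · rintro C hC ⟨c, hcC⟩ hcl
    have hcl' : ∀ c ∈ C, ∀ d ∈ B p ∩ V₁, G.Adj c d → d ∈ C := fun c hc d hd hcd =>
      hcl c hc d hd (Or.inl ⟨hcd, (hC hc).2, hd.2⟩)
    by_cases hK : u ∈ C ∨ w ∈ C
    · have hK' : ∀ k ∈ B p, k ∈ V₁ → k ∈ V₂ → k ∈ C := by
        intro k hk hk1 hk2
        by_cases huw : u = w
        · subst huw
          rcases hi ⟨hk1, hk2⟩ with rfl | rfl
          · simpa using hK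
          · simpa using hK
        · rcases hi ⟨hk1, hk2⟩ with rfl | rfl
          · rcases hK with h | h
            · exact h
            · exact hcl _ h _ ⟨hk, hk1⟩ (Or.inr (by simp [edge_adj, Ne.symm huw]))
          · rcases hK with h | h
            · exact hcl _ h _ ⟨hk, hk1⟩ (Or.inr (by simp [edge_adj, huw]))
            · exact h
      have := hc p (C ∪ (B p \ V₁)) ?_ ⟨c, Or.inl hcC⟩ ?_
      · exact fun b hb => (this hb.1).resolve_right fun h => h.2 hb.2
      · exact union_subset (hC.trans inter_subset_left) sdiff_subset
      · rintro c hc d hd hcd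
        by_cases hd1 : d ∈ V₁
        · left
          rcases hc with hc | hc
          · exact hcl' c hc d ⟨hd, hd1⟩ hcd
          · rcases hG c d hcd with h | h
            · exact absurd h.1 hc.2
            · exact hK' d hd hd1 h.2
        · exact Or.inr ⟨hd, hd1⟩
    · push Not at hK
      refine inter_subset_left.trans (hc p C (hC.trans inter_subset_left) ⟨c, hcC⟩ ?_)
      intro c hc d hd hcd
      rcases hG c d hcd with h | h
      · exact hcl' c hc d ⟨hd, h.2⟩ hcd
      · rcases hi ⟨(hC hc).2, h.1⟩ with rfl | rfl
        · exact absurd hc hK.1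
        · exact absurd hc hK.2
  · obtain ⟨x, hx, y, hy, hxy⟩ := he p q hpq
    have hpq' : p ≠ q := fun h => hpq (h ▸ rfl)
    rcases hG x y hxy with h | h
    · exact ⟨x, ⟨hx, h.1⟩, y, ⟨hy, h.2⟩, Or.inl ⟨hxy, h⟩⟩
    · have hdis := fun k (h : k ∈ B p) (h' : k ∈ B q) => (hd p q hpq').le_bot ⟨h, h'⟩
      rcases key p x hx h.1 with h1 | h1 <;> rcases key q y hy h.2 with h2 | h2
      · exact (hdis _ h1 h2).elim
      · have : u ≠ w := fun h => hdis u h1 (h ▸ h2)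
        exact ⟨u, ⟨h1, hu⟩, w, ⟨h2, hw⟩, Or.inr (by simp [edge_adj, this])⟩
      · have : u ≠ w := fun h => hdis u (h ▸ h1) h2
        exact ⟨w, ⟨h1, hw⟩, u, ⟨h2, hu⟩, Or.inr (by simp [edge_adj, this.symm])⟩
      · exact (hdis _ h1 h2).elim

lemma exists_avoid {B : Bool × Fin 3 → Set U} (hd : ∀ p q, p ≠ q → Disjoint (B p) (B q))
    (b : Bool) (u w : U) : ∃ i : Fin 3, u ∉ B (b, i) ∧ w ∉ B (b, i) := by
  have h : ∀ i j : Fin 3, i ≠ j → ∀ x, x ∈ B (b, i) → x ∈ B (b, j) → False :=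
    fun i j hij x h1 h2 => (hd (b, i) (b, j) (by simpa using hij)).le_bot ⟨h1, h2⟩
  by_contra! hn
  have h0 := hn 0
  have h1 := hn 1
  have h2 := hn 2
  have a1 := h 0 1 (by decide)
  have a2 := h 0 2 (by decide)
  have a3 := h 1 2 (by decide)
  have := a1 u; have := a1 w; have := a2 u; have := a2 w; have := a3 u; have := a3 w
  tauto

/-- A graph glued from two `K_{3,3}`-minor-free graphs along at most one edge
is `K_{3,3}`-minor-free. -/
lemma KF.two_sum {V₁ V₂ : Set U} {u w : U} (hi : V₁ ∩ V₂ ⊆ {u, w}) (hu₁ : u ∈ V₁) (hw₁ : w ∈ V₁)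
    (hu₂ : u ∈ V₂) (hw₂ : w ∈ V₂)
    (hG : ∀ a b, G.Adj a b → (a ∈ V₁ ∧ b ∈ V₁) ∨ (a ∈ V₂ ∧ b ∈ V₂))
    (h₁ : KF (restr G V₁ ⊔ edge u w)) (h₂ : KF (restr G V₂ ⊔ edge u w)) : KF G := by
  rintro ⟨B, hne, hc, hd, he⟩
  have hs := fun p a => HasK33.mem_support hc he p (a := a)
  have hcov : ∀ p a, a ∈ B p → a ∈ V₁ ∨ a ∈ V₂ := by
    intro p a ha
    obtain ⟨b, hb⟩ := (SimpleGraph.mem_support _).1 (hs p a ha)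
    rcases hG a b hb with h | h
    · exact Or.inl h.1
    · exact Or.inr h.1
  have hmix : ∀ p, u ∉ B p → w ∉ B p → (∀ a ∈ B p, a ∈ V₁ ∧ a ∉ V₂) ∨ 
      (∀ a ∈ B p, a ∉ V₁ ∧ a ∈ V₂) := by
    intro p hu hw
    have hno : ∀ a ∈ B p, a ∈ V₁ → a ∈ V₂ → False := by
      intro a ha h1 h2
      rcases hi ⟨h1, h2⟩ with rfl | rfl
      · exact hu ha
      · exact hw ha
    by_cases hm : (B p ∩ V₁).Nonempty
    · left
      have := hc p (B p ∩ V₁) inter_subset_left hm fun c hc d hd hcd => by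
        rcases hG c d hcd with h | h
        · exact ⟨hd, h.2⟩
        · exact (hno c hc.1 hc.2 h.1).elim
      exact fun a ha => ⟨(this ha).2, fun h => hno a ha (this ha).2 h⟩
    · right
      intro a ha
      have : a ∉ V₁ := fun h => hm ⟨a, ha, h⟩
      exact ⟨this, (hcov p a ha).resolve_left this⟩
  by_cases hB : ∀ p, (B p ∩ V₁).Nonempty
  · exact h₁ (HasK33.restrict_side hc hd he hi hu₁ hw₁ hG hB)
  push Not at hB
  obtain ⟨p, hp⟩ := hB
  have hp1 : ∀ a ∈ B p, a ∉ V₁ := fun a ha h => by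
    have : a ∈ B p ∩ V₁ := ⟨ha, h⟩
    simp [hp] at this
  refine h₂ (HasK33.restrict_side hc hd he (inter_comm V₁ V₂ ▸ hi) hu₂ hw₂
    (fun a b h => (hG a b h).symm) fun q => ?_)
  by_contra hq
  have hq2 : ∀ a ∈ B q, a ∉ V₂ := fun a ha h => hq ⟨a, ha, h⟩
  have hopp : ∀ r, p.1 ≠ r.1 → q.1 ≠ r.1 → u ∉ B r → w ∉ B r → False := by
    intro r hpr hqr hur hwr
    rcases hmix r hur hwr with h | h
    · obtain ⟨x, hx, y, hy, hxy⟩ := he p r hpr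
      rcases hG x y hxy with h' | h'
      · exact hp1 x hx h'.1
      · exact (h y hy).2 h'.2
    · obtain ⟨x, hx, y, hy, hxy⟩ := he q r hqr
      rcases hG x y hxy with h' | h'
      · exact (h y hy).1 h'.2
      · exact hq2 x hx h'.1
  by_cases hpq : p.1 = q.1
  · obtain ⟨i, hi1, hi2⟩ := exists_avoid hd (!p.1) u w
    exact hopp (!p.1, i) (by simp) (by simp [hpq]) hi1 hi2
  · obtain ⟨x, hx, y, hy, hxy⟩ := he p q hpq
    rcases hG x y hxy with h | h
    · exact hp1 x hx h.1
    · exact hq2 y hy h.2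

lemma kf_of_support_subset {F : Finset U} (hF : G.support ⊆ F) (hcard : F.card ≤ 5) : KF G := by
  rintro ⟨B, hne, hc, hd, he⟩
  choose r hr using hne
  have hinj : Function.Injective r := by
    intro p q hpq
    by_contra h
    exact (hd p q h).le_bot ⟨hr p, hpq ▸ hr q⟩
  have : (Finset.univ : Finset (Bool × Fin 3)).card ≤ F.card :=
    Finset.card_le_card_of_injOn r (fun p _ => hF (HasK33.mem_support hc he p (hr p)))
      hinj.injOn
  simp at this
  omega

/-- Adding a vertex of degree at most two whose neighbours are adjacent does not create
a `K_{3,3}` minor. -/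
lemma KF.add_vertex {v u w : U} (hvu : v ≠ u) (hvw : v ≠ w)
    (hn : ∀ b, G.Adj v b → b = u ∨ b = w) (huw : u = w ∨ G.Adj u w)
    (h : KF (restr G {v}ᶜ)) : KF G := by
  classical
  have hn' : ∀ b, G.Adj b v → b = u ∨ b = w := fun b hb => hn b hb.symm
  refine KF.two_sum (V₁ := {v}ᶜ) (V₂ := {v, u, w}) (u := u) (w := w) ?_ (by simpa using hvu.symm)
    (by simpa using hvw.symm) (by simp) (by simp) ?_ (h.mono ?_) ?_
  · rintro a ⟨h1, h2⟩; simp at h1 h2 ⊢; tauto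
  · intro a b hab
    by_cases ha : a = v
    · subst ha; right; have := hn b hab; simp; tauto
    · by_cases hb : b = v
      · subst hb; right; have := hn' a hab; simp; tauto
      · left; simp [ha, hb]
  · rintro a b (hab | hab)
    · exact hab
    · rw [edge_adj] at hab
      rcases huw with huw | huw
      · subst huw; obtain ⟨⟨rfl, rfl⟩ | ⟨rfl, rfl⟩, hne⟩ := hab <;> exact absurd rfl hne
      · obtain ⟨⟨rfl, rfl⟩ | ⟨rfl, rfl⟩, hne⟩ := hab
        · exact ⟨huw, hvu.symm, hvw.symm⟩
        · exact ⟨huw.symm, hvw.symm, hvu.symm⟩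
  · refine kf_of_support_subset (F := {v, u, w}) ?_ ((Finset.card_le_three).trans (by norm_num))
    rintro a ha
    obtain ⟨b, hab⟩ := (SimpleGraph.mem_support _).1 ha
    rcases hab with hab | hab
    · simpa using hab.2.1
    · rw [edge_adj] at hab
      simp; tauto

end TwoSum

section Certificate

variable {U W : Type*} {G : SimpleGraph U} {τ : U → U → ZMod 2} {Φ : U → U → U → ZMod 2}
  {a a' b b' c d x y : U}

/-- A mod 2 certificate, in the spirit of van Kampen, that a graph has no `K_{3,3}` minor. -/
structure IsVK (G : SimpleGraph U) (τ : U → U → ZMod 2) (Φ : U → U → U → ZMod 2) : Prop where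
  tour : ∀ a b, a ≠ b → τ a b + τ b a = 1
  symm : ∀ a b c, Φ a b c = Φ b a c
  edges : ∀ a b c d, G.Adj a b → G.Adj c d → a ≠ c → a ≠ d → b ≠ c → b ≠ d →
    τ a c + τ a d + τ b c + τ b d = Φ a b c + Φ a b d + Φ c d a + Φ c d b

/-- The sum of `Φ` over the edges of a walk. -/
def walkSum (Φ : U → U → U → ZMod 2) : ∀ {a b : U}, G.Walk a b → U → ZMod 2
  | _, _, .nil, _ => 0
  | _, _, .cons (u := u) (v := v) _ p, z => Φ u v z + walkSum Φ p z

lemma IsVK.walk_edge (h : IsVK G τ Φ) (p : G.Walk a a') (hcd : G.Adj c d)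
    (hc : c ∉ p.support) (hd : d ∉ p.support) :
    τ a c + τ a d + τ a' c + τ a' d + walkSum Φ p c + walkSum Φ p d + Φ c d a + Φ c d a' = 0 := by
  induction p with
  | nil => simp only [walkSum]; grind
  | @cons u v w huv p ih =>
    simp only [Walk.support_cons, List.mem_cons, not_or] at hc hd
    have hv : v ∈ p.support := p.start_mem_support
    have h1 := h.edges u v c d huv hcd (Ne.symm hc.1) (Ne.symm hd.1)
      (fun h => hc.2 (h ▸ hv)) (fun h => hd.2 (h ▸ hv))
    have h2 := ih hc.2 hd.2
    simp only [walkSum]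
    clear ih h
    grind

lemma IsVK.walk_walk (h : IsVK G τ Φ) (p : G.Walk a a') (q : G.Walk b b')
    (hpq : ∀ v ∈ p.support, v ∉ q.support) :
    τ a b + τ a b' + τ a' b + τ a' b' + walkSum Φ p b + walkSum Φ p b' +
      walkSum Φ q a + walkSum Φ q a' = 0 := by
  induction q with
  | nil => simp only [walkSum]; grind
  | @cons u v w huv q ih =>
    simp only [Walk.support_cons, List.mem_cons, not_or] at hpq
    have hv : v ∈ q.support := q.start_mem_support
    have h1 := h.walk_edge p huv (fun hu => (hpq u hu).1 rfl) (fun hu => (hpq v hu).2 hv)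
    have h2 := ih fun v hv => (hpq v hv).2
    simp only [walkSum]
    clear ih h
    grind

lemma no_pairing (t : Fin 3 → Fin 3 → ZMod 2) (s : Fin 3 → Fin 3 → ZMod 2)
    (m n : Fin 3 → Fin 3 → ZMod 2) (f : Fin 3 → Fin 3 → Fin 3 → ZMod 2)
    (g : Fin 3 → Fin 3 → Fin 3 → ZMod 2)
    (hs : ∀ i j, i ≠ j → s i j + s j i = 1)
    (h : ∀ i i' j j', i < i' → j ≠ j' →
      t i i' + m i j' + n j i' + s j j' + f i j i' + g i j j' + f i' j' i + g i' j' j = 0) :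
    False := by
  have e1 := h 0 1 0 1 (by decide) (by decide)
  have e2 := h 0 1 0 2 (by decide) (by decide)
  have e3 := h 0 1 1 0 (by decide) (by decide)
  have e4 := h 0 1 1 2 (by decide) (by decide)
  have e5 := h 0 1 2 0 (by decide) (by decide)
  have e6 := h 0 1 2 1 (by decide) (by decide)
  have f1 := h 0 2 0 1 (by decide) (by decide)
  have f2 := h 0 2 0 2 (by decide) (by decide)
  have f3 := h 0 2 1 0 (by decide) (by decide)
  have f4 := h 0 2 1 2 (by decide) (by decide)
  have f5 := h 0 2 2 0 (by decide) (by decide)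
  have f6 := h 0 2 2 1 (by decide) (by decide)
  have g1 := h 1 2 0 1 (by decide) (by decide)
  have g2 := h 1 2 0 2 (by decide) (by decide)
  have g3 := h 1 2 1 0 (by decide) (by decide)
  have g4 := h 1 2 1 2 (by decide) (by decide)
  have g5 := h 1 2 2 0 (by decide) (by decide)
  have g6 := h 1 2 2 1 (by decide) (by decide)
  have s1 := hs 0 1 (by decide)
  have s2 := hs 0 2 (by decide)
  have s3 := hs 1 2 (by decide)
  clear h hs
  have key : (1 : ZMod 2) = 0 := by
    linear_combination (norm := (ring_nf; reduce_mod_char)) e1 + e2 + e3 + e4 + e5 + e6 + f1 + f2 + f3 + f4 + f5 + f6 +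
      g1 + g2 + g3 + g4 + g5 + g6 + s1 + s2 + s3
  exact absurd key (by decide)

lemma IsVK.kf (h : IsVK G τ Φ) : KF G := by
  rintro ⟨B, hne, hc, hd, he⟩
  choose r hr using hne
  have hw : ∀ i j, ∃ p : G.Walk (r (false, i)) (r (true, j)),
      ∀ v ∈ p.support, v ∈ B (false, i) ∪ B (true, j) := by
    intro i j
    obtain ⟨x, hx, y, hy, hxy⟩ := he (false, i) (true, j) (by simp)
    exact ((hc _).union_adj (hc _) hx hy hxy).exists_walk (Or.inl (hr _)) (Or.inr (hr _))
  choose P hP using hw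
  have hdis : ∀ p q, p ≠ q → ∀ v ∈ B p, v ∉ B q := fun p q hpq v h1 h2 =>
    (hd p q hpq).le_bot ⟨h1, h2⟩
  have hrne : ∀ p q, p ≠ q → r p ≠ r q := fun p q hpq h => hdis p q hpq _ (hr p) (h ▸ hr q)
  refine no_pairing (fun i i' => τ (r (false, i)) (r (false, i')))
    (fun i i' => τ (r (true, i)) (r (true, i'))) (fun i j => τ (r (false, i)) (r (true, j)))
    (fun j i => τ (r (true, j)) (r (false, i))) (fun i j k => walkSum Φ (P i j) (r (false, k)))
    (fun i j k => walkSum Φ (P i j) (r (true, k))) (fun i j hij => h.tour _ _ (hrne _ _ ?_)) ?_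
  · simpa using hij
  · intro i i' j j' hi hj
    refine h.walk_walk (P i j) (P i' j') fun v hv hv' => ?_
    rcases hP _ _ v hv with h1 | h1 <;> rcases hP _ _ v hv' with h2 | h2 <;>
      exact hdis _ _ (by simp [hi.ne, hj]) v h1 h2

lemma IsVK.of_hom {Q : SimpleGraph W} (h : IsVK G τ Φ) (f : W → U) (hinj : InjOn f Q.support)
    (hf : ∀ a b, Q.Adj a b → G.Adj (f a) (f b)) : ∃ τ' Φ', IsVK Q τ' Φ' := by
  classical
  refine ⟨fun a b => if a ∈ Q.support ∧ b ∈ Q.support then τ (f a) (f b) else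
    if WellOrderingRel a b then 1 else 0, fun a b c => Φ (f a) (f b) (f c), ?_, ?_, ?_⟩
  · intro a b hab
    by_cases hs : a ∈ Q.support ∧ b ∈ Q.support
    · rw [if_pos hs, if_pos (And.comm.1 hs)]
      exact h.tour _ _ fun h => hab (hinj hs.1 hs.2 h)
    · rw [if_neg hs, if_neg (fun h => hs (And.comm.1 h))]
      rcases trichotomous_of WellOrderingRel a b with h | h | h
      · rw [if_pos h, if_neg (asymm h)]; rfl
      · exact absurd h hab
      · rw [if_neg (asymm h), if_pos h]; rfl
  · exact fun a b c => h.symm _ _ _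
  · intro a b c d hab hcd h1 h2 h3 h4
    have ha : a ∈ Q.support := ⟨b, hab⟩
    have hb : b ∈ Q.support := ⟨a, hab.symm⟩
    have hc : c ∈ Q.support := ⟨d, hcd⟩
    have hd : d ∈ Q.support := ⟨c, hcd.symm⟩
    simp only [ha, hb, hc, hd, and_self, if_true]
    exact h.edges _ _ _ _ (hf _ _ hab) (hf _ _ hcd) (fun h => h1 (hinj ha hc h))
      (fun h => h2 (hinj ha hd h)) (fun h => h3 (hinj hb hc h)) (fun h => h4 (hinj hb hd h))

/-- The crossing form of a certificate at a vertex `x`, on the edges incident with `x`. -/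
def cross (τ : U → U → ZMod 2) (Φ : U → U → U → ZMod 2) (x a b : U) : ZMod 2 :=
  τ x b + τ a x + τ a b + Φ x a b + Φ x b a

/-- The crossing form summed over two pairs. -/
def cross4 (τ : U → U → ZMod 2) (Φ : U → U → U → ZMod 2) (x a a' b b' : U) : ZMod 2 :=
  cross τ Φ x a b + cross τ Φ x a' b + cross τ Φ x a b' + cross τ Φ x a' b'

lemma IsVK.cross_comm (h : IsVK G τ Φ) (ha : a ≠ x) (hb : b ≠ x) (hab : a ≠ b) :
    cross τ Φ x a b + cross τ Φ x b a = 1 := by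
  have h1 := h.tour a x ha
  have h2 := h.tour b x hb
  have h3 := h.tour a b hab
  simp only [cross]
  clear h
  grind

lemma IsVK.cross4_eq_zero (h : IsVK G τ Φ) (ha : G.Adj x a) (ha' : G.Adj x a') (hb : G.Adj x b)
    (hb' : G.Adj x b') {A B : Set U} (hA : ConnOn G A) (hB : ConnOn G B) (hAB : Disjoint A B)
    (haA : a ∈ A) (haA' : a' ∈ A) (hbB : b ∈ B) (hbB' : b' ∈ B) (hxA : x ∉ A) (hxB : x ∉ B) :
    cross4 τ Φ x a a' b b' = 0 := by
  obtain ⟨p, hp⟩ := hA.exists_walk haA haA'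
  obtain ⟨q, hq⟩ := hB.exists_walk hbB hbB'
  have hdA : ∀ v ∈ A, v ∉ B := fun v h1 h2 => hAB.le_bot ⟨h1, h2⟩
  have hdB : ∀ v ∈ B, v ∉ A := fun v h1 h2 => hAB.le_bot ⟨h2, h1⟩
  have e1 := h.walk_edge p hb (fun h => hxA (hp _ h)) (fun h => hdB b hbB (hp _ h))
  have e2 := h.walk_edge p hb' (fun h => hxA (hp _ h)) (fun h => hdB b' hbB' (hp _ h))
  have e3 := h.walk_edge q ha (fun h => hxB (hq _ h)) (fun h => hdA a haA (hq _ h))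
  have e4 := h.walk_edge q ha' (fun h => hxB (hq _ h)) (fun h => hdA a' haA' (hq _ h))
  have e5 := h.walk_walk p q (fun v hv hv' => hdA v (hp v hv) (hq v hv'))
  have ne : ∀ u ∈ A, ∀ v ∈ B, u ≠ v := fun u hu v hv huv => hdA u hu (huv ▸ hv)
  have t1 := h.tour a b (ne a haA b hbB)
  have t2 := h.tour a b' (ne a haA b' hbB')
  have t3 := h.tour a' b (ne a' haA' b hbB)
  have t4 := h.tour a' b' (ne a' haA' b' hbB')
  simp only [cross4, cross]
  linear_combination (norm := (ring_nf; reduce_mod_char)) e1 + e2 + e3 + e4 + e5 + t1 + t2 + t3 + t4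

lemma IsVK.cross4_sum (h : IsVK G τ Φ) (hb : b ≠ x) (hc : c ≠ x) (hd : d ≠ x)
    (hbc : b ≠ c) (hbd : b ≠ d) (hcd : c ≠ d) :
    cross4 τ Φ x a b c d + cross4 τ Φ x a c b d + cross4 τ Φ x a d b c = 1 := by
  have h1 := h.cross_comm hb hc hbc
  have h2 := h.cross_comm hb hd hbd
  have h3 := h.cross_comm hc hd hcd
  simp only [cross4]
  linear_combination (norm := (ring_nf; reduce_mod_char)) h1 + h2 + h3

lemma exists_potential (M : U → U → ZMod 2) (X Y : Set U)
    (h3 : ¬ ∃ a b c, a ≠ b ∧ a ≠ c ∧ b ≠ c ∧ a ∈ X ∩ Y ∧ b ∈ X ∩ Y ∧ c ∈ X ∩ Y)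
    (hq : ∀ a ∈ X, ∀ a' ∈ X, ∀ b ∈ Y, ∀ b' ∈ Y, a ≠ a' → b ≠ b' → a ≠ b → a ≠ b' → a' ≠ b →
      a' ≠ b' → M a b + M a' b + M a b' + M a' b' = 0) :
    ∃ φ ψ : U → ZMod 2, ∀ a ∈ X, ∀ b ∈ Y, a ≠ b → M a b = φ a + ψ b := by
  classical
  have hsel : ∀ (Z : Set U) (a : U), ∃ b, ∀ c ∈ Z, c ≠ a → b ∈ Z ∧ b ≠ a := by
    intro Z a
    by_cases h : ∃ b ∈ Z, b ≠ a
    · obtain ⟨b, hb⟩ := h; exact ⟨b, fun _ _ _ => hb⟩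
    · push Not at h; exact ⟨a, fun c hc hca => absurd (h c hc) hca⟩
  by_cases hXY : X ⊆ Y
  · by_cases hYX : Y ⊆ X
    · choose s hs using hsel Y
      refine ⟨fun a => M a (s a), fun _ => 0, fun a ha b hb hab => ?_⟩
      obtain ⟨h1, h2⟩ := hs a b hb hab.symm
      have : s a = b := by
        by_contra hne
        exact h3 ⟨a, b, s a, hab, h2.symm, Ne.symm hne, ⟨ha, hXY ha⟩, ⟨hYX hb, hb⟩, ⟨hYX h1, h1⟩⟩
      simp [this]
    · obtain ⟨b0, hb0, hb0X⟩ := Set.not_subset.1 hYX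
      choose s hs using hsel X
      refine ⟨fun a => M a b0, fun b => M (s b) b + M (s b) b0, fun a ha b hb hab => ?_⟩
      obtain ⟨h1, h2⟩ := hs b a ha hab
      by_cases e1 : s b = a
      · simp only [e1]; grind
      by_cases e2 : b = b0
      · subst e2; grind
      have := hq a ha (s b) h1 b hb b0 hb0 (Ne.symm e1) e2 hab (fun h => hb0X (h ▸ ha)) h2
        (fun h => hb0X (h ▸ h1))
      clear hq hs h3
      grind
  · obtain ⟨a0, ha0, ha0Y⟩ := Set.not_subset.1 hXY
    choose s hs using hsel Y
    refine ⟨fun a => M a (s a) + M a0 (s a), fun b => M a0 b, fun a ha b hb hab => ?_⟩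
    obtain ⟨h1, h2⟩ := hs a b hb hab.symm
    by_cases e1 : s a = b
    · simp only [e1]; grind
    by_cases e2 : a = a0
    · subst e2; grind
    have := hq a ha a0 ha0 b hb (s a) h1 e2 (Ne.symm e1) hab h2.symm (fun h => ha0Y (h ▸ hb))
      (fun h => ha0Y (h ▸ h1))
    clear hq hs h3
    grind

/-- The map identifying `y` with `x`. -/
noncomputable def merge (x y : U) : U → U := by
  classical exact fun a => if a = y then x else a

lemma merge_self : merge x y y = x := by simp [merge]

lemma merge_of_ne (h : a ≠ y) : merge x y a = a := by simp [merge, h]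

lemma merge_ne_merge (h : a ≠ b) (h' : ¬ (x = a ∨ x = b) ∨ ¬ (y = a ∨ y = b)) :
    merge x y a ≠ merge x y b := by
  simp only [merge]
  grind

lemma isVK_of_reduced (ht : ∀ a b, a ≠ b → τ a b + τ b a = 1) (hs : ∀ a b c, Φ a b c = Φ b a c)
    (hgen : ∀ a b c d, ¬ (x = a ∨ x = b ∨ x = c ∨ x = d) ∨ ¬ (y = a ∨ y = b ∨ y = c ∨ y = d) →
      G.Adj a b → G.Adj c d → a ≠ c → a ≠ d → b ≠ c → b ≠ d →
      τ a c + τ a d + τ b c + τ b d = Φ a b c + Φ a b d + Φ c d a + Φ c d b)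
    (hxy : ∀ c d, x ≠ c → x ≠ d → y ≠ c → y ≠ d →
      τ x c + τ x d + τ y c + τ y d = Φ x y c + Φ x y d + Φ c d x + Φ c d y)
    (hxa : ∀ a b, G.Adj x a → G.Adj y b → a ≠ y → b ≠ x → a ≠ b →
      τ x y + τ x b + τ a y + τ a b = Φ x a y + Φ x a b + Φ y b x + Φ y b a)
    (hne : x ≠ y) : IsVK G τ Φ := by
  let E : U → U → U → U → Prop := fun a b c d =>
    τ a c + τ a d + τ b c + τ b d = Φ a b c + Φ a b d + Φ c d a + Φ c d b
  have E1 : ∀ a b c d, E a b c d → E b a c d := by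
    intro a b c d hE
    have := hs a b c; have := hs a b d
    simp only [E] at hE ⊢
    clear hgen hxy hxa ht hs
    grind
  have E2 : ∀ a b c d, a ≠ c → a ≠ d → b ≠ c → b ≠ d → E a b c d → E c d a b := by
    intro a b c d h1 h2 h3 h4 hE
    have e1 := ht a c h1; have e2 := ht a d h2; have e3 := ht b c h3; have e4 := ht b d h4
    simp only [E] at hE ⊢
    linear_combination (norm := (ring_nf; reduce_mod_char)) hE + e1 + e2 + e3 + e4
  have E3 : ∀ a b c d, a ≠ c → a ≠ d → b ≠ c → b ≠ d → E a b c d → E a b d c :=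
    fun a b c d h1 h2 h3 h4 hE => E2 _ _ _ _ h2.symm h4.symm h1.symm h3.symm
      (E1 _ _ _ _ (E2 _ _ _ _ h1 h2 h3 h4 hE))
  refine ⟨ht, hs, fun a b c d hab hcd h1 h2 h3 h4 => ?_⟩
  change E a b c d
  by_cases hx : x = a ∨ x = b ∨ x = c ∨ x = d
  swap
  · exact hgen a b c d (Or.inl hx) hab hcd h1 h2 h3 h4
  by_cases hy : y = a ∨ y = b ∨ y = c ∨ y = d
  swap
  · exact hgen a b c d (Or.inr hy) hab hcd h1 h2 h3 h4
  have hfirst : ∀ b c d, G.Adj x b → G.Adj c d → x ≠ c → x ≠ d → b ≠ c → b ≠ d →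
      (y = b ∨ y = c ∨ y = d) → E x b c d := by
    intro b c d hab hcd h1 h2 h3 h4 hy
    rcases hy with rfl | rfl | rfl
    · exact hxy c d h1 h2 h3 h4
    · exact hxa b d hab hcd h3 h2.symm h4
    · exact E3 _ _ _ _ h2 h1 h4 h3 (hxa b c hab hcd.symm h4 h1.symm h3)
  have hxy' := hne.symm
  clear_value E
  clear hgen hxy hxa ht hs
  rcases hx with rfl | rfl | rfl | rfl
  · exact hfirst b c d hab hcd h1 h2 h3 h4 (by tauto)
  · exact E1 _ _ _ _ (hfirst a c d hab.symm hcd h3 h4 h1 h2 (by tauto))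
  · exact E2 _ _ _ _ h1.symm h3.symm h2.symm h4.symm
      (hfirst d a b hcd hab h1.symm h3.symm h2.symm h4.symm (by tauto))
  · exact E3 _ _ _ _ h2 h1 h4 h3 (E2 _ _ _ _ h2.symm h4.symm h1.symm h3.symm
      (hfirst c a b hcd.symm hab h2.symm h4.symm h1.symm h3.symm (by tauto)))

/-- Uncontracting an edge preserves certificates if the crossing form vanishes. -/
lemma IsVK.uncontract (h : IsVK (quot G (merge x y)) τ Φ) (hxy : x ≠ y)
    (h3 : ¬ ∃ a b c, a ≠ b ∧ a ≠ c ∧ b ≠ c ∧ (G.Adj x a ∧ G.Adj y a) ∧ (G.Adj x b ∧ G.Adj y b) ∧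
      (G.Adj x c ∧ G.Adj y c))
    (hq : ∀ a a' b b', G.Adj x a → G.Adj x a' → G.Adj y b → G.Adj y b' → a ≠ y → a' ≠ y → b ≠ x →
      b' ≠ x → a ≠ a' → b ≠ b' → a ≠ b → a ≠ b' → a' ≠ b → a' ≠ b' →
      cross4 τ Φ x a a' b b' = 0) : ∃ τ' Φ', IsVK G τ' Φ' := by
  classical
  obtain ⟨φ, ψ, hφ⟩ := exists_potential (cross τ Φ x) {a | G.Adj x a ∧ a ≠ y}
    {b | G.Adj y b ∧ b ≠ x} (by
      rintro ⟨a, b, c, h1, h2, h3', h4, h5, h6⟩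
      exact h3 ⟨a, b, c, h1, h2, h3', ⟨h4.1.1, h4.2.1⟩, ⟨h5.1.1, h5.2.1⟩, ⟨h6.1.1, h6.2.1⟩⟩)
    (fun a ha a' ha' b hb b' hb' h1 h2 h3 h4 h5 h6 => hq a a' b b' ha.1 ha'.1 hb.1 hb'.1 ha.2
      ha'.2 hb.2 hb'.2 h1 h2 h3 h4 h5 h6)
  let ρ := merge x y
  have ρy : ρ y = x := merge_self
  have ρn : ∀ a, a ≠ y → ρ a = a := fun a ha => merge_of_ne ha
  let τ' : U → U → ZMod 2 := fun a b =>
    if a = x ∧ b = y then 0 else if a = y ∧ b = x then 1 else τ (ρ a) (ρ b)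
  let Φ' : U → U → U → ZMod 2 := fun a b c =>
    if (a = x ∧ b = y) ∨ (a = y ∧ b = x) then 0 else
    if c = y ∧ a = x then φ b else if c = y ∧ b = x then φ a else
    if c = x ∧ a = y then ψ b else if c = x ∧ b = y then ψ a else Φ (ρ a) (ρ b) (ρ c)
  have ht : ∀ a b, a ≠ b → τ' a b + τ' b a = 1 := by
    intro a b hab
    simp only [τ']
    by_cases h1 : a = x ∧ b = y
    · obtain ⟨rfl, rfl⟩ := h1; simp [hxy]
    by_cases h2 : a = y ∧ b = x
    · obtain ⟨rfl, rfl⟩ := h2; simp [hxy]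
    rw [if_neg h1, if_neg h2, if_neg (fun h => h2 (And.comm.1 h)),
      if_neg (fun h => h1 (And.comm.1 h))]
    refine h.tour _ _ ?_
    simp only [ρ, merge]
    grind
  have hs : ∀ a b c, Φ' a b c = Φ' b a c := by
    intro a b c
    have := h.symm (ρ a) (ρ b) (ρ c)
    simp only [Φ']
    clear hφ hq h3 h
    grind
  refine ⟨τ', Φ', isVK_of_reduced (x := x) (y := y) ht hs ?_ ?_ ?_ hxy⟩
  · intro a b c d hn hab hcd h1 h2 h3 h4
    have hadj : ∀ s t, G.Adj s t → ρ s ≠ ρ t → (quot G ρ).Adj (ρ s) (ρ t) :=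
      fun s t hst hne => ⟨hne, s, t, rfl, rfl, hst⟩
    have h5 := hab.ne
    have h6 := hcd.ne
    have := h.edges (ρ a) (ρ b) (ρ c) (ρ d) (hadj a b hab (merge_ne_merge h5 (by tauto)))
      (hadj c d hcd (merge_ne_merge h6 (by tauto))) (merge_ne_merge h1 (by tauto))
      (merge_ne_merge h2 (by tauto)) (merge_ne_merge h3 (by tauto))
      (merge_ne_merge h4 (by tauto))
    have et : ∀ s t, (¬ (x = s ∨ x = t) ∨ ¬ (y = s ∨ y = t)) → τ' s t = τ (ρ s) (ρ t) := by
      intro s t hst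
      simp only [τ']
      rw [if_neg (by rintro ⟨rfl, rfl⟩; tauto), if_neg (by rintro ⟨rfl, rfl⟩; tauto)]
    have eΦ : ∀ s t u, (¬ (x = s ∨ x = t ∨ x = u) ∨ ¬ (y = s ∨ y = t ∨ y = u)) →
        Φ' s t u = Φ (ρ s) (ρ t) (ρ u) := by
      intro s t u hst
      simp only [Φ']
      rw [if_neg (by rintro (⟨rfl, rfl⟩ | ⟨rfl, rfl⟩) <;> tauto),
        if_neg (by rintro ⟨rfl, rfl⟩; tauto), if_neg (by rintro ⟨rfl, rfl⟩; tauto),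
        if_neg (by rintro ⟨rfl, rfl⟩; tauto), if_neg (by rintro ⟨rfl, rfl⟩; tauto)]
    rw [et, et, et, et, eΦ, eΦ, eΦ, eΦ]
    · exact this
    all_goals
      clear this et eΦ hadj hab hcd h5 h6 ht hs hφ hq h3 h
      tauto
  · intro c d h1 h2 h3 h4
    simp only [τ', Φ', ρy, ρn x hxy, ρn c h3.symm, ρn d h4.symm]
    simp only [h1.symm, h2.symm, h3.symm, h4.symm, hxy, hxy.symm, and_true, and_false, if_false,
      if_true, or_false]
    clear hφ hq h
    grind
  · intro a b hxa hyb hay hbx hab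
    have hax : a ≠ x := hxa.ne'
    have hby : b ≠ y := hyb.ne'
    have hM := hφ a ⟨hxa, hay⟩ b ⟨hyb, hbx⟩ hab
    simp only [cross] at hM
    simp only [τ', Φ', ρy, ρn x hxy, ρn a hay, ρn b hby]
    simp only [hay, hbx, hax, hby, hxy, hxy.symm, and_true, and_false, if_false,
      if_true, and_self, or_self]
    linear_combination (norm := (ring_nf; reduce_mod_char)) hM

end Certificate

section Structure

variable {U : Type*} {G : SimpleGraph U} {S A B : Set U} {a a' b b' c d u v w x y z : U}

lemma exists_side (hA : ¬ ConnOn G A) (hxy : G.Adj x y ∨ x = y) :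
    ∃ D ⊆ A, D.Nonempty ∧ (∀ c ∈ D, ∀ d ∈ A, G.Adj c d → d ∈ D) ∧ (A \ D).Nonempty ∧
      x ∉ D ∧ y ∉ D := by
  unfold ConnOn at hA
  push Not at hA
  obtain ⟨C, hC, hne, hcl, hnot⟩ := hA
  have hcl' : ∀ c ∈ A \ C, ∀ d ∈ A, G.Adj c d → d ∈ A \ C := fun c hc d hd hcd =>
    ⟨hd, fun hdC => hc.2 (hcl d hdC c hc.1 hcd.symm)⟩
  obtain ⟨e, heA, heC⟩ := not_subset.1 hnot
  by_cases h : x ∈ C ∨ y ∈ C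
  · refine ⟨A \ C, sdiff_subset, ⟨e, heA, heC⟩, hcl', ?_, ?_⟩
    · obtain ⟨c, hc⟩ := hne
      exact ⟨c, hC hc, fun h => h.2 hc⟩
    · rcases hxy with hxy | rfl
      · constructor
        · rintro ⟨h1, h2⟩
          exact h2 (hcl y (h.resolve_left h2) x h1 hxy.symm)
        · rintro ⟨h1, h2⟩
          exact h2 (hcl x (h.resolve_right h2) y h1 hxy)
      · simp_all
  · push Not at h
    exact ⟨C, hC, hne, hcl, ⟨e, heA, heC⟩, h.1, h.2⟩

/-- If `C` is nonempty and closed in `A \ {z}`, and `A` is connected and contains `z`,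
then `z` has a neighbour in `C`. -/
lemma ConnOn.exists_adj (hA : ConnOn G A) {C : Set U} (hC : C ⊆ A) (hne : C.Nonempty)
    (hz : z ∈ A) (hzC : z ∉ C) (hcl : ∀ c ∈ C, ∀ d ∈ A, d ≠ z → G.Adj c d → d ∈ C) :
    ∃ c ∈ C, G.Adj z c := by
  by_contra! hn
  refine hzC (hA C hC hne (fun c hc d hd hcd => hcl c hc d hd ?_ hcd) hz)
  rintro rfl
  exact hn c hc hcd.symm

/-- A 3-connected graph has an edge whose contraction leaves it 3-connected. -/
lemma exists_contractible_edge (hS : S.Finite) (h3 : ∀ u w, ConnOn G (S \ {u, w}))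
    (hxy : G.Adj x y) (hx : x ∈ S) (hy : y ∈ S) :
    ∃ x ∈ S, ∃ y ∈ S, G.Adj x y ∧ ∀ z, ConnOn G (S \ {x, y, z}) := by
  by_contra! hbad
  have main : ∀ (n : ℕ) (C : Set U) (x y z : U), C.ncard = n → x ∈ S → y ∈ S → G.Adj x y →
      C ⊆ S \ {x, y, z} → C.Nonempty → (∀ c ∈ C, ∀ d ∈ S \ {x, y, z}, G.Adj c d → d ∈ C) →
      ((S \ {x, y, z}) \ C).Nonempty → False := by
    intro n
    induction n using Nat.strong_induction_on with
    | _ n ih =>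
    intro C x y z hn hx hy hxy hC hne hcl hpr
    have hzS : z ∈ S ∧ z ≠ x ∧ z ≠ y := by
      by_contra hz
      have : S \ {x, y, z} = S \ {x, y} := by
        ext t
        simp only [mem_sdiff, mem_insert_iff, mem_singleton_iff]
        grind
      rw [this] at hC hcl hpr
      obtain ⟨t, ht, htC⟩ := hpr
      exact htC (h3 x y C hC hne hcl ht)
    have hzC : z ∉ C := fun h => (hC h).2 (by simp)
    obtain ⟨v, hvC, hzv⟩ := (h3 x y).exists_adj (z := z) (C := C)
      (fun t ht => ⟨(hC ht).1, fun h => (hC ht).2 (by simp at h ⊢; tauto)⟩) hne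
      ⟨hzS.1, by simp [hzS.2]⟩ hzC (fun c hc d hd hdz hcd => hcl c hc d
        ⟨hd.1, by have := hd.2; simp at this ⊢; tauto⟩ hcd)
    have hvS : v ∈ S := (hC hvC).1
    have hv : v ≠ x ∧ v ≠ y := by have := (hC hvC).2; simp at this; tauto
    obtain ⟨w, hw⟩ := hbad z hzS.1 v hvS hzv
    obtain ⟨D, hD, hDne, hDcl, hDpr, hxD, hyD⟩ := exists_side hw (Or.inl hxy)
    have hvD : v ∉ D := fun h => (hD h).2 (by simp)
    have hvw : v ≠ w := by
      rintro rfl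
      obtain ⟨t, ht, htD⟩ := hDpr
      simp only [insert_eq_of_mem, mem_singleton_iff] at hD hDcl ht
      exact htD (h3 z v D hD hDne hDcl ht)
    obtain ⟨d, hdD, hvd⟩ := (h3 z w).exists_adj (z := v) (C := D)
      (fun t ht => ⟨(hD ht).1, fun h => (hD ht).2 (by simp at h ⊢; tauto)⟩) hDne
      ⟨hvS, by simp [hvw, hzv.ne']⟩ hvD (fun c hc d hd hdz hcd => hDcl c hc d
        ⟨hd.1, by have := hd.2; simp at this ⊢; tauto⟩ hcd)
    have hDsub : ∀ t ∈ D, t ∈ S \ {x, y, z} := by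
      intro t ht
      have := hD ht
      simp only [mem_sdiff, mem_insert_iff, mem_singleton_iff] at this ⊢
      refine ⟨this.1, ?_⟩
      rintro (rfl | rfl | rfl)
      · exact hxD ht
      · exact hyD ht
      · tauto
    have hdC : d ∈ C := hcl v hvC d (hDsub d hdD) hvd
    have hfin : C.Finite := hS.subset fun t ht => (hC ht).1
    refine ih (D ∩ C).ncard ?_ (D ∩ C) z v w rfl hzS.1 hvS hzv (inter_subset_left.trans hD)
      ⟨d, hdD, hdC⟩ ?_ ?_
    · rw [← hn]
      exact ncard_lt_ncard ⟨inter_subset_right, fun h => hvD (h hvC).1⟩ hfin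
    · intro c hc d hd hcd
      have hdD := hDcl c hc.1 d hd hcd
      exact ⟨hdD, hcl c hc.2 d (hDsub d hdD) hcd⟩
    · obtain ⟨t, ht, htD⟩ := hDpr
      exact ⟨t, ht, fun h => htD h.1⟩
  obtain ⟨z, hz⟩ := hbad x hx y hy hxy
  obtain ⟨D, hD, hDne, hDcl, hDpr, -, -⟩ := exists_side hz (Or.inl hxy)
  exact main _ D x y z rfl hx hy hxy hD hDne hDcl hDpr

/-- In a 2-connected graph some edge at `z` can be contracted. -/
lemma exists_contractible_neighbor (hS : S.Finite) (h2 : ∀ z, ConnOn G (S \ {z})) (hz : z ∈ S)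
    (hb : b ∈ S) (haz : a ≠ z) (hbz : b ≠ z) (hab : a ≠ b) :
    ∃ u ∈ S, G.Adj z u ∧ ConnOn G (S \ {z, u}) := by
  by_contra! hbad
  have main : ∀ (n : ℕ) (C : Set U) (u : U), C.ncard = n → u ∈ S → G.Adj z u →
      C ⊆ S \ {z, u} → C.Nonempty → (∀ c ∈ C, ∀ d ∈ S \ {z, u}, G.Adj c d → d ∈ C) →
      False := by
    intro n
    induction n using Nat.strong_induction_on with
    | _ n ih =>
    intro C u hn hu hzu hC hne hcl
    have hzC : z ∉ C := fun h => (hC h).2 (by simp)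
    obtain ⟨v, hvC, hzv⟩ := (h2 u).exists_adj (z := z) (C := C)
      (fun t ht => ⟨(hC ht).1, fun h => (hC ht).2 (by simp at h ⊢; tauto)⟩) hne
      ⟨hz, by simp [hzu.ne]⟩ hzC (fun c hc d hd hdz hcd => hcl c hc d
        ⟨hd.1, by have := hd.2; simp at this ⊢; tauto⟩ hcd)
    have hvS : v ∈ S := (hC hvC).1
    obtain ⟨D, hD, hDne, hDcl, hDpr, huD, -⟩ := exists_side (hbad v hvS hzv) (Or.inr (rfl : u = u))
    have hvD : v ∉ D := fun h => (hD h).2 (by simp)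
    obtain ⟨d, hdD, hvd⟩ := (h2 z).exists_adj (z := v) (C := D)
      (fun t ht => ⟨(hD ht).1, fun h => (hD ht).2 (by simp at h ⊢; tauto)⟩) hDne
      ⟨hvS, by simp [hzv.ne']⟩ hvD (fun c hc d hd hdz hcd => hDcl c hc d
        ⟨hd.1, by have := hd.2; simp at this ⊢; tauto⟩ hcd)
    have hDsub : ∀ t ∈ D, t ∈ S \ {z, u} := by
      intro t ht
      have := hD ht
      simp only [mem_sdiff, mem_insert_iff, mem_singleton_iff] at this ⊢
      refine ⟨this.1, ?_⟩
      rintro (rfl | rfl)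
      · tauto
      · exact huD ht
    have hfin : C.Finite := hS.subset fun t ht => (hC ht).1
    refine ih (D ∩ C).ncard ?_ (D ∩ C) v rfl hvS hzv (inter_subset_left.trans hD)
      ⟨d, hdD, hcl v hvC d (hDsub d hdD) hvd⟩ ?_
    · rw [← hn]
      exact ncard_lt_ncard ⟨inter_subset_right, fun h => hvD (h hvC).1⟩ hfin
    · intro c hc d hd hcd
      have hdD := hDcl c hc.1 d hd hcd
      exact ⟨hdD, hcl c hc.2 d (hDsub d hdD) hcd⟩
  obtain ⟨c, hc, hzc⟩ := (h2 a).exists_adj (z := z) (C := S \ {a, z})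
    (fun t ht => ⟨ht.1, fun h => ht.2 (by simp at h ⊢; tauto)⟩)
    ⟨b, hb, by simp [hbz, hab.symm]⟩ ⟨hz, by simp [haz.symm]⟩ (by simp)
    (fun c hc d hd hdz hcd => ⟨hd.1, by have := hd.2; simp at this ⊢; tauto⟩)
  obtain ⟨D, hD, hDne, hDcl, -⟩ := exists_side (hbad c hc.1 hzc) (Or.inr (rfl : a = a))
  exact main _ D c rfl hc.1 hzc hD hDne hDcl

lemma merge_fiber (hxy : G.Adj x y) (w : U) : ConnOn G (merge x y ⁻¹' {w}) := by
  by_cases hw : w = x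
  · have : merge x y ⁻¹' {w} = {x, y} := by
      ext t
      simp only [mem_preimage, mem_singleton_iff, merge, hw, mem_insert_iff]
      have := hxy.ne
      grind
    rw [this]
    exact connOn_pair hxy
  · intro C hC ⟨c, hc⟩ _ d hd
    have h1 := hC hc
    simp only [mem_preimage, mem_singleton_iff, merge] at h1 hd
    split_ifs at h1 hd <;> simp_all

lemma quot_merge_adj (hab : G.Adj a b) (ha : a ≠ y) (hb : b ≠ y) :
    (quot G (merge x y)).Adj a b :=
  ⟨hab.ne, a, b, merge_of_ne ha, merge_of_ne hb, hab⟩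

lemma quot_merge_adj' (hb : G.Adj y b) (hby : b ≠ x) : (quot G (merge x y)).Adj x b :=
  ⟨hby.symm, y, b, merge_self, merge_of_ne hb.ne', hb⟩

lemma adj_of_quot_merge (h : (quot G (merge x y)).Adj a b) (ha : a ≠ x) :
    a ≠ y ∧ ((b ≠ x ∧ b ≠ y ∧ G.Adj a b) ∨ (b = x ∧ (G.Adj a x ∨ G.Adj a y))) := by
  obtain ⟨hne, a', b', h1, h2, h3⟩ := h
  simp only [merge] at h1 h2
  split_ifs at h1 h2 <;> grind

lemma ConnOn.merge_mem (hA : ConnOn G A) (hx : x ∈ A) (hxy : x ≠ y) :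
    ConnOn (quot G (merge x y)) (A \ {y}) := by
  have : A \ {y} = merge x y '' A := by
    ext t
    simp only [mem_sdiff, mem_singleton_iff, mem_image, merge]
    constructor
    · rintro ⟨h1, h2⟩; exact ⟨t, h1, by simp [h2]⟩
    · rintro ⟨s, hs, rfl⟩
      split_ifs with h
      · exact ⟨hx, hxy⟩
      · exact ⟨hs, h⟩
  rw [this]
  refine hA.image fun s _ t _ hst => ?_
  by_cases h : merge x y s = merge x y t
  · exact Or.inl h
  · exact Or.inr ⟨h, s, t, rfl, rfl, hst⟩

lemma ConnOn.merge_notMem (hA : ConnOn G A) (hy : y ∉ A) :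
    ConnOn (quot G (merge x y)) A :=
  hA.mono fun _ hc _ hd hcd => quot_merge_adj hcd (fun h => hy (h ▸ hc)) (fun h => hy (h ▸ hd))

lemma ConnOn.of_merge (hA : ConnOn (quot G (merge x y)) A) (hxy : G.Adj x y) :
    ConnOn G (merge x y ⁻¹' A) :=
  hA.preimage (fun w _ => merge_fiber hxy w) fun _ _ _ _ h => h.2

/-- Four disjoint connected subsets of `S` containing `a`, `b`, `c`, `d`, cyclically adjacent. -/
structure CycleModel (G : SimpleGraph U) (S : Set U) (a b c d : U) (A B C D : Set U) : Prop where
  sub : A ⊆ S ∧ B ⊆ S ∧ C ⊆ S ∧ D ⊆ S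
  mem : a ∈ A ∧ b ∈ B ∧ c ∈ C ∧ d ∈ D
  conn : ConnOn G A ∧ ConnOn G B ∧ ConnOn G C ∧ ConnOn G D
  disj : Disjoint A B ∧ Disjoint A C ∧ Disjoint A D ∧ Disjoint B C ∧ Disjoint B D ∧ Disjoint C D
  adj : (∃ s ∈ A, ∃ t ∈ B, G.Adj s t) ∧ (∃ s ∈ B, ∃ t ∈ C, G.Adj s t) ∧
    (∃ s ∈ C, ∃ t ∈ D, G.Adj s t) ∧ ∃ s ∈ D, ∃ t ∈ A, G.Adj s t

/-- A cycle minor rooted at `a`, `b`, `c`, `d` in this cyclic order. -/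
def RootedCycle (G : SimpleGraph U) (S : Set U) (a b c d : U) : Prop :=
  ∃ A B C D, CycleModel G S a b c d A B C D

lemma RootedCycle.of_merge {u z : U} (hzu : G.Adj u z) (hz : z ∈ S) (ha : a ≠ z)
    (hb : b ≠ z) (hc : c ≠ z) (hd : d ≠ z)
    (h : RootedCycle (quot G (merge u z)) (S \ {z}) a b c d) : RootedCycle G S a b c d := by
  obtain ⟨A, B, C, D, h⟩ := h
  have hsub : ∀ A ⊆ S \ {z}, merge u z ⁻¹' A ⊆ S := by
    intro A hA t ht
    by_cases htz : t = z
    · rw [htz]; exact hz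
    · rw [mem_preimage, merge_of_ne htz] at ht; exact (hA ht).1
  have hmem : ∀ (A : Set U) a, a ≠ z → a ∈ A → a ∈ merge u z ⁻¹' A := by
    intro A a ha haA
    rw [mem_preimage, merge_of_ne ha]; exact haA
  have hadj : ∀ A B : Set U, (∃ s ∈ A, ∃ t ∈ B, (quot G (merge u z)).Adj s t) →
      ∃ s ∈ merge u z ⁻¹' A, ∃ t ∈ merge u z ⁻¹' B, G.Adj s t := by
    rintro A B ⟨_, hs, _, ht, -, s, t, rfl, rfl, hst⟩
    exact ⟨s, hs, t, ht, hst⟩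
  obtain ⟨s1, s2, s3, s4⟩ := h.sub
  obtain ⟨m1, m2, m3, m4⟩ := h.mem
  obtain ⟨c1, c2, c3, c4⟩ := h.conn
  obtain ⟨d1, d2, d3, d4, d5, d6⟩ := h.disj
  obtain ⟨e1, e2, e3, e4⟩ := h.adj
  exact ⟨_, _, _, _, ⟨hsub _ s1, hsub _ s2, hsub _ s3, hsub _ s4⟩,
    ⟨hmem _ _ ha m1, hmem _ _ hb m2, hmem _ _ hc m3, hmem _ _ hd m4⟩,
    ⟨c1.of_merge hzu, c2.of_merge hzu, c3.of_merge hzu, c4.of_merge hzu⟩,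
    ⟨d1.preimage _, d2.preimage _, d3.preimage _, d4.preimage _, d5.preimage _, d6.preimage _⟩,
    ⟨hadj _ _ e1, hadj _ _ e2, hadj _ _ e3, hadj _ _ e4⟩⟩

lemma rootedCycle_of_adj (ha : a ∈ S) (hb : b ∈ S) (hc : c ∈ S) (hd : d ∈ S)
    (hac : a ≠ c) (hbd : b ≠ d) (h1 : G.Adj a b) (h2 : G.Adj b c) (h3 : G.Adj c d)
    (h4 : G.Adj d a) : RootedCycle G S a b c d := by
  have := h1.ne; have := h2.ne; have := h3.ne; have := h4.ne'
  exact ⟨{a}, {b}, {c}, {d}, by simp [ha, hb, hc, hd], by simp,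
    ⟨connOn_singleton, connOn_singleton, connOn_singleton, connOn_singleton⟩,
    by simp_all, by simp_all⟩

lemma ConnOn.triple (h : ConnOn G {a, b, c}) (hab : a ≠ b) (hac : a ≠ c) (hbc : b ≠ c) :
    (G.Adj a b ∧ G.Adj a c) ∨ (G.Adj a b ∧ G.Adj b c) ∨ (G.Adj a c ∧ G.Adj b c) := by
  have h1 := h.exists_adj (C := {b, c}) (z := a) (by simp) (by simp) (by simp) (by simp [hab, hac])
    (by simp)
  have h2 := h.exists_adj (C := {a, c}) (z := b) (by intro; simp; tauto) (by simp) (by simp)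
    (by simp [hab.symm, hbc]) (by simp)
  have h3 := h.exists_adj (C := {a, b}) (z := c) (by intro; simp; tauto) (by simp) (by simp)
    (by simp [hac.symm, hbc.symm]) (by simp)
  simp only [mem_insert_iff, mem_singleton_iff, exists_eq_or_imp, exists_eq_left] at h1 h2 h3
  have := G.adj_comm b a; have := G.adj_comm c a; have := G.adj_comm c b
  tauto

/-- Four vertices of a 2-connected graph are the roots of a cycle minor in some order. -/
lemma exists_rootedCycle (hS : S.Finite) (h2 : ∀ z, ConnOn G (S \ {z})) (ha : a ∈ S) (hb : b ∈ S)
    (hc : c ∈ S) (hd : d ∈ S) (hab : a ≠ b) (hac : a ≠ c) (had : a ≠ d) (hbc : b ≠ c)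
    (hbd : b ≠ d) (hcd : c ≠ d) :
    RootedCycle G S a b c d ∨ RootedCycle G S a b d c ∨ RootedCycle G S a c b d := by
  induction hn : S.ncard generalizing S G with
  | zero => exact absurd ((ncard_eq_zero hS).1 hn ▸ ha) (by simp)
  | succ n ih =>
  by_cases hz : ∃ z ∈ S, z ≠ a ∧ z ≠ b ∧ z ≠ c ∧ z ≠ d
  · obtain ⟨z, hz, hza, hzb, hzc, hzd⟩ := hz
    obtain ⟨u, hu, hzu, hcon⟩ := exists_contractible_neighbor hS h2 hz hb hza.symm hzb.symm hab
    have hne := hzu.ne'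
    have := ih (G := quot G (merge u z)) (S := S \ {z}) (hS.subset sdiff_subset) ?_ ⟨ha, hza.symm⟩
      ⟨hb, hzb.symm⟩ ⟨hc, hzc.symm⟩ ⟨hd, hzd.symm⟩ ?_
    · refine this.imp ?_ (Or.imp ?_ ?_) <;> apply RootedCycle.of_merge hzu.symm hz <;>
        first | exact hza.symm | exact hzb.symm | exact hzc.symm | exact hzd.symm
    · intro w
      by_cases hw : w = u
      · subst hw
        rw [sdiff_sdiff, ← insert_eq]
        exact hcon.merge_notMem (by simp)
      · rw [sdiff_sdiff, union_comm, ← sdiff_sdiff]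
        exact (h2 w).merge_mem ⟨hu, Ne.symm hw⟩ hne
    · rw [ncard_sdiff_singleton_of_mem hz, hn]; rfl
  · push Not at hz
    have hS4 : S = {a, b, c, d} := by
      ext t
      simp only [mem_insert_iff, mem_singleton_iff]
      constructor
      · intro ht; have := hz t ht; tauto
      · rintro (rfl | rfl | rfl | rfl) <;> assumption
    have e1 : S \ {a} = {b, c, d} := by rw [hS4]; ext; simp; grind
    have e2 : S \ {b} = {a, c, d} := by rw [hS4]; ext; simp; grind
    have e3 : S \ {c} = {a, b, d} := by rw [hS4]; ext; simp; grind
    have e4 : S \ {d} = {a, b, c} := by rw [hS4]; ext; simp; grind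
    have t1 := (e1 ▸ h2 a).triple hbc hbd hcd
    have t2 := (e2 ▸ h2 b).triple hac had hcd
    have t3 := (e3 ▸ h2 c).triple hab had hbd
    have t4 := (e4 ▸ h2 d).triple hab hac hbc
    have key : (G.Adj a b ∧ G.Adj b c ∧ G.Adj c d ∧ G.Adj a d) ∨
        (G.Adj a b ∧ G.Adj b d ∧ G.Adj c d ∧ G.Adj a c) ∨
        (G.Adj a c ∧ G.Adj b c ∧ G.Adj b d ∧ G.Adj a d) := by
      clear * - t1 t2 t3 t4
      generalize G.Adj a b = p, G.Adj a c = q, G.Adj a d = r, G.Adj b c = s, G.Adj b d = t,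
        G.Adj c d = o at *
      by_cases p <;> by_cases q <;> by_cases r <;> (simp_all; try tauto)
    rcases key with ⟨k1, k2, k3, k4⟩ | ⟨k1, k2, k3, k4⟩ | ⟨k1, k2, k3, k4⟩
    · exact Or.inl (rootedCycle_of_adj ha hb hc hd hac hbd k1 k2 k3 k4.symm)
    · exact Or.inr (Or.inl (rootedCycle_of_adj ha hb hd hc had hbc k1 k2 k3.symm k4.symm))
    · exact Or.inr (Or.inr (rootedCycle_of_adj ha hc hb hd hab hcd k1 k2.symm k3 k4.symm))

/-- Disjoint connected subsets of `S` joining `a` to `a'` and `b` to `b'`. -/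
def Linked (G : SimpleGraph U) (S : Set U) (a a' b b' : U) : Prop :=
  ∃ A ⊆ S, ∃ B ⊆ S, ConnOn G A ∧ ConnOn G B ∧ Disjoint A B ∧ a ∈ A ∧ a' ∈ A ∧ b ∈ B ∧ b' ∈ B

lemma RootedCycle.linked (h : RootedCycle G S a b c d) : Linked G S a b c d := by
  obtain ⟨A, B, C, D, h⟩ := h
  obtain ⟨s1, s2, s3, s4⟩ := h.sub
  obtain ⟨m1, m2, m3, m4⟩ := h.mem
  obtain ⟨c1, c2, c3, c4⟩ := h.conn
  obtain ⟨d1, d2, d3, d4, d5, d6⟩ := h.disj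
  obtain ⟨⟨s, hs, t, ht, hst⟩, -, ⟨s', hs', t', ht', hst'⟩, -⟩ := h.adj
  refine ⟨A ∪ B, union_subset s1 s2, C ∪ D, union_subset s3 s4, c1.union_adj c2 hs ht hst,
    c3.union_adj c4 hs' ht' hst', ?_, Or.inl m1, Or.inr m2, Or.inl m3, Or.inr m4⟩
  simp only [disjoint_union_left, disjoint_union_right]
  exact ⟨⟨d2, d4⟩, d3, d5⟩

lemma RootedCycle.rotate (h : RootedCycle G S a b c d) : RootedCycle G S b c d a := by
  obtain ⟨A, B, C, D, h⟩ := h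
  obtain ⟨s1, s2, s3, s4⟩ := h.sub
  obtain ⟨m1, m2, m3, m4⟩ := h.mem
  obtain ⟨c1, c2, c3, c4⟩ := h.conn
  obtain ⟨d1, d2, d3, d4, d5, d6⟩ := h.disj
  obtain ⟨e1, e2, e3, e4⟩ := h.adj
  exact ⟨B, C, D, A, ⟨s2, s3, s4, s1⟩, ⟨m2, m3, m4, m1⟩, ⟨c2, c3, c4, c1⟩,
    ⟨d4, d5, d1.symm, d6, d2.symm, d3.symm⟩, e2, e3, e4, e1⟩

lemma Linked.swap_right (h : Linked G S a a' b b') : Linked G S a a' b' b := by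
  obtain ⟨A, hA, B, hB, h1, h2, h3, h4, h5, h6, h7⟩ := h
  exact ⟨A, hA, B, hB, h1, h2, h3, h4, h5, h7, h6⟩

lemma linked_or_rootedCycle (hS : S.Finite) (h2 : ∀ z, ConnOn G (S \ {z})) (ha : a ∈ S)
    (ha' : a' ∈ S) (hb : b ∈ S) (hb' : b' ∈ S) (haa' : a ≠ a') (hab : a ≠ b) (hab' : a ≠ b')
    (ha'b : a' ≠ b) (ha'b' : a' ≠ b') (hbb' : b ≠ b') :
    Linked G S a a' b b' ∨ RootedCycle G S a b a' b' := by
  rcases exists_rootedCycle hS h2 ha ha' hb hb' haa' hab hab' ha'b ha'b' hbb' with h | h | h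
  · exact Or.inl h.linked
  · exact Or.inl h.linked.swap_right
  · exact Or.inr h

end Structure

section VanKampen

variable {U : Type*} {G : SimpleGraph U} {S A B C : Set U} {a a' b b' c d u v w x y z : U}
  {c₁ c₂ c₃ : U}

lemma common_aux (hG : KF G) (hxy : G.Adj x y) (h : ∀ z, ConnOn G (S \ {x, y, z}))
    (h1 : G.Adj x c₁ ∧ G.Adj y c₁) (h2 : G.Adj x c₂ ∧ G.Adj y c₂)
    (h3 : G.Adj x c₃) (m1 : c₁ ∈ S) (m2 : c₂ ∈ S) (m3 : c₃ ∈ S) (h12 : c₁ ≠ c₂) (h13 : c₁ ≠ c₃)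
    (h23 : c₂ ≠ c₃) (h3y : c₃ ≠ y)
    (hC : ∀ t ∈ C, t ∈ S ∧ t ≠ x ∧ t ≠ y ∧ t ≠ c₁ ∧ t ≠ c₂ ∧ t ≠ c₃) (hne : C.Nonempty)
    (hcon : ConnOn G C)
    (hcl : ∀ c ∈ C, ∀ d ∈ S, d ≠ x → d ≠ y → d ≠ c₁ → d ≠ c₂ → G.Adj c d → d ∈ C)
    (hxC : ∃ c ∈ C, G.Adj x c) : False := by
  have n1 := h1.1.ne'; have n1' := h1.2.ne'; have n2 := h2.1.ne'; have n2' := h2.2.ne'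
  have n3 := h3.ne'
  have hx : x ≠ y := hxy.ne
  let T := S \ {x, y, c₁, c₂}
  have h3T : c₃ ∈ T := ⟨m3, by simp [n3, h3y, h13.symm, h23.symm]⟩
  let D := comp G T c₃
  have hDT : ∀ t ∈ D, t ∈ S ∧ t ≠ x ∧ t ≠ y ∧ t ≠ c₁ ∧ t ≠ c₂ := by
    intro t ht
    have := comp_subset ht
    simpa [T] using this
  have hDcl : ∀ c ∈ D, ∀ d ∈ S, d ≠ x → d ≠ y → d ≠ c₁ → d ≠ c₂ → G.Adj c d → d ∈ D :=
    fun c hc d hd e1 e2 e3 e4 hcd => comp_closed c hc d ⟨hd, by simp [e1, e2, e3, e4]⟩ hcd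
  have hD3 : c₃ ∈ D := mem_comp_self h3T
  have hCD : Disjoint D C := by
    rw [Set.disjoint_left]
    intro t ht htC
    have hcomp : D ⊆ C := by
      have := comp_connOn (G := G) h3T (D ∩ C) inter_subset_left ⟨t, ht, htC⟩ ?_
      · exact fun s hs => (this hs).2
      · intro s hs r hr hsr
        have := hDT r hr
        exact ⟨hr, hcl s hs.2 r this.1 this.2.1 this.2.2.1 this.2.2.2.1 this.2.2.2.2 hsr⟩
    exact (hC _ (hcomp hD3)).2.2.2.2.2 rfl
  have key : ∀ E : Set U, (∀ t ∈ E, t ∈ S ∧ t ≠ x ∧ t ≠ y ∧ t ≠ c₁ ∧ t ≠ c₂) → E.Nonempty →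
      (∀ c ∈ E, ∀ d ∈ S, d ≠ x → d ≠ y → d ≠ c₁ → d ≠ c₂ → G.Adj c d → d ∈ E) →
      (∃ c ∈ E, G.Adj c₁ c) ∧ ∃ c ∈ E, G.Adj c₂ c := by
    intro E hE hEne hEcl
    constructor
    · refine (h c₂).exists_adj (fun t ht => ⟨(hE t ht).1, by simp [hE t ht]⟩) hEne
        ⟨m1, by simp [n1, n1', h12]⟩ (fun h => (hE _ h).2.2.2.1 rfl) fun c hc d hd hd1 hcd => ?_
      have := hd.2
      simp only [mem_insert_iff, mem_singleton_iff, not_or] at this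
      exact hEcl c hc d hd.1 this.1 this.2.1 hd1 this.2.2 hcd
    · refine (h c₁).exists_adj (fun t ht => ⟨(hE t ht).1, by simp [hE t ht]⟩) hEne
        ⟨m2, by simp [n2, n2', h12.symm]⟩ (fun h => (hE _ h).2.2.2.2 rfl) fun c hc d hd hd1 hcd => ?_
      have := hd.2
      simp only [mem_insert_iff, mem_singleton_iff, not_or] at this
      exact hEcl c hc d hd.1 this.1 this.2.1 this.2.2 hd1 hcd
  obtain ⟨⟨p1, hp1, q1⟩, p2, hp2, q2⟩ := key D hDT ⟨_, hD3⟩ hDcl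
  obtain ⟨⟨p3, hp3, q3⟩, p4, hp4, q4⟩ := key C (fun t ht => ⟨(hC t ht).1, (hC t ht).2.1,
    (hC t ht).2.2.1, (hC t ht).2.2.2.1, (hC t ht).2.2.2.2.1⟩) hne hcl
  obtain ⟨p5, hp5, q5⟩ := hxC
  have dC : x ∉ C ∧ y ∉ C ∧ c₁ ∉ C ∧ c₂ ∉ C := by
    refine ⟨?_, ?_, ?_, ?_⟩ <;> intro h <;> have := hC _ h <;> simp at this
  have dD : x ∉ D ∧ y ∉ D ∧ c₁ ∉ D ∧ c₂ ∉ D := by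
    refine ⟨?_, ?_, ?_, ?_⟩ <;> intro h <;> have := hDT _ h <;> simp at this
  refine hG (HasK33.mk6 (X₀ := {x}) (X₁ := {c₁}) (X₂ := {c₂}) (Y₀ := {y}) (Y₁ := D) (Y₂ := C)
    (by simp) ⟨by simp, ⟨_, hD3⟩, hne⟩ ⟨connOn_singleton, connOn_singleton, connOn_singleton⟩
    ⟨connOn_singleton, comp_connOn h3T, hcon⟩ ?_ ?_ ?_ ?_ ?_ ?_ ?_ ?_ ?_ ?_ ?_ ?_ ?_ ?_)
  · simp [n1.symm, n2.symm, h12]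
  · simp [dC, dD, hCD]
  · simp [dC, dD, hx]
  · simp [dC, dD, n1']
  · simp [dC, dD, n2']
  · simpa using hxy
  · exact ⟨x, rfl, c₃, hD3, h3⟩
  · exact ⟨x, rfl, p5, hp5, q5⟩
  · simpa using h1.2.symm
  · exact ⟨c₁, rfl, p1, hp1, q1⟩
  · exact ⟨c₁, rfl, p3, hp3, q3⟩
  · simpa using h2.2.symm
  · exact ⟨c₂, rfl, p2, hp2, q2⟩
  · exact ⟨c₂, rfl, p4, hp4, q4⟩

lemma common_aux' (hG : KF G) (hxy : G.Adj x y) (h : ∀ z, ConnOn G (S \ {x, y, z}))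
    (h2 : ConnOn G (S \ {c₁, c₂}))
    (e1 : G.Adj x c₁ ∧ G.Adj y c₁) (e2 : G.Adj x c₂ ∧ G.Adj y c₂)
    (e3 : G.Adj x c₃ ∧ G.Adj y c₃) (m1 : c₁ ∈ S) (m2 : c₂ ∈ S) (m3 : c₃ ∈ S) (h12 : c₁ ≠ c₂)
    (h13 : c₁ ≠ c₃) (h23 : c₂ ≠ c₃)
    (hC : ∀ t ∈ C, t ∈ S ∧ t ≠ x ∧ t ≠ y ∧ t ≠ c₁ ∧ t ≠ c₂ ∧ t ≠ c₃) (hne : C.Nonempty)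
    (hcon : ConnOn G C)
    (hcl : ∀ c ∈ C, ∀ d ∈ S, d ≠ x → d ≠ y → d ≠ c₁ → d ≠ c₂ → d ≠ c₃ → G.Adj c d → d ∈ C)
    (hn : ∀ c ∈ C, ¬ G.Adj c₃ c) : False := by
  have hcl' : ∀ c ∈ C, ∀ d ∈ S, d ≠ x → d ≠ y → d ≠ c₁ → d ≠ c₂ → G.Adj c d → d ∈ C := by
    intro c hc d hd f1 f2 f3 f4 hcd
    refine hcl c hc d hd f1 f2 f3 f4 ?_ hcd
    rintro rfl
    exact hn c hc hcd.symm
  by_cases hxC : ∃ c ∈ C, G.Adj x c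
  · exact common_aux hG hxy h e1 e2 e3.1 m1 m2 m3 h12 h13 h23 e3.2.ne' hC hne hcon hcl' hxC
  by_cases hyC : ∃ c ∈ C, G.Adj y c
  · refine common_aux (x := y) (y := x) hG hxy.symm (fun z => ?_) e1.symm e2.symm e3.2 m1 m2 m3 h12
      h13 h23 e3.1.ne' (fun t ht => ?_) hne hcon (fun c hc d hd f1 f2 => hcl' c hc d hd f2 f1) hyC
    · rw [insert_comm]; exact h z
    · have := hC t ht; tauto
  · push Not at hxC hyC
    refine (hC c₃ (h2 C (fun t ht => ⟨(hC t ht).1, by simp [hC t ht]⟩) hne ?_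
      ⟨m3, by simp [h13.symm, h23.symm]⟩)).2.2.2.2.2 rfl
    intro c hc d hd hcd
    have := hd.2
    simp only [mem_insert_iff, mem_singleton_iff, not_or] at this
    refine hcl' c hc d hd.1 ?_ ?_ this.1 this.2 hcd
    · rintro rfl; exact hxC c hc hcd.symm
    · rintro rfl; exact hyC c hc hcd.symm

/-- An edge with three common neighbours whose contraction is 3-connected lies in a `K₅`. -/
lemma eq_of_three_common (hG : KF G) (h3 : ∀ u w, ConnOn G (S \ {u, w})) (hxy : G.Adj x y)
    (h : ∀ z, ConnOn G (S \ {x, y, z}))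
    (e1 : G.Adj x c₁ ∧ G.Adj y c₁) (e2 : G.Adj x c₂ ∧ G.Adj y c₂)
    (e3 : G.Adj x c₃ ∧ G.Adj y c₃) (mx : x ∈ S) (my : y ∈ S) (m1 : c₁ ∈ S) (m2 : c₂ ∈ S)
    (m3 : c₃ ∈ S) (h12 : c₁ ≠ c₂) (h13 : c₁ ≠ c₃) (h23 : c₂ ≠ c₃) :
    S = {x, y, c₁, c₂, c₃} := by
  by_contra hne
  have : ∃ v ∈ S, v ≠ x ∧ v ≠ y ∧ v ≠ c₁ ∧ v ≠ c₂ ∧ v ≠ c₃ := by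
    by_contra! hv
    refine hne (Subset.antisymm (fun t ht => ?_) ?_)
    · have := hv t ht
      simp only [mem_insert_iff, mem_singleton_iff]
      tauto
    · simp [insert_subset_iff, *]
  obtain ⟨v, hv, hv'⟩ := this
  let T := S \ {x, y, c₁, c₂, c₃}
  have hvT : v ∈ T := ⟨hv, by simp [hv']⟩
  let C := comp G T v
  have hC : ∀ t ∈ C, t ∈ S ∧ t ≠ x ∧ t ≠ y ∧ t ≠ c₁ ∧ t ≠ c₂ ∧ t ≠ c₃ := fun t ht => by
    simpa [T] using comp_subset ht
  have hcl : ∀ c ∈ C, ∀ d ∈ S, d ≠ x → d ≠ y → d ≠ c₁ → d ≠ c₂ → d ≠ c₃ → G.Adj c d → d ∈ C :=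
    fun c hc d hd f1 f2 f3 f4 f5 hcd => comp_closed c hc d ⟨hd, by simp [*]⟩ hcd
  have hcon : ConnOn G C := comp_connOn hvT
  have hCne : C.Nonempty := ⟨v, mem_comp_self hvT⟩
  by_cases n1 : ∃ c ∈ C, G.Adj c₁ c
  · by_cases n2 : ∃ c ∈ C, G.Adj c₂ c
    · by_cases n3 : ∃ c ∈ C, G.Adj c₃ c
      · obtain ⟨p1, hp1, q1⟩ := n1
        obtain ⟨p2, hp2, q2⟩ := n2
        obtain ⟨p3, hp3, q3⟩ := n3
        have dC : x ∉ C ∧ y ∉ C ∧ c₁ ∉ C ∧ c₂ ∉ C ∧ c₃ ∉ C := by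
          refine ⟨?_, ?_, ?_, ?_, ?_⟩ <;> intro h <;> have := hC _ h <;> simp at this
        have i1 := e1.1.ne; have i1' := e1.2.ne; have i2 := e2.1.ne; have i2' := e2.2.ne
        have i3 := e3.1.ne; have i3' := e3.2.ne
        refine hG (HasK33.mk6 (X₀ := {x}) (X₁ := {y}) (X₂ := C) (Y₀ := {c₁}) (Y₁ := {c₂})
          (Y₂ := {c₃}) ⟨by simp, by simp, hCne⟩ (by simp) ⟨connOn_singleton, connOn_singleton, hcon⟩
          ⟨connOn_singleton, connOn_singleton, connOn_singleton⟩ ?_ ?_ ?_ ?_ ?_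
          ?_ ?_ ?_ ?_ ?_ ?_ ?_ ?_ ?_)
        · simp [dC, hxy.ne]
        · simp [h12, h13, h23]
        · simp [i1, i2, i3]
        · simp [i1', i2', i3']
        · simp [dC]
        · simpa using e1.1
        · simpa using e2.1
        · simpa using e3.1
        · simpa using e1.2
        · simpa using e2.2
        · simpa using e3.2
        · exact ⟨p1, hp1, c₁, rfl, q1.symm⟩
        · exact ⟨p2, hp2, c₂, rfl, q2.symm⟩
        · exact ⟨p3, hp3, c₃, rfl, q3.symm⟩
      · exact common_aux' hG hxy h (h3 _ _) e1 e2 e3 m1 m2 m3 h12 h13 h23 hC hCne hcon hcl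
          (by push Not at n3; exact n3)
    · exact common_aux' hG hxy h (h3 _ _) e1 e3 e2 m1 m3 m2 h13 h12 h23.symm
        (fun t ht => by have := hC t ht; tauto) hCne hcon
        (fun c hc d hd f1 f2 f3 f4 f5 => hcl c hc d hd f1 f2 f3 f5 f4) (by push Not at n2; exact n2)
  · exact common_aux' hG hxy h (h3 _ _) e2 e3 e1 m2 m3 m1 h23 h12.symm h13.symm
      (fun t ht => by have := hC t ht; tauto) hCne hcon
      (fun c hc d hd f1 f2 f3 f4 f5 => hcl c hc d hd f1 f2 f5 f3 f4) (by push Not at n1; exact n1)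

lemma ConnOn.adj_of_pair (h : ConnOn G {a, b}) (hab : a ≠ b) : G.Adj a b := by
  simpa using h.exists_adj (C := {b}) (z := a) (by simp) (by simp) (by simp) (by simp [hab])
    (by simp +contextual)

lemma complete_of_three_common (hG : KF G) (h3 : ∀ u w, ConnOn G (S \ {u, w})) (hxy : G.Adj x y)
    (h : ∀ z, ConnOn G (S \ {x, y, z}))
    (e1 : G.Adj x c₁ ∧ G.Adj y c₁) (e2 : G.Adj x c₂ ∧ G.Adj y c₂)
    (e3 : G.Adj x c₃ ∧ G.Adj y c₃) (mx : x ∈ S) (my : y ∈ S) (m1 : c₁ ∈ S) (m2 : c₂ ∈ S)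
    (m3 : c₃ ∈ S) (h12 : c₁ ≠ c₂) (h13 : c₁ ≠ c₃) (h23 : c₂ ≠ c₃) :
    S.ncard = 5 ∧ ∀ a ∈ S, ∀ b ∈ S, a ≠ b → G.Adj a b := by
  have hS := eq_of_three_common hG h3 hxy h e1 e2 e3 mx my m1 m2 m3 h12 h13 h23
  have i0 := hxy.ne
  have i1 := e1.1.ne; have i1' := e1.2.ne; have i2 := e2.1.ne; have i2' := e2.2.ne
  have i3 := e3.1.ne; have i3' := e3.2.ne
  have p1 : S \ {x, y, c₁} = {c₂, c₃} := by
    rw [hS]; ext t; simp only [mem_sdiff, mem_insert_iff, mem_singleton_iff]; grind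
  have p2 : S \ {x, y, c₂} = {c₁, c₃} := by
    rw [hS]; ext t; simp only [mem_sdiff, mem_insert_iff, mem_singleton_iff]; grind
  have p3 : S \ {x, y, c₃} = {c₁, c₂} := by
    rw [hS]; ext t; simp only [mem_sdiff, mem_insert_iff, mem_singleton_iff]; grind
  have q1 := (p1 ▸ h c₁).adj_of_pair h23
  have q2 := (p2 ▸ h c₂).adj_of_pair h13
  have q3 := (p3 ▸ h c₃).adj_of_pair h12
  constructor
  · rw [hS, ncard_insert_of_notMem, ncard_insert_of_notMem, ncard_insert_of_notMem, ncard_pair h23]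
      <;> simp [*]
  · rw [hS]
    simp only [mem_insert_iff, mem_singleton_iff]
    clear h h3 p1 p2 p3 hS
    have := @G.symm
    rintro a (rfl | rfl | rfl | rfl | rfl) b (rfl | rfl | rfl | rfl | rfl) hab <;>
      first | exact absurd rfl hab | tauto

lemma hasK33_of_clique (hxy : G.Adj x y) (h1 : G.Adj x a ∧ G.Adj x b)
    (h2 : G.Adj y c ∧ G.Adj y d) (hxc : x ≠ c) (hxd : x ≠ d) (hya : y ≠ a) (hyb : y ≠ b)
    (h3 : G.Adj a b) (h4 : G.Adj a c) (h5 : G.Adj a d) (h6 : G.Adj b c) (h7 : G.Adj b d)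
    (h8 : G.Adj c d) : HasK33 G := by
  have := hxy.ne; have := h1.1.ne; have := h1.2.ne; have := h2.1.ne; have := h2.2.ne
  have := h3.ne; have := h4.ne'; have := h5.ne'; have := h6.ne'; have := h7.ne'; have := h8.ne
  refine HasK33.mk6 (X₀ := {x}) (X₁ := {c}) (X₂ := {d}) (Y₀ := {y}) (Y₁ := {a}) (Y₂ := {b})
    (by simp) (by simp) ⟨connOn_singleton, connOn_singleton, connOn_singleton⟩
    ⟨connOn_singleton, connOn_singleton, connOn_singleton⟩ ?_ ?_ ?_ ?_ ?_ ?_ ?_ ?_ ?_ ?_ ?_ ?_ ?_ ?_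
  · simp [*]
  · simp [*]
  · simp [*]
  · simp [*, h2.1.ne']
  · simp [*, h2.2.ne']
  · simpa using hxy
  · simpa using h1.1
  · simpa using h1.2
  · simpa using h2.1.symm
  · simpa using h4.symm
  · simpa using h6.symm
  · simpa using h2.2.symm
  · simpa using h5.symm
  · simpa using h7.symm

lemma not_complete_contraction (hG : KF G) (h3 : ∀ u w, ConnOn G (S \ {u, w}))
    (hxy : G.Adj x y) (mx : x ∈ S) (my : y ∈ S) (h5 : (S \ {y}).ncard = 5)
    (hK : ∀ a ∈ S \ {y}, ∀ b ∈ S \ {y}, a ≠ b → (quot G (merge x y)).Adj a b) : False := by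
  have hT : ((S \ {y}) \ {x}).ncard = 4 := by
    rw [ncard_sdiff_singleton_of_mem (show x ∈ S \ {y} from ⟨mx, hxy.ne⟩), h5]
  have hne : ((S \ {y}) \ {x}).Nonempty := nonempty_of_ncard_ne_zero (by omega)
  obtain ⟨p, hp⟩ := hne
  have hT' : (((S \ {y}) \ {x}) \ {p}).ncard = 3 := by
    rw [ncard_sdiff_singleton_of_mem hp, hT]
  obtain ⟨q, r, s, hqr, hqs, hrs, hT'⟩ := ncard_eq_three.1 hT'
  have hmem : ∀ t, (t ∈ S ∧ t ≠ x ∧ t ≠ y) ↔ t = p ∨ t = q ∨ t = r ∨ t = s := by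
    intro t
    have e1 : t ∈ ((S \ {y}) \ {x}) \ {p} ↔ t ∈ ({q, r, s} : Set U) := by rw [hT']
    simp only [mem_sdiff, mem_singleton_iff, mem_insert_iff] at e1 hp
    by_cases htp : t = p
    · subst htp; tauto
    · tauto
  have hpq : p ≠ q ∧ p ≠ r ∧ p ≠ s := by
    have : p ∉ ({q, r, s} : Set U) := by rw [← hT']; simp
    simpa using this
  obtain ⟨hpq, hpr, hps⟩ := hpq
  obtain ⟨mp, px, py⟩ := (hmem p).2 (by simp)
  obtain ⟨mq, qx, qy⟩ := (hmem q).2 (by simp)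
  obtain ⟨mr, rx, ry⟩ := (hmem r).2 (by simp)
  obtain ⟨ms, sx, sy⟩ := (hmem s).2 (by simp)
  have hadj : ∀ a b, a ∈ S → a ≠ x → a ≠ y → b ∈ S → b ≠ x → b ≠ y → a ≠ b → G.Adj a b := by
    intro a b h1 h2 h3 h4 h5 h6 hab
    have := (adj_of_quot_merge (hK a ⟨h1, h3⟩ b ⟨h4, h6⟩ hab) h2).2
    tauto
  have hor : ∀ a, a ∈ S → a ≠ x → a ≠ y → G.Adj x a ∨ G.Adj y a := by
    intro a h1 h2 h3
    have := (adj_of_quot_merge (hK a ⟨h1, h3⟩ x ⟨mx, hxy.ne⟩ h2) h2).2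
    have e1 := G.adj_comm a x
    have e2 := G.adj_comm a y
    tauto
  have deg : ∀ v v', v ≠ v' → v ∈ S → (∀ t, t ≠ v → t ≠ v' → t ∈ S → t = p ∨ t = q ∨ t = r ∨ t = s) →
      ∀ t, t ≠ v → ∀ t', t' ≠ t → t' ≠ v → t' ≠ v' → t' ∈ S →
      ∃ c, (c = p ∨ c = q ∨ c = r ∨ c = s) ∧ c ≠ t ∧ G.Adj v c := by
    intro v v' hvv' hv hvm t ht t' h1 h2 h3' h4
    obtain ⟨c, hc, hvc⟩ := (h3 v' t).exists_adj (z := v) (C := S \ {v, v', t})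
      (fun t ht => ⟨ht.1, fun h => ht.2 (by simp at h ⊢; tauto)⟩)
      ⟨t', h4, by simp [h1, h2, h3']⟩ ⟨hv, by simp [hvv', ht.symm]⟩ (by simp)
      (fun c hc d hd hdz hcd => ⟨hd.1, by have := hd.2; simp at this ⊢; tauto⟩)
    have := hc.2
    simp only [mem_insert_iff, mem_singleton_iff, not_or] at this
    exact ⟨c, hvm c this.1 this.2.1 hc.1, this.2.2, hvc⟩
  have degx := deg x y hxy.ne mx (fun t h1 h2 h3 => (hmem t).1 ⟨h3, h1, h2⟩)
  have degy := deg y x hxy.ne' my (fun t h1 h2 h3 => (hmem t).1 ⟨h3, h2, h1⟩)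
  have x1 := degx p px q hpq.symm qx qy mq
  have x2 := degx q qx p hpq px py mp
  have x3 := degx r rx p hpr px py mp
  have x4 := degx s sx p hps px py mp
  have y1 := degy p py q hpq.symm qy qx mq
  have y2 := degy q qy p hpq py px mp
  have y3 := degy r ry p hpr py px mp
  have y4 := degy s sy p hps py px mp
  have o1 := hor p mp px py
  have o2 := hor q mq qx qy
  have o3 := hor r mr rx ry
  have o4 := hor s ms sx sy
  have a1 := hadj p q mp px py mq qx qy hpq
  have a2 := hadj p r mp px py mr rx ry hpr
  have a3 := hadj p s mp px py ms sx sy hps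
  have a4 := hadj q r mq qx qy mr rx ry hqr
  have a5 := hadj q s mq qx qy ms sx sy hqs
  have a6 := hadj r s mr rx ry ms sx sy hrs
  clear deg degx degy hor hadj hmem hT hT' hK h5 h3
  simp only [or_and_right, exists_or, exists_eq_left, ne_eq, not_true_eq_false, false_and,
    false_or, or_false, hpq, hpr, hps, hqr, hqs, hrs, hpq.symm, hpr.symm, hps.symm, hqr.symm,
    hqs.symm, hrs.symm, not_false_eq_true, true_and] at x1 x2 x3 x4 y1 y2 y3 y4
  have fin : ∀ a b c d, x ≠ c → x ≠ d → y ≠ a → y ≠ b → G.Adj a b → G.Adj a c → G.Adj a d →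
      G.Adj b c → G.Adj b d → G.Adj c d →
      ¬ (G.Adj x a ∧ G.Adj x b ∧ G.Adj y c ∧ G.Adj y d) := by
    intro a b c d n1 n2 n3 n4 h3 h4 h5 h6 h7 h8 ⟨i1, i2, i3, i4⟩
    exact hG (hasK33_of_clique hxy ⟨i1, i2⟩ ⟨i3, i4⟩ n1 n2 n3 n4 h3 h4 h5 h6 h7 h8)
  have f1 := fin p q r s rx.symm sx.symm py.symm qy.symm a1 a2 a3 a4 a5 a6
  have f2 := fin p r q s qx.symm sx.symm py.symm ry.symm a2 a1 a3 a4.symm a6 a5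
  have f3 := fin p s q r qx.symm rx.symm py.symm sy.symm a3 a1 a2 a5.symm a6.symm a4
  have f4 := fin q r p s px.symm sx.symm qy.symm ry.symm a4 a1.symm a5 a2.symm a6 a3
  have f5 := fin q s p r px.symm rx.symm qy.symm sy.symm a5 a1.symm a4 a3.symm a6.symm a2
  have f6 := fin r s p q px.symm qx.symm ry.symm sy.symm a6 a2.symm a4.symm a3.symm a5.symm a1
  clear * - x1 x2 x3 x4 y1 y2 y3 y4 o1 o2 o3 o4 f1 f2 f3 f4 f5 f6
  grind only

lemma hasK33_of_rootedCycle (hxy : G.Adj x y) (ha : G.Adj x a) (ha' : G.Adj x a') (hb : G.Adj y b)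
    (hb' : G.Adj y b') (hx : x ∉ S) (hy : y ∉ S) (h : RootedCycle G S a b a' b') : HasK33 G := by
  obtain ⟨A, B, A', B', h⟩ := h
  obtain ⟨s1, s2, s3, s4⟩ := h.sub
  obtain ⟨m1, m2, m3, m4⟩ := h.mem
  obtain ⟨c1, c2, c3, c4⟩ := h.conn
  obtain ⟨d1, d2, d3, d4, d5, d6⟩ := h.disj
  obtain ⟨e1, e2, e3, e4⟩ := h.adj
  have flip : ∀ A B : Set U, (∃ s ∈ A, ∃ t ∈ B, G.Adj s t) → ∃ s ∈ B, ∃ t ∈ A, G.Adj s t :=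
    fun A B ⟨s, hs, t, ht, hst⟩ => ⟨t, ht, s, hs, hst.symm⟩
  have hxn : x ∉ A ∧ x ∉ B ∧ x ∉ A' ∧ x ∉ B' :=
    ⟨fun h => hx (s1 h), fun h => hx (s2 h), fun h => hx (s3 h), fun h => hx (s4 h)⟩
  have hyn : y ∉ A ∧ y ∉ B ∧ y ∉ A' ∧ y ∉ B' :=
    ⟨fun h => hy (s1 h), fun h => hy (s2 h), fun h => hy (s3 h), fun h => hy (s4 h)⟩
  refine HasK33.mk6 (X₀ := {x}) (X₁ := B) (X₂ := B') (Y₀ := {y}) (Y₁ := A) (Y₂ := A')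
    ⟨by simp, ⟨_, m2⟩, ⟨_, m4⟩⟩ ⟨by simp, ⟨_, m1⟩, ⟨_, m3⟩⟩ ⟨connOn_singleton, c2, c4⟩
    ⟨connOn_singleton, c1, c3⟩ ?_ ?_ ?_ ?_ ?_ ?_ ?_ ?_ ?_ (flip _ _ e1) e2 ?_ e4 (flip _ _ e3)
  · simp [hxn, d5]
  · simp [hyn, d2]
  · simp [hxn, hxy.ne]
  · simp [hyn, d1.symm, d4]
  · simp [hyn, d3.symm, d6.symm]
  · simpa using hxy
  · exact ⟨x, rfl, a, m1, ha⟩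
  · exact ⟨x, rfl, a', m3, ha'⟩
  · exact ⟨b, m2, y, rfl, hb.symm⟩
  · exact ⟨b', m4, y, rfl, hb'.symm⟩

lemma exists_isVK_bot : ∃ τ Φ, IsVK (⊥ : SimpleGraph U) τ Φ := by
  classical
  refine ⟨fun a b => if WellOrderingRel a b then 1 else 0, fun _ _ _ => 0, fun a b hab => ?_,
    fun _ _ _ => rfl, fun _ _ _ _ h => h.elim⟩
  rcases trichotomous_of WellOrderingRel a b with h | h | h
  · rw [if_pos h, if_neg (asymm h)]; rfl
  · exact absurd h hab
  · rw [if_neg (asymm h), if_pos h]; rfl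

/-- A finite 3-connected graph without a `K₃,₃` minor is `K₅` or has vanishing van Kampen
obstruction. -/
theorem exists_isVK_or_complete (hS : S.Finite) (hsupp : ∀ a b, G.Adj a b → a ∈ S) (hG : KF G)
    (h3 : ∀ u w, ConnOn G (S \ {u, w})) :
    (∃ τ Φ, IsVK G τ Φ) ∨ (S.ncard = 5 ∧ ∀ a ∈ S, ∀ b ∈ S, a ≠ b → G.Adj a b) := by
  induction hn : S.ncard using Nat.strong_induction_on generalizing S G with
  | _ n ih =>
  subst hn
  by_cases hE : ∃ x y, G.Adj x y
  swap
  · left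
    push Not at hE
    have : G = ⊥ := by ext a b; simp [hE]
    rw [this]
    exact exists_isVK_bot
  obtain ⟨x, y, hxy⟩ := hE
  obtain ⟨x, mx, y, my, hxy, h⟩ :=
    exists_contractible_edge hS h3 hxy (hsupp _ _ hxy) (hsupp _ _ hxy.symm)
  have hlt : (S \ {y}).ncard < S.ncard := ncard_sdiff_singleton_lt_of_mem my hS
  have hsupp' : ∀ a b, (quot G (merge x y)).Adj a b → a ∈ S \ {y} := by
    rintro a b ⟨hne, a', b', rfl, rfl, hab⟩
    by_cases ha : a' = y
    · rw [ha, merge_self]; exact ⟨mx, hxy.ne⟩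
    · rw [merge_of_ne ha]; exact ⟨hsupp _ _ hab, ha⟩
  have h3' : ∀ u w, ConnOn (quot G (merge x y)) ((S \ {y}) \ {u, w}) := by
    intro u w
    by_cases hx : x = u ∨ x = w
    · have : ∃ z, (S \ {y}) \ {u, w} = S \ {x, y, z} := by
        rcases hx with rfl | rfl
        · exact ⟨w, by ext; simp; tauto⟩
        · exact ⟨u, by ext; simp; tauto⟩
      obtain ⟨z, hz⟩ := this
      rw [hz]
      exact (h z).merge_notMem (by simp)
    · rw [sdiff_sdiff, union_comm, ← sdiff_sdiff]
      exact (h3 u w).merge_mem ⟨mx, by simpa using hx⟩ hxy.ne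
  rcases ih _ hlt (hS.subset sdiff_subset) hsupp'
    (hG.quot (merge_fiber hxy)) h3' rfl with ⟨τ, Φ, hVK⟩ | ⟨h5, hK⟩
  · by_cases hcom : ∃ a b c, a ≠ b ∧ a ≠ c ∧ b ≠ c ∧ (G.Adj x a ∧ G.Adj y a) ∧
      (G.Adj x b ∧ G.Adj y b) ∧ (G.Adj x c ∧ G.Adj y c)
    · obtain ⟨a, b, c, n1, n2, n3, e1, e2, e3⟩ := hcom
      exact Or.inr (complete_of_three_common hG h3 hxy h e1 e2 e3 mx my (hsupp _ _ e1.1.symm)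
        (hsupp _ _ e2.1.symm) (hsupp _ _ e3.1.symm) n1 n2 n3)
    left
    refine hVK.uncontract hxy.ne hcom fun a a' b b' ha ha' hb hb' hay ha'y hbx hb'x haa' hbb' hab
      hab' ha'b ha'b' => ?_
    have hmem : ∀ {t v}, G.Adj v t → t ≠ x → t ≠ y → t ∈ S \ {x, y} := fun hvt h1 h2 =>
      ⟨hsupp _ _ hvt.symm, by simp [h1, h2]⟩
    rcases linked_or_rootedCycle (hS.subset (sdiff_subset (t := {x, y}))) 
      (fun z => by
        have := h z
        rwa [show S \ {x, y, z} = (S \ {x, y}) \ {z} by ext; simp; tauto] at this)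
      (hmem ha ha.ne' hay) (hmem ha' ha'.ne' ha'y) (hmem hb hbx hb.ne') (hmem hb' hb'x hb'.ne')
      haa' hab hab' ha'b ha'b' hbb' with hl | hc
    · obtain ⟨A, hA, B, hB, cA, cB, hAB, m1, m2, m3, m4⟩ := hl
      exact hVK.cross4_eq_zero (quot_merge_adj ha hxy.ne hay) (quot_merge_adj ha' hxy.ne ha'y)
        (quot_merge_adj' hb hbx) (quot_merge_adj' hb' hb'x)
        (cA.merge_notMem fun h => (hA h).2 (by simp)) (cB.merge_notMem fun h => (hB h).2 (by simp))
        hAB m1 m2 m3 m4 (fun h => (hA h).2 (by simp)) (fun h => (hB h).2 (by simp))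
    · exact absurd (hasK33_of_rootedCycle hxy ha ha' hb hb' (by simp) (by simp) hc) hG
  · exact (not_complete_contraction hG h3 hxy mx my h5 hK).elim

end VanKampen

section Star

variable {U : Type*} {P : SimpleGraph U} {S A B C D : Set U} {a a' b b' c d e r u v w x y z : U}
  {m : U → U ⊕ Fin 4} {ℓ : U → Fin 4}

/-- The edges of the graph obtained from `P` by splitting up the vertex `x`. -/
inductive StarRel (P : SimpleGraph U) (x : U) (m : U → U ⊕ Fin 4) : U ⊕ Fin 4 → U ⊕ Fin 4 → Prop
  | base {a b : U} : P.Adj a b → a ≠ x → b ≠ x → StarRel P x m (.inl a) (.inl b)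
  | leaf {z : U} : P.Adj x z → StarRel P x m (m z) (.inl z)
  | stem {z : U} : P.Adj x z → StarRel P x m (.inl x) (m z)

/-- `P` with the vertex `x` replaced by a star with centre `x`, whose vertex `m z` is joined to
the neighbour `z` of `x`. -/
def star (P : SimpleGraph U) (x : U) (m : U → U ⊕ Fin 4) : SimpleGraph (U ⊕ Fin 4) :=
  fromRel (StarRel P x m)

lemma StarRel.adj {s t : U ⊕ Fin 4} (h : StarRel P x m s t) (hst : s ≠ t) : (star P x m).Adj s t :=
  (fromRel_adj _ _ _).2 ⟨hst, Or.inl h⟩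

lemma star_neighbor {s : U ⊕ Fin 4} (h : (star P x m).Adj (.inl x) s) :
    ∃ z, P.Adj x z ∧ ((m z = .inl x ∧ s = .inl z) ∨ (m z ≠ .inl x ∧ s = m z)) := by
  obtain ⟨hne, h | h⟩ := (fromRel_adj _ _ _).1 h
  · generalize ht : (Sum.inl x : U ⊕ Fin 4) = t at h
    cases h with
    | base h1 h2 h3 => simp at ht; exact absurd ht.symm h2
    | @leaf z h1 => exact ⟨z, h1, Or.inl ⟨rfl, rfl⟩⟩
    | @stem z h1 => exact ⟨z, h1, Or.inr ⟨hne.symm, rfl⟩⟩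
  · generalize ht : (Sum.inl x : U ⊕ Fin 4) = t at h
    cases h with
    | base h1 h2 h3 => simp at ht; exact absurd ht.symm h3
    | leaf h1 => simp at ht; exact absurd ht h1.ne
    | stem h1 => exact absurd rfl hne

lemma star_neighbor_inr {s : U ⊕ Fin 4} {i : Fin 4} (h : (star P x m).Adj (.inr i) s) :
    s = .inl x ∨ ∃ z, P.Adj x z ∧ m z = .inr i ∧ s = .inl z := by
  obtain ⟨hne, h | h⟩ := (fromRel_adj _ _ _).1 h
  · generalize ht : (Sum.inr i : U ⊕ Fin 4) = t at h
    cases h with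
    | base h1 h2 h3 => simp at ht
    | @leaf z h1 => exact Or.inr ⟨z, h1, rfl, rfl⟩
    | stem h1 => simp at ht
  · generalize ht : (Sum.inr i : U ⊕ Fin 4) = t at h
    cases h with
    | base h1 h2 h3 => simp at ht
    | leaf h1 => simp at ht
    | stem h1 => exact Or.inl rfl

lemma quot_star_le {i : Fin 4} :
    quot (star P x m) (merge (.inl x) (.inr i)) ≤ star P x (merge (.inl x) (.inr i) ∘ m) := by
  rintro s t ⟨hne, s', t', rfl, rfl, h⟩
  have key : ∀ s t, StarRel P x m s t →
      StarRel P x (merge (.inl x) (.inr i) ∘ m) (merge (.inl x) (.inr i) s)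
        (merge (.inl x) (.inr i) t) := by
    intro s t h
    cases h with
    | base h1 h2 h3 =>
      rw [merge_of_ne (by simp), merge_of_ne (by simp)]
      exact .base h1 h2 h3
    | leaf h1 =>
      rw [merge_of_ne (a := Sum.inl _) (by simp)]
      exact .leaf (m := merge (.inl x) (.inr i) ∘ m) h1
    | stem h1 =>
      rw [merge_of_ne (a := Sum.inl x) (by simp)]
      exact .stem (m := merge (.inl x) (.inr i) ∘ m) h1
  obtain ⟨-, h | h⟩ := (fromRel_adj _ _ _).1 h
  · exact (key _ _ h).adj hne
  · exact ((key _ _ h).adj hne.symm).symm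

lemma exists_isVK_star {i : Fin 4} (hm : ∀ z, m z = .inl x ∨ ∃ j, m z = .inr j)
    (h : ∃ τ Φ, IsVK (star P x (merge (.inl x) (.inr i) ∘ m)) τ Φ)
    (hlink : ∀ a a' b b', P.Adj x a → P.Adj x a' → P.Adj x b → P.Adj x b' → m a ≠ .inr i →
      m a' ≠ .inr i → m b = .inr i → m b' = .inr i → a ≠ a' → b ≠ b' → Linked P {x}ᶜ a a' b b') :
    ∃ τ Φ, IsVK (star P x m) τ Φ := by
  obtain ⟨τ, Φ, h⟩ := h
  obtain ⟨τ, Φ, h⟩ := h.of_hom id (injOn_id _) fun _ _ hab => quot_star_le hab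
  refine h.uncontract (by simp) ?_ ?_
  · rintro ⟨a, -, -, -, -, -, ⟨h1, h2⟩, -⟩
    obtain ⟨z, hz, h1⟩ := star_neighbor h1
    rcases star_neighbor_inr h2 with rfl | ⟨z', hz', h3, rfl⟩
    · rcases h1 with ⟨-, h1⟩ | ⟨h1, h1'⟩
      · simp at h1; exact hz.ne h1
      · exact h1 h1'.symm
    · rcases h1 with ⟨h1, h1'⟩ | ⟨h1, h1'⟩
      · simp at h1'; rw [h1', h1] at h3; simp at h3
      · obtain ⟨j, hj⟩ := (hm z).resolve_left h1
        rw [hj] at h1'; simp at h1'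
  · intro α α' β β' ha ha' hb hb' n1 n2 n3 n4 n5 n6 _ _ _ _
    let Q := quot (star P x m) (merge (.inl x) (.inr i))
    obtain ⟨b, hxb, mb, rfl⟩ := (star_neighbor_inr hb).resolve_left n3
    obtain ⟨b', hxb', mb', rfl⟩ := (star_neighbor_inr hb').resolve_left n4
    obtain ⟨a, hxa, ma⟩ := star_neighbor ha
    obtain ⟨a', hxa', ma'⟩ := star_neighbor ha'
    have hmne : ∀ {a α}, ((m a = .inl x ∧ α = .inl a) ∨ (m a ≠ .inl x ∧ α = m a)) → α ≠ .inr i →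
        m a ≠ .inr i := by
      rintro a α (⟨h1, h2⟩ | ⟨h1, h2⟩) h3
      · rw [h1]; simp
      · rwa [← h2]
    have haa' : a ≠ a' := by
      rintro rfl
      rcases ma with ⟨h1, rfl⟩ | ⟨h1, rfl⟩ <;> rcases ma' with ⟨h2, rfl⟩ | ⟨h2, rfl⟩ <;> simp_all
    obtain ⟨A, hA, B, hB, cA, cB, hAB, m1, m2, m3, m4⟩ := hlink a a' b b' hxa hxa' hxb hxb'
      (hmne ma n1) (hmne ma' n2) mb mb' haa' fun h => n6 (by rw [h])
    have cinl : ∀ A : Set U, A ⊆ {x}ᶜ → ConnOn P A → ConnOn Q (Sum.inl '' A) := by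
      intro A hA cA
      refine cA.image fun s hs t ht hst => Or.inr ?_
      exact quot_merge_adj ((StarRel.base hst (hA hs) (hA ht)).adj (by simpa using hst.ne))
        (by simp) (by simp)
    have cins : ∀ {a α T}, P.Adj x a → ((m a = .inl x ∧ α = .inl a) ∨ (m a ≠ .inl x ∧ α = m a)) →
        α ≠ .inr i → ConnOn Q T → .inl a ∈ T → ConnOn Q (insert α T) := by
      rintro a α T hxa (⟨h1, rfl⟩ | ⟨h1, rfl⟩) h3 cT haT
      · rwa [insert_eq_of_mem haT]
      · refine cT.insert_adj haT (quot_merge_adj ((StarRel.leaf hxa).adj ?_) h3 (by simp))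
        rcases hm a with h | ⟨j, h⟩
        · exact absurd h h1
        · rw [h]; simp
    have hnot : ∀ {a α} (T : Set U), ((m a = .inl x ∧ α = .inl a) ∨ (m a ≠ .inl x ∧ α = m a)) →
        a ∉ T → α ∉ Sum.inl '' T := by
      rintro a α T (⟨h1, rfl⟩ | ⟨h1, rfl⟩) h3
      · simpa using h3
      · obtain ⟨j, hj⟩ := (hm a).resolve_left h1
        rw [hj]; simp
    have hdis : ∀ t ∈ A, t ∉ B := fun t h1 h2 => hAB.le_bot ⟨h1, h2⟩
    refine h.cross4_eq_zero (A := insert α (insert α' (Sum.inl '' A))) (B := Sum.inl '' B)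
      (quot_merge_adj ha (by simp) n1) (quot_merge_adj ha' (by simp) n2)
      (quot_merge_adj' hb (by simpa using hxb.ne'))
      (quot_merge_adj' hb' (by simpa using hxb'.ne')) ?_ (cinl B hB cB) ?_ (by simp) (by simp)
      (by simpa) (by simpa) ?_ ?_
    · exact cins hxa ma n1 (cins hxa' ma' n2 (cinl A hA cA) (by simpa)) (by right; simpa)
    · rw [disjoint_insert_left, disjoint_insert_left]
      refine ⟨hnot B ma (hdis a m1), hnot B ma' (hdis a' m2), ?_⟩
      exact (disjoint_image_iff Sum.inl_injective).2 hAB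
    · simp only [mem_insert_iff, not_or]
      refine ⟨ha.ne, ha'.ne, ?_⟩
      rintro ⟨t, ht, htx⟩
      exact hA ht (by simpa using htx)
    · rintro ⟨t, ht, htx⟩
      exact hB ht (by simpa using htx)

lemma Linked.mono (h : Linked P A a a' b b') (hAB : A ⊆ B) : Linked P B a a' b b' := by
  obtain ⟨A', hA', B', hB', h⟩ := h
  exact ⟨A', hA'.trans hAB, B', hB'.trans hAB, h⟩

variable {τ : U → U → ZMod 2} {Φ : U → U → U → ZMod 2}

lemma Linked.cross4_eq_zero (h : IsVK P τ Φ) (ha : P.Adj x a) (ha' : P.Adj x a') (hb : P.Adj x b)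
    (hb' : P.Adj x b') (hl : Linked P {x}ᶜ a a' b b') : cross4 τ Φ x a a' b b' = 0 := by
  obtain ⟨A, hA, B, hB, cA, cB, hAB, m1, m2, m3, m4⟩ := hl
  exact h.cross4_eq_zero ha ha' hb hb' cA cB hAB m1 m2 m3 m4 (fun h => hA h rfl) fun h => hB h rfl

lemma zmod_two_cases (s : ZMod 2) : s = 0 ∨ s = 1 := by
  revert s; decide

section Label

variable (hS : S.Finite) (h3 : ∀ u w, ConnOn P (S \ {u, w})) (hN : ∀ z, P.Adj x z → z ∈ S)
include hS h3 hN

lemma linked_or_rootedCycle_compl (ha : P.Adj x a) (ha' : P.Adj x a') (hb : P.Adj x b)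
    (hb' : P.Adj x b') (haa' : a ≠ a') (hab : a ≠ b) (hab' : a ≠ b') (ha'b : a' ≠ b)
    (ha'b' : a' ≠ b') (hbb' : b ≠ b') :
    Linked P {x}ᶜ a a' b b' ∨ (Linked P {x}ᶜ a b a' b' ∧ Linked P {x}ᶜ a b' a' b) := by
  have hmem : ∀ {z}, P.Adj x z → z ∈ S \ {x} := fun hz => ⟨hN _ hz, hz.ne'⟩
  have hsub : S \ {x} ⊆ {x}ᶜ := fun z hz => hz.2
  rcases linked_or_rootedCycle (hS.subset sdiff_subset)
    (fun z => by rw [sdiff_sdiff_left]; exact h3 x z) (hmem ha) (hmem ha') (hmem hb) (hmem hb') haa'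
    hab hab' ha'b ha'b' hbb' with hl | hr
  · exact Or.inl (hl.mono hsub)
  · obtain ⟨A, hA, B, hB, h1, h2, h4, h5, h6, h7, h8⟩ := hr.rotate.rotate.rotate.linked
    exact Or.inr ⟨hr.linked.mono hsub,
      ⟨A, hA.trans hsub, B, hB.trans hsub, h1, h2, h4, h6, h5, h8, h7⟩⟩

variable (h : IsVK P τ Φ)
include h

lemma linked_of_cross4 (ha : P.Adj x a) (ha' : P.Adj x a') (hb : P.Adj x b)
    (hb' : P.Adj x b') (haa' : a ≠ a') (hab : a ≠ b) (hab' : a ≠ b') (ha'b : a' ≠ b)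
    (ha'b' : a' ≠ b') (hbb' : b ≠ b') (hq : cross4 τ Φ x a a' b b' = 0) :
    Linked P {x}ᶜ a a' b b' := by
  refine (linked_or_rootedCycle_compl hS h3 hN ha ha' hb hb' haa' hab hab' ha'b ha'b'
    hbb').resolve_right ?_
  rintro ⟨h1, h2⟩
  have e1 := h1.cross4_eq_zero h ha hb ha' hb'
  have e2 := h2.cross4_eq_zero h ha hb' ha' hb
  have e3 := h.cross4_sum (a := a) ha'.ne' hb.ne' hb'.ne' ha'b ha'b' hbb'
  rw [hq, e1, e2] at e3
  exact absurd e3 (by decide)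

lemma cross4_eq_zero_of_label (hr : P.Adj x r) (he : P.Adj x e) (ha : P.Adj x a)
    (hb : P.Adj x b) (hre : r ≠ e) (har : a ≠ r) (hae : a ≠ e) (hbr : b ≠ r) (hbe : b ≠ e)
    (hab : cross τ Φ x r a + cross τ Φ x e a ≠ cross τ Φ x r b + cross τ Φ x e b) :
    cross4 τ Φ x r a b e = 0 := by
  have hne : a ≠ b := by rintro rfl; exact hab rfl
  rcases linked_or_rootedCycle_compl hS h3 hN hr he ha hb hre har.symm hbr.symm hae.symm hbe.symm
    hne with hl | ⟨hl, -⟩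
  · have := hl.cross4_eq_zero h hr he ha hb
    simp only [cross4] at this
    refine absurd ?_ hab
    linear_combination (norm := (ring_nf; reduce_mod_char)) this
  · have := hl.cross4_eq_zero h hr ha he hb
    simp only [cross4] at this ⊢
    linear_combination this

lemma cross4_root_eq_zero (hr : P.Adj x r) (he : P.Adj x e) (ha : P.Adj x a)
    (hb : P.Adj x b) (hb' : P.Adj x b') (hre : r ≠ e) (har : a ≠ r) (hbr : b ≠ r) (hbe : b ≠ e)
    (hbr' : b' ≠ r) (hbe' : b' ≠ e)
    (hbb : cross τ Φ x r b + cross τ Φ x e b = cross τ Φ x r b' + cross τ Φ x e b')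
    (hab : a = e ∨ cross τ Φ x r a + cross τ Φ x e a ≠ cross τ Φ x r b + cross τ Φ x e b) :
    cross4 τ Φ x r a b b' = 0 := by
  by_cases hae : a = e
  · subst hae
    simp only [cross4]
    linear_combination (norm := (ring_nf; reduce_mod_char)) hbb
  · have hab := hab.resolve_left hae
    have e1 := cross4_eq_zero_of_label hS h3 hN h hr he ha hb hre har hae hbr hbe hab
    have e2 := cross4_eq_zero_of_label hS h3 hN h hr he ha hb' hre har hae hbr' hbe' (hbb ▸ hab)
    simp only [cross4] at e1 e2 ⊢
    linear_combination (norm := (ring_nf; reduce_mod_char)) e1 + e2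

lemma linked_of_label (hr : P.Adj x r) (he : P.Adj x e) (ha : P.Adj x a) (ha' : P.Adj x a')
    (hb : P.Adj x b) (hb' : P.Adj x b') (hre : r ≠ e) (haa' : a ≠ a') (hbb' : b ≠ b')
    (hbr : b ≠ r) (hbe : b ≠ e) (hbr' : b' ≠ r) (hbe' : b' ≠ e)
    (hbb : cross τ Φ x r b + cross τ Φ x e b = cross τ Φ x r b' + cross τ Φ x e b')
    (hab : a = r ∨ a = e ∨ cross τ Φ x r a + cross τ Φ x e a ≠ cross τ Φ x r b + cross τ Φ x e b)
    (hab' : a' = r ∨ a' = e ∨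
      cross τ Φ x r a' + cross τ Φ x e a' ≠ cross τ Φ x r b + cross τ Φ x e b) :
    Linked P {x}ᶜ a a' b b' := by
  have hne : ∀ {a}, (a = r ∨ a = e ∨
      cross τ Φ x r a + cross τ Φ x e a ≠ cross τ Φ x r b + cross τ Φ x e b) → a ≠ b ∧ a ≠ b' := by
    rintro a (rfl | rfl | h)
    · exact ⟨hbr.symm, hbr'.symm⟩
    · exact ⟨hbe.symm, hbe'.symm⟩
    · exact ⟨by rintro rfl; exact h rfl, by rintro rfl; exact h hbb.symm⟩
  have key : ∀ {a}, P.Adj x a → (a = r ∨ a = e ∨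
      cross τ Φ x r a + cross τ Φ x e a ≠ cross τ Φ x r b + cross τ Φ x e b) →
      cross4 τ Φ x r a b b' = 0 := by
    intro a ha hab
    by_cases har : a = r
    · subst har
      simp only [cross4]
      linear_combination (norm := (ring_nf; reduce_mod_char))
    · exact cross4_root_eq_zero hS h3 hN h hr he ha hb hb' hre har hbr hbe hbr' hbe' hbb
        (hab.resolve_left har)
  refine linked_of_cross4 hS h3 hN h ha ha' hb hb' haa' (hne hab).1 (hne hab).2 (hne hab').1
    (hne hab').2 hbb' ?_
  have e1 := key ha hab
  have e2 := key ha' hab'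
  simp only [cross4] at e1 e2 ⊢
  linear_combination (norm := (ring_nf; reduce_mod_char)) e1 + e2

end Label

end Star

section StarPlus

variable {U : Type*} {P : SimpleGraph U} {S A B C D : Set U} {a a' b b' c d e r u v w x y z : U}
  {m : U → U ⊕ Fin 4} {ℓ : U → Fin 4}

open Classical in
/-- The attachment map of the star replacing `x`, where the roots `r` and `e` stay attached to the
centre. -/
noncomputable def lab (x r e : U) (ℓ : U → Fin 4) (z : U) : U ⊕ Fin 4 :=
  if z = r ∨ z = e then .inl x else .inr (ℓ z)

lemma lab_root (h : z = r ∨ z = e) : lab x r e ℓ z = .inl x := if_pos h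

lemma lab_of_ne (hr : z ≠ r) (he : z ≠ e) : lab x r e ℓ z = .inr (ℓ z) :=
  if_neg fun h => h.elim hr he

lemma lab_ne_inr {i : Fin 4} : lab x r e ℓ z ≠ .inr i ↔ z = r ∨ z = e ∨ ℓ z ≠ i := by
  simp only [lab]
  split_ifs with h
  · simp; tauto
  · simp; tauto

lemma lab_eq_inr {i : Fin 4} : lab x r e ℓ z = .inr i ↔ z ≠ r ∧ z ≠ e ∧ ℓ z = i := by
  have := lab_ne_inr (x := x) (r := r) (e := e) (ℓ := ℓ) (z := z) (i := i)
  tauto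

lemma lab_eq_inl : lab x r e ℓ z = .inl y ↔ (z = r ∨ z = e) ∧ x = y := by
  simp only [lab]
  split_ifs with h
  · simp [h]
  · simp [h]

/-- The star graph at `x`, with two further leaves attached to `e` and to `r`. -/
noncomputable def starPlus (P : SimpleGraph U) (x r e : U) (ℓ : U → Fin 4) :
    SimpleGraph (U ⊕ Fin 4) :=
  star P x (lab x r e ℓ) ⊔
    (edge (.inl x) (.inr 2) ⊔ edge (.inl x) (.inr 3) ⊔ edge (.inr 2) (.inl e) ⊔
      edge (.inr 3) (.inl r))

lemma starPlus_adj {s t : U ⊕ Fin 4} : (starPlus P x r e ℓ).Adj s t ↔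
    (star P x (lab x r e ℓ)).Adj s t ∨ ((s = .inl x ∧ t = .inr 2 ∨ s = .inr 2 ∧ t = .inl x) ∨
      (s = .inl x ∧ t = .inr 3 ∨ s = .inr 3 ∧ t = .inl x) ∨
      (s = .inr 2 ∧ t = .inl e ∨ s = .inl e ∧ t = .inr 2) ∨
      (s = .inr 3 ∧ t = .inl r ∨ s = .inl r ∧ t = .inr 3)) := by
  simp only [starPlus, sup_adj, edge_adj]
  rcases s with s | s <;> rcases t with t | t <;> simp [or_assoc]

lemma lab_leaf_ne (hxz : P.Adj x z) : lab x r e ℓ z ≠ .inl z := by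
  simp only [lab]
  split_ifs
  · simpa using hxz.ne
  · simp

lemma star_adj_root (hr : P.Adj x z) (h : z = r ∨ z = e) :
    (star P x (lab x r e ℓ)).Adj (.inl x) (.inl z) := by
  have h1 : StarRel P x (lab x r e ℓ) (lab x r e ℓ z) (.inl z) := StarRel.leaf hr
  rw [lab_root h] at h1
  exact h1.adj (by simpa using hr.ne)

lemma kf_starPlus (hr : P.Adj x r) (he : P.Adj x e)
    (hℓ : ∀ z, P.Adj x z → z ≠ r → z ≠ e → ℓ z ≠ 2 ∧ ℓ z ≠ 3) (h : KF (star P x (lab x r e ℓ))) :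
    KF (starPlus P x r e ℓ) := by
  have hn : ∀ {i : Fin 4} {s}, (i = 2 ∨ i = 3) → (star P x (lab x r e ℓ)).Adj (.inr i) s →
      s = .inl x := by
    intro i s hi hs
    refine (star_neighbor_inr hs).resolve_right ?_
    rintro ⟨z, hz, h1, -⟩
    rw [lab_eq_inr] at h1
    have := hℓ z hz h1.1 h1.2.1
    grind
  refine KF.add_vertex (v := .inr 2) (u := .inl x) (w := .inl e) (by simp) (by simp) ?_
    (Or.inr (starPlus_adj.2 (Or.inl (star_adj_root he (Or.inr rfl))))) ?_
  · intro b hb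
    rcases starPlus_adj.1 hb with hb | hb
    · exact Or.inl (hn (Or.inl rfl) hb)
    · simpa using hb
  refine KF.add_vertex (v := .inr 3) (u := .inl x) (w := .inl r) (by simp) (by simp) ?_
    (Or.inr (restr_adj.2 ⟨starPlus_adj.2 (Or.inl (star_adj_root hr (Or.inl rfl))), by simp, by simp⟩))
    ?_
  · intro b hb
    rcases starPlus_adj.1 (restr_le hb) with hb | hb
    · exact Or.inl (hn (Or.inr rfl) hb)
    · simpa using hb
  refine h.mono fun s t hst => ?_
  obtain ⟨⟨hst, h1, h2⟩, h3, h4⟩ := hst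
  rcases starPlus_adj.1 hst with hst | hst
  · exact hst
  · simp only [mem_compl_iff, mem_singleton_iff] at h1 h2 h3 h4
    tauto

lemma exists_isVK_star_const {τ : U → U → ZMod 2} {Φ : U → U → U → ZMod 2} (h : IsVK P τ Φ) :
    ∃ τ Φ, IsVK (star P x fun _ => .inl x) τ Φ := by
  have hsub : ∀ s t, (star P x fun _ => .inl x).Adj s t → ∃ a b, s = .inl a ∧ t = .inl b ∧
      P.Adj a b := by
    intro s t hst
    obtain ⟨hne, h | h⟩ := (fromRel_adj _ _ _).1 hst
    · cases h with
      | @base a b h1 h2 h3 => exact ⟨a, b, rfl, rfl, h1⟩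
      | @leaf z h1 => exact ⟨x, z, rfl, rfl, h1⟩
      | @stem z h1 => exact absurd rfl hne
    · cases h with
      | @base a b h1 h2 h3 => exact ⟨b, a, rfl, rfl, h1.symm⟩
      | @leaf z h1 => exact ⟨z, x, rfl, rfl, h1.symm⟩
      | @stem z h1 => exact absurd rfl hne
  refine h.of_hom (Sum.elim id fun _ => x) ?_ ?_
  · rintro s ⟨s', hs⟩ t ⟨t', ht⟩ hst
    obtain ⟨a, _, rfl, _⟩ := hsub _ _ hs
    obtain ⟨b, _, rfl, _⟩ := hsub _ _ ht
    simpa using hst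
  · intro s t hst
    obtain ⟨a, b, rfl, rfl, hab⟩ := hsub _ _ hst
    exact hab

lemma exists_starPlus_of_isVK {τ : U → U → ZMod 2} {Φ : U → U → U → ZMod 2} (h : IsVK P τ Φ)
    (hS : S.Finite) (hN : ∀ z, P.Adj x z → z ∈ S) (h3 : ∀ u w, ConnOn P (S \ {u, w}))
    (hr : P.Adj x r) (he : P.Adj x e) (hre : r ≠ e) : ∃ ℓ, KF (starPlus P x r e ℓ) := by
  classical
  let f : U → ZMod 2 := fun b => cross τ Φ x r b + cross τ Φ x e b
  let ℓ : U → Fin 4 := fun z => if f z = 0 then 0 else 1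
  have hf0 : ∀ z, ℓ z = 0 ↔ f z = 0 := fun z => by simp [ℓ]
  have hf1 : ∀ z, ℓ z = 1 ↔ f z = 1 := fun z => by
    rcases zmod_two_cases (f z) with h | h <;> simp [ℓ, h]
  have hL : ∀ {a a' b b'} (i : Fin 4), P.Adj x a → P.Adj x a' → P.Adj x b → P.Adj x b' →
      lab x r e ℓ a ≠ .inr i → lab x r e ℓ a' ≠ .inr i → lab x r e ℓ b = .inr i →
      lab x r e ℓ b' = .inr i → a ≠ a' → b ≠ b' → (i = 0 ∨ i = 1) → Linked P {x}ᶜ a a' b b' := by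
    intro a a' b b' i ha ha' hb hb' la la' lb lb' haa hbb hi
    rw [lab_ne_inr] at la la'
    rw [lab_eq_inr] at lb lb'
    have hfb : ∀ {c}, ℓ c = i ↔ f c = f b := by
      intro c
      rcases hi with rfl | rfl
      · rw [hf0, (hf0 b).1 lb.2.2]
      · rw [hf1, (hf1 b).1 lb.2.2]
    refine linked_of_label hS h3 hN h hr he ha ha' hb hb' hre haa hbb lb.1 lb.2.1 lb'.1 lb'.2.1
      (hfb.1 lb'.2.2).symm ?_ ?_
    · rwa [Ne, hfb] at la
    · rwa [Ne, hfb] at la'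
  let m₁ : U → U ⊕ Fin 4 := merge (.inl x) (.inr 0) ∘ lab x r e ℓ
  have hm₁ : ∀ z, m₁ z = .inr 1 ↔ lab x r e ℓ z = .inr 1 := by
    intro z
    by_cases hz : lab x r e ℓ z = .inr 0
    · simp [m₁, hz, merge_self]
    · simp [m₁, merge_of_ne hz]
  have hm₁' : ∀ z, m₁ z = .inl x ∨ m₁ z = .inr 1 := by
    intro z
    by_cases hz : lab x r e ℓ z = .inr 0
    · simp [m₁, hz, merge_self]
    · simp only [m₁, Function.comp, merge_of_ne hz]
      simp only [lab, ℓ] at hz ⊢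
      split_ifs with h1 h2 <;> simp_all
  have hm₀ : merge (.inl x) (.inr 1) ∘ m₁ = fun _ => .inl x := by
    funext z
    rcases hm₁' z with h | h
    · simp [h, merge_of_ne]
    · simp [h, merge_self]
  have v₀ := exists_isVK_star_const (x := x) h
  rw [← hm₀] at v₀
  have v₁ := exists_isVK_star (fun z => (hm₁' z).imp_right fun h => ⟨1, h⟩) v₀
    fun a a' b b' ha ha' hb hb' ma ma' mb mb' haa hbb => hL 1 ha ha' hb hb' (by rwa [Ne, ← hm₁])
      (by rwa [Ne, ← hm₁]) ((hm₁ _).1 mb) ((hm₁ _).1 mb') haa hbb (Or.inr rfl)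
  obtain ⟨τ', Φ', v₂⟩ := exists_isVK_star (fun z => by simp only [lab]; split_ifs <;> simp) v₁
    fun a a' b b' ha ha' hb hb' ma ma' mb mb' haa hbb => hL 0 ha ha' hb hb' ma ma' mb mb' haa hbb
      (Or.inl rfl)
  refine ⟨ℓ, kf_starPlus hr he (fun z _ _ _ => ?_) v₂.kf⟩
  simp only [ℓ]
  split_ifs <;> decide

lemma exists_starPlus_of_complete (hS : S.Finite) (hsupp : ∀ a b, P.Adj a b → a ∈ S)
    (hcard : S.ncard = 5) (hr : P.Adj x r) (he : P.Adj x e)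
    (hre : r ≠ e) : ∃ ℓ, KF (starPlus P x r e ℓ) := by
  classical
  obtain ⟨b, c, hbc, hS'⟩ : ∃ b c, b ≠ c ∧ S \ {x, r, e} = {b, c} := by
    rw [← ncard_eq_two, ncard_sdiff, hcard, ncard_eq_three.2 ⟨x, r, e, hr.ne, he.ne, hre, rfl⟩]
    rintro z (rfl | rfl | rfl)
    exacts [hsupp _ _ hr, hsupp _ _ hr.symm, hsupp _ _ he.symm]
  have hmem : ∀ {z}, z ∈ S → z ≠ x → z ≠ r → z ≠ e → z = b ∨ z = c := by
    intro z h1 h2 h3 h4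
    have : z ∈ S \ {x, r, e} := ⟨h1, by simp [h2, h3, h4]⟩
    rwa [hS'] at this
  have hb : b ∈ S \ {x, r, e} := hS' ▸ mem_insert b {c}
  have hc : c ∈ S \ {x, r, e} := hS' ▸ mem_insert_of_mem b rfl
  simp only [mem_sdiff, mem_insert_iff, mem_singleton_iff, not_or] at hb hc
  let ℓ : U → Fin 4 := fun z => if z = b then 0 else 1
  refine ⟨ℓ, kf_starPlus hr he (fun z _ _ _ => by simp only [ℓ]; split_ifs <;> decide) ?_⟩
  let H := star P x (lab x r e ℓ) ⊔ (edge (.inl x) (.inl b) ⊔ edge (.inl x) (.inl c))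
  have hH : ∀ {s t}, H.Adj s t ↔ (star P x (lab x r e ℓ)).Adj s t ∨
      (s = .inl x ∧ t = .inl b ∨ s = .inl b ∧ t = .inl x) ∨
      (s = .inl x ∧ t = .inl c ∨ s = .inl c ∧ t = .inl x) := by
    intro s t
    have := hb.2.1; have := hc.2.1
    simp only [H, sup_adj, edge_adj]
    rcases s with s | s <;> rcases t with t | t <;> simp <;> grind
  have hn : ∀ {i : Fin 4} {s}, (star P x (lab x r e ℓ)).Adj (.inr i) s →
      s = .inl x ∨ (i = 0 ∧ s = .inl b) ∨ (i = 1 ∧ s = .inl c) := by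
    intro i s hs
    rcases star_neighbor_inr hs with h | ⟨z, hz, h1, rfl⟩
    · exact Or.inl h
    · rw [lab_eq_inr] at h1
      obtain ⟨h2, h3, rfl⟩ := h1
      rcases hmem (hsupp _ _ hz.symm) hz.ne' h2 h3 with rfl | rfl
      · simp [ℓ]
      · simp [ℓ, hbc.symm]
  refine KF.mono ?_ (le_sup_left : _ ≤ H)
  refine KF.add_vertex (v := .inr 0) (u := .inl x) (w := .inl b) (by simp) (by simp) ?_
    (Or.inr (hH.2 (by simp))) ?_
  · intro s hs
    rcases hH.1 hs with hs | hs
    · simpa using hn hs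
    · simp at hs
  refine KF.add_vertex (v := .inr 1) (u := .inl x) (w := .inl c) (by simp) (by simp) ?_
    (Or.inr (restr_adj.2 ⟨hH.2 (by simp), by simp, by simp⟩)) ?_
  · intro s hs
    rcases hH.1 (restr_le hs) with hs | hs
    · simpa using hn hs
    · simp at hs
  have hxS := hsupp _ _ hr
  refine kf_of_support_subset (F := hS.toFinset.map ⟨Sum.inl, Sum.inl_injective⟩) ?_ ?_
  · rintro s ⟨t, ⟨hst, h1, -⟩, h2, -⟩
    simp only [mem_compl_iff, mem_singleton_iff] at h1 h2
    simp only [Finset.coe_map, Function.Embedding.coeFn_mk, Finite.coe_toFinset]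
    rcases hH.1 hst with hst | hst
    · obtain ⟨hne, h | h⟩ := (fromRel_adj _ _ _).1 hst
      · cases h with
        | @base a b hab _ _ => exact ⟨a, hsupp _ _ hab, rfl⟩
        | @leaf z hz =>
          simp only [lab] at h1 h2 ⊢
          split_ifs at h1 h2 ⊢ with h3
          · exact ⟨x, hxS, rfl⟩
          · simp only [ℓ] at h1 h2
            split_ifs at h1 h2 <;> simp_all
        | @stem z hz => exact ⟨x, hxS, rfl⟩
      · cases h with
        | @base a b hab _ _ => exact ⟨b, hsupp _ _ hab.symm, rfl⟩
        | @leaf z hz => exact ⟨z, hsupp _ _ hz.symm, rfl⟩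
        | @stem z hz =>
          simp only [lab] at h1 h2 ⊢
          split_ifs at h1 h2 ⊢ with h3
          · exact ⟨x, hxS, rfl⟩
          · simp only [ℓ] at h1 h2
            split_ifs at h1 h2 <;> simp_all
    · rcases hst with (⟨rfl, -⟩ | ⟨rfl, -⟩) | (⟨rfl, -⟩ | ⟨rfl, -⟩)
      exacts [⟨x, hxS, rfl⟩, ⟨b, hb.1, rfl⟩, ⟨x, hxS, rfl⟩, ⟨c, hc.1, rfl⟩]
  · rw [Finset.card_map, ← ncard_eq_toFinset_card _ hS, hcard]

end StarPlus

section FiniteCore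

variable {U : Type*} {P : SimpleGraph U} {S T A B C D : Set U} {a a' b b' c d e r u v w x y z : U}
  {ℓ : U → Fin 4}

lemma starPlus_induction {p : U ⊕ Fin 4 → U ⊕ Fin 4 → Prop} (hs : ∀ s t, p s t → p t s)
    (hbase : ∀ a b, P.Adj a b → a ≠ x → b ≠ x → p (.inl a) (.inl b))
    (hleaf : ∀ z, P.Adj x z → p (lab x r e ℓ z) (.inl z))
    (hstem : ∀ z, P.Adj x z → z ≠ r → z ≠ e → p (.inl x) (.inr (ℓ z)))
    (h1 : p (.inl x) (.inr 2)) (h2 : p (.inl x) (.inr 3)) (h3 : p (.inr 2) (.inl e))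
    (h4 : p (.inr 3) (.inl r)) (s t : U ⊕ Fin 4) (hst : (starPlus P x r e ℓ).Adj s t) : p s t := by
  have key : ∀ s t, s ≠ t → StarRel P x (lab x r e ℓ) s t → p s t := by
    intro s t hne h
    cases h with
    | @base a b hab ha hb => exact hbase a b hab ha hb
    | @leaf z hz => exact hleaf z hz
    | @stem z hz =>
      by_cases h : z = r ∨ z = e
      · exact absurd (lab_root h).symm hne
      · rw [not_or] at h
        rw [lab_of_ne h.1 h.2]
        exact hstem z hz h.1 h.2
  rcases starPlus_adj.1 hst with h | h
  · obtain ⟨hne, h | h⟩ := (fromRel_adj _ _ _).1 h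
    · exact key s t hne h
    · exact hs _ _ (key t s hne.symm h)
  · rcases h with (⟨rfl, rfl⟩ | ⟨rfl, rfl⟩) | (⟨rfl, rfl⟩ | ⟨rfl, rfl⟩) |
      (⟨rfl, rfl⟩ | ⟨rfl, rfl⟩) | (⟨rfl, rfl⟩ | ⟨rfl, rfl⟩)
    exacts [h1, hs _ _ h1, h2, hs _ _ h2, h3, hs _ _ h3, h4, hs _ _ h4]

lemma starPlus_base (h : P.Adj a b) (ha : a ≠ x) (hb : b ≠ x) :
    (starPlus P x r e ℓ).Adj (.inl a) (.inl b) :=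
  starPlus_adj.2 (Or.inl ((StarRel.base h ha hb).adj (by simpa using h.ne)))

lemma starPlus_leaf (h : P.Adj x z) : (starPlus P x r e ℓ).Adj (lab x r e ℓ z) (.inl z) :=
  starPlus_adj.2 (Or.inl ((StarRel.leaf h).adj (lab_leaf_ne h)))

lemma starPlus_stem (h : P.Adj x z) (hr : z ≠ r) (he : z ≠ e) :
    (starPlus P x r e ℓ).Adj (.inl x) (.inr (ℓ z)) := by
  have h1 : StarRel P x (lab x r e ℓ) (.inl x) (lab x r e ℓ z) := StarRel.stem h
  rw [lab_of_ne hr he] at h1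
  exact starPlus_adj.2 (Or.inl (h1.adj (by simp)))

lemma starPlus_elim (hr : P.Adj x r) (he : P.Adj x e) (s t : U ⊕ Fin 4)
    (hst : (starPlus P x r e ℓ).Adj s t) (hs : s ≠ .inl x) (ht : t ≠ .inl x) :
    P.Adj (Sum.elim id (fun _ => x) s) (Sum.elim id (fun _ => x) t) := by
  refine starPlus_induction (p := fun s t => s ≠ .inl x → t ≠ .inl x →
    P.Adj (Sum.elim id (fun _ => x) s) (Sum.elim id (fun _ => x) t)) (fun s t h h1 h2 => (h h2 h1).symm)
    (fun a b h _ _ _ _ => h) (fun z hz h1 _ => ?_) (fun z _ _ _ h => absurd rfl h)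
    (fun h => absurd rfl h) (fun h => absurd rfl h) (fun _ _ => he) (fun _ _ => hr) s t hst hs ht
  by_cases h : z = r ∨ z = e
  · exact absurd (lab_root h) h1
  · rw [not_or] at h
    rw [lab_of_ne h.1 h.2]
    exact hz

/-- A separation of the graph `P` on `S` of order at most two, together with the minors obtained
by replacing either side by an edge. -/
structure Sep (P : SimpleGraph U) (S : Set U) (u w : U) (C D : Set U) : Prop where
  neC : C.Nonempty
  neD : D.Nonempty
  disj : Disjoint C D
  union : C ∪ D = S \ {u, w}
  notAdj : ∀ c ∈ C, ∀ d ∈ D, ¬ P.Adj c d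
  mem : u = w ∨ u ∈ S ∧ w ∈ S
  kfC : KF (restr P Cᶜ ⊔ edge u w)
  kfD : KF (restr P Dᶜ ⊔ edge u w)

lemma Sep.symm (h : Sep P S u w C D) : Sep P S u w D C :=
  ⟨h.neD, h.neC, h.disj.symm, by rw [union_comm, h.union], fun c hc d hd hcd =>
    h.notAdj d hd c hc hcd.symm, h.mem, h.kfD, h.kfC⟩

lemma Sep.comm (h : Sep P S u w C D) : Sep P S w u C D :=
  ⟨h.neC, h.neD, h.disj, by rw [h.union, pair_comm], h.notAdj, h.mem.imp Eq.symm And.symm,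
    by rw [edge_comm]; exact h.kfC, by rw [edge_comm]; exact h.kfD⟩

lemma exists_sep (hG : KF P) (h3 : ¬ ∀ u w, ConnOn P (S \ {u, w})) :
    ∃ u w C D, Sep P S u w C D := by
  have key : ∀ {u w}, ¬ ConnOn P (S \ {u, w}) → (u = w ∨ u ∈ S ∧ w ∈ S) →
      (∀ C a, a ∈ S \ {u, w} → comp P (S \ {u, w}) a ⊆ C → KF (restr P Cᶜ ⊔ edge u w)) →
      ∃ u w C D, Sep P S u w C D := by
    intro u w hn hm hk
    have : ∃ a ∈ S \ {u, w}, ∃ d ∈ S \ {u, w}, ¬ ReachIn P (S \ {u, w}) a d := by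
      by_contra! h
      exact hn (connOn_of_reachIn' h)
    obtain ⟨a, ha, d, hd, hr⟩ := this
    have hd' : d ∈ (S \ {u, w}) \ comp P (S \ {u, w}) a := ⟨hd, fun h => hr h.2⟩
    refine ⟨u, w, comp P (S \ {u, w}) a, (S \ {u, w}) \ comp P (S \ {u, w}) a,
      ⟨a, mem_comp_self ha⟩, ⟨d, hd'⟩, disjoint_sdiff_self_right, union_sdiff_cancel comp_subset,
      fun c hc d hd hcd => hd.2 (comp_closed c hc d hd.1 hcd), hm, hk _ a ha subset_rfl,
      hk _ d hd fun t ht => ⟨comp_subset ht, fun h => ?_⟩⟩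
    exact hr (h.2.trans (ht.2.symm hd))
  by_cases h2 : ∀ u, ConnOn P (S \ {u, u})
  · push Not at h3
    obtain ⟨u, w, huw⟩ := h3
    have hne : u ≠ w := by
      rintro rfl
      exact huw (h2 u)
    simp only [pair_eq_singleton] at h2
    have hu : u ∈ S := by
      by_contra hu
      rw [insert_eq, ← sdiff_sdiff, sdiff_singleton_eq_self hu] at huw
      exact huw (h2 w)
    have hw : w ∈ S := by
      by_contra hw
      rw [pair_comm, insert_eq, ← sdiff_sdiff, sdiff_singleton_eq_self hw] at huw
      exact huw (h2 u)
    refine key huw (Or.inr ⟨hu, hw⟩) fun C a ha hC => ?_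
    have hsub : ∀ t ∈ comp P (S \ {u, w}) a, t ∈ S ∧ t ≠ u ∧ t ≠ w := by
      intro t ht
      simpa using comp_subset ht
    refine KF.mono (hG.restr_sup_edge (S := (comp P (S \ {u, w}) a)ᶜ) (comp_connOn ha)
      disjoint_compl_right (fun h => (hsub u h).2.1 rfl) (fun h => (hsub w h).2.2 rfl) hne ?_ ?_) ?_
    · exact (h2 w).exists_adj (fun t ht => ⟨(hsub t ht).1, (hsub t ht).2.2⟩) ⟨a, mem_comp_self ha⟩
        ⟨hu, hne⟩ (fun h => (hsub u h).2.1 rfl) fun c hc d hd hdu hcd =>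
          comp_closed c hc d (by simp [hd.1, hdu]; exact hd.2) hcd
    · obtain ⟨c, hc, hcw⟩ := (h2 u).exists_adj (z := w)
        (fun t ht => ⟨(hsub t ht).1, (hsub t ht).2.1⟩) ⟨a, mem_comp_self ha⟩
        ⟨hw, hne.symm⟩ (fun h => (hsub w h).2.2 rfl) fun c hc d hd hdu hcd =>
          comp_closed c hc d (by simp [hd.1, hdu]; exact hd.2) hcd
      exact ⟨c, hc, hcw.symm⟩
    · exact sup_le_sup_right (fun s t hst => ⟨hst.1, fun h => hst.2.1 (hC h),
        fun h => hst.2.2 (hC h)⟩) _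
  · push Not at h2
    obtain ⟨u, hu⟩ := h2
    refine key hu (Or.inl rfl) fun C a _ _ => hG.mono ?_
    rw [edge_self_eq_bot, sup_bot_eq]
    exact restr_le

lemma Sep.notMem (h : Sep P S u w C D) : u ∉ C ∧ w ∉ C := by
  have : ∀ t ∈ C, t ∈ S \ {u, w} := fun t ht => h.union ▸ Or.inl ht
  exact ⟨fun hu => (this u hu).2 (by simp), fun hw => (this w hw).2 (by simp)⟩

lemma Sep.subset (h : Sep P S u w C D) : C ⊆ S :=
  fun t ht => (h.union ▸ Or.inl ht : t ∈ S \ {u, w}).1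

lemma Sep.mem_or (h : Sep P S u w C D) (hz : z ∈ S) : z ∈ C ∨ z ∈ D ∨ z = u ∨ z = w := by
  by_cases hz' : z = u ∨ z = w
  · exact Or.inr (Or.inr hz')
  · have : z ∈ C ∪ D := h.union ▸ ⟨hz, hz'⟩
    exact this.imp id Or.inl

lemma Sep.adj_left (h : Sep P S u w C D) (hsupp : ∀ a b, P.Adj a b → a ∈ S) (hc : c ∈ C)
    (hcd : P.Adj c d) : d ∈ C ∨ d = u ∨ d = w := by
  rcases h.mem_or (hsupp _ _ hcd.symm) with h1 | h1 | h1
  · exact Or.inl h1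
  · exact absurd hcd (h.notAdj c hc d h1)
  · exact Or.inr h1

lemma Sep.support (h : Sep P S u w C D) (hsupp : ∀ a b, P.Adj a b → a ∈ S)
    (hab : (restr P Cᶜ ⊔ edge u w).Adj a b) : a ∈ S \ C := by
  rcases hab with hab | hab
  · exact ⟨hsupp _ _ hab.1, hab.2.1⟩
  · obtain ⟨h1, h2⟩ := (edge_adj _ _ _ _).1 hab
    have := h.notMem
    rcases h.mem with h3 | ⟨h3, h4⟩
    · subst h3
      rcases h1 with ⟨rfl, rfl⟩ | ⟨rfl, rfl⟩ <;> exact absurd rfl h2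
    · rcases h1 with ⟨rfl, rfl⟩ | ⟨rfl, rfl⟩
      · exact ⟨h3, this.1⟩
      · exact ⟨h4, this.2⟩

lemma Sep.reachIn (h : Sep P S u w C D) (hsupp : ∀ a b, P.Adj a b → a ∈ S)
    (he : e ∉ C) (hre : ReachIn P (S \ T) r e) :
    ReachIn (restr P Cᶜ ⊔ edge u w) ((S \ C) \ T) r e := by
  intro Z hZ hrZ hcl
  have hrest : ∀ z ∈ Z, ∀ d ∈ S \ T, d ∉ C → P.Adj z d → d ∈ Z := fun z hz d hd hdC hzd =>
    hcl z hz d ⟨⟨hd.1, hdC⟩, hd.2⟩ (Or.inl ⟨hzd, (hZ hz).1.2, hdC⟩)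
  by_cases huw : u ∈ Z ∨ w ∈ Z
  · have := hre (Z ∪ C \ T) ?_ (Or.inl hrZ) ?_
    · exact this.resolve_right fun h => he h.1
    · rintro t (ht | ht)
      · exact ⟨(hZ ht).1.1, (hZ ht).2⟩
      · exact ⟨h.subset ht.1, ht.2⟩
    · rintro z (hz | hz) d hd hzd
      · by_cases hdC : d ∈ C
        · exact Or.inr ⟨hdC, hd.2⟩
        · exact Or.inl (hrest z hz d hd hdC hzd)
      · rcases h.adj_left hsupp hz.1 hzd with h1 | h1
        · exact Or.inr ⟨h1, hd.2⟩
        · left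
          have hnC := h.notMem
          rcases h1 with rfl | rfl
          · rcases huw with h1 | h1
            · exact h1
            · by_cases hdw : d = w
              · rwa [hdw]
              · exact hcl w h1 d ⟨⟨hd.1, hnC.1⟩, hd.2⟩
                  (Or.inr ((edge_adj _ _ _ _).2 ⟨Or.inr ⟨rfl, rfl⟩, Ne.symm hdw⟩))
          · rcases huw with h1 | h1
            · by_cases hdw : u = d
              · rwa [← hdw]
              · exact hcl u h1 d ⟨⟨hd.1, hnC.2⟩, hd.2⟩
                  (Or.inr ((edge_adj _ _ _ _).2 ⟨Or.inl ⟨rfl, rfl⟩, hdw⟩))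
            · exact h1
  · refine hre Z (fun t ht => ⟨(hZ ht).1.1, (hZ ht).2⟩) hrZ fun z hz d hd hzd => ?_
    refine hrest z hz d hd (fun hdC => ?_) hzd
    rcases h.adj_left hsupp hdC hzd.symm with h1 | rfl | rfl
    · exact (hZ hz).1.2 h1
    · exact huw (Or.inl hz)
    · exact huw (Or.inr hz)

lemma Sep.starPlus_of_mem (h : Sep P S u w C D) (hsupp : ∀ a b, P.Adj a b → a ∈ S) (hx : x ∈ D)
    (hr : P.Adj x r) (he : P.Adj x e)
    (hk : KF (starPlus (restr P Cᶜ ⊔ edge u w) x r e ℓ)) : KF (starPlus P x r e ℓ) := by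
  have hxC : x ∉ C := fun h' => h.disj.le_bot ⟨h', hx⟩
  have hN : ∀ {z}, P.Adj x z → z ∉ C := fun hz hzC => h.notAdj _ hzC _ hx hz.symm
  have hN' : ∀ {z}, P.Adj x z → (restr P Cᶜ ⊔ edge u w).Adj x z := fun hz =>
    Or.inl ⟨hz, hxC, hN hz⟩
  obtain ⟨hu, hw⟩ := h.notMem
  obtain ⟨hxu, hxw⟩ : x ≠ u ∧ x ≠ w :=
    ⟨fun h' => h.symm.notMem.1 (h' ▸ hx), fun h' => h.symm.notMem.2 (h' ▸ hx)⟩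
  have hlab : ∀ z, lab x r e ℓ z ∈ (Sum.inl '' C : Set (U ⊕ Fin 4))ᶜ := by
    rintro z ⟨c, hc, h1⟩
    exact hxC ((lab_eq_inl.1 h1.symm).2 ▸ hc)
  have hinl : ∀ {z}, z ∉ C → (.inl z : U ⊕ Fin 4) ∈ (Sum.inl '' C : Set (U ⊕ Fin 4))ᶜ := by
    rintro z hz ⟨c, hc, h1⟩
    exact hz (by simpa [← Sum.inl_injective h1] using hc)
  refine KF.two_sum (V₁ := (Sum.inl '' C)ᶜ) (V₂ := Sum.inl '' (C ∪ {u, w})) (u := .inl u)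
    (w := .inl w) ?_ (hinl hu) (hinl hw) ⟨u, by simp, rfl⟩ ⟨w, by simp, rfl⟩ ?_ ?_ ?_
  · rintro _ ⟨h1, t, ht | ht, rfl⟩
    · exact absurd ⟨t, ht, rfl⟩ h1
    · rcases ht with rfl | rfl <;> simp
  · refine starPlus_induction (fun s t h => h.imp And.symm And.symm) (fun a b hab ha hb => ?_)
      (fun z hz => Or.inl ⟨hlab z, hinl (hN hz)⟩)
      (fun z hz _ _ => Or.inl ⟨hinl hxC, by simp⟩) (Or.inl ⟨hinl hxC, by simp⟩)
      (Or.inl ⟨hinl hxC, by simp⟩) (Or.inl ⟨by simp, hinl (hN he)⟩) (Or.inl ⟨by simp, hinl (hN hr)⟩)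
    by_cases haC : a ∈ C
    · exact Or.inr ⟨⟨a, Or.inl haC, rfl⟩, ⟨b, h.adj_left hsupp haC hab, rfl⟩⟩
    · by_cases hbC : b ∈ C
      · exact Or.inr ⟨⟨a, h.adj_left hsupp hbC hab.symm, rfl⟩, ⟨b, Or.inl hbC, rfl⟩⟩
      · exact Or.inl ⟨hinl haC, hinl hbC⟩
  · refine hk.mono (sup_le ?_ ?_)
    · rintro s t ⟨hst, hs, ht⟩
      revert hs ht
      refine starPlus_induction (p := fun s t => s ∈ (Sum.inl '' C : Set (U ⊕ Fin 4))ᶜ →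
        t ∈ (Sum.inl '' C : Set (U ⊕ Fin 4))ᶜ →
        (starPlus (restr P Cᶜ ⊔ edge u w) x r e ℓ).Adj s t) (fun s t h h1 h2 => (h h2 h1).symm)
        (fun a b hab ha hb h1 h2 => starPlus_base (Or.inl ⟨hab, fun h' => h1 ⟨a, h', rfl⟩,
          fun h' => h2 ⟨b, h', rfl⟩⟩) ha hb) (fun z hz _ _ => starPlus_leaf (hN' hz))
        (fun z hz hr he _ _ => starPlus_stem (hN' hz) hr he)
        (fun _ _ => starPlus_adj.2 (by simp)) (fun _ _ => starPlus_adj.2 (by simp))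
        (fun _ _ => starPlus_adj.2 (by simp)) (fun _ _ => starPlus_adj.2 (by simp)) s t hst
    · rw [edge_le_iff]
      by_cases huw : u = w
      · exact Or.inl (by rw [huw])
      · exact Or.inr (starPlus_base (Or.inr ((edge_adj _ _ _ _).2 ⟨Or.inl ⟨rfl, rfl⟩, huw⟩))
          hxu.symm hxw.symm)
  · have hV : ∀ {t}, t ∈ C ∪ {u, w} → t ∈ Dᶜ ∧ t ≠ x := by
      have : ∀ {t}, t ∈ C ∪ {u, w} → t ∈ Dᶜ := by
        rintro t (ht | rfl | rfl)
        · exact fun h' => h.disj.le_bot ⟨ht, h'⟩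
        · exact h.symm.notMem.1
        · exact h.symm.notMem.2
      intro t ht
      exact ⟨this ht, fun h' => this ht (h' ▸ hx)⟩
    have hV' : ∀ {s t}, (restr (starPlus P x r e ℓ) (Sum.inl '' (C ∪ {u, w})) ⊔
        edge (Sum.inl u) (Sum.inl w)).Adj s t → s ∈ Sum.inl '' (C ∪ {u, w}) := by
      rintro s t (⟨-, h1, -⟩ | h1)
      · exact h1
      · obtain ⟨⟨rfl, rfl⟩ | ⟨rfl, rfl⟩, -⟩ := (edge_adj _ _ _ _).1 h1
        exacts [⟨u, by simp, rfl⟩, ⟨w, by simp, rfl⟩]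
    refine h.kfD.of_hom (Sum.elim id fun _ => x) ?_ ?_
    · rintro s ⟨s', hs⟩ t ⟨t', ht⟩ hst
      obtain ⟨a, _, rfl⟩ := hV' hs
      obtain ⟨b, _, rfl⟩ := hV' ht
      simpa using hst
    · rintro s t (⟨h1, ⟨a, ha, rfl⟩, ⟨b, hb, rfl⟩⟩ | h1)
      · exact Or.inl ⟨starPlus_elim hr he _ _ h1 (by simpa using (hV ha).2)
          (by simpa using (hV hb).2), (hV ha).1, (hV hb).1⟩
      · right
        obtain ⟨⟨rfl, rfl⟩ | ⟨rfl, rfl⟩, h2⟩ := (edge_adj _ _ _ _).1 h1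
        · exact (edge_adj _ _ _ _).2 ⟨Or.inl ⟨rfl, rfl⟩, by simpa using h2⟩
        · exact (edge_adj _ _ _ _).2 ⟨Or.inr ⟨rfl, rfl⟩, by simpa using h2⟩

end FiniteCore

section FiniteCore

variable {U : Type*} {P : SimpleGraph U} {S T A B C D : Set U} {a a' b b' c d e r u v w x y z : U}
  {ℓ : U → Fin 4}

lemma Sep.exists_starPlus (h : Sep P S x w C D) (hsupp : ∀ a b, P.Adj a b → a ∈ S)
    (hr : P.Adj x r) (he : P.Adj x e) (hrC : r ∉ C) (heC : e ∉ C)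
    (hk : KF (starPlus (restr P Cᶜ ⊔ edge x w) x r e ℓ)) : ∃ ℓ, KF (starPlus P x r e ℓ) := by
  classical
  obtain ⟨hx, hw⟩ := h.notMem
  obtain ⟨hxD, hwD⟩ := h.symm.notMem
  have hDC : ∀ {z}, z ∈ C → z ∉ D := fun h1 h2 => h.disj.le_bot ⟨h1, h2⟩
  let i : Fin 4 := if w = r then 3 else if w = e ∨ w = x then 2 else ℓ w
  let ℓ' : U → Fin 4 := fun z => if z ∈ C then i else ℓ z
  let ŵ : U ⊕ Fin 4 := if w = x then .inr i else .inl w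
  have hlab : ∀ {z}, z ∉ C → lab x r e ℓ' z = lab x r e ℓ z := by
    intro z hz
    simp only [lab, ℓ', if_neg hz]
  have hlabC : ∀ {z}, z ∈ C → lab x r e ℓ' z = .inr i := by
    intro z hz
    rw [lab_of_ne (by rintro rfl; exact hrC hz) (by rintro rfl; exact heC hz)]
    simp only [ℓ', if_pos hz]
  have hN' : ∀ {z}, P.Adj x z → z ∉ C → (restr P Cᶜ ⊔ edge x w).Adj x z := fun hz hzC =>
    Or.inl ⟨hz, hx, hzC⟩
  have hxw : w ≠ x → (restr P Cᶜ ⊔ edge x w).Adj x w := fun h' =>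
    Or.inr ((edge_adj _ _ _ _).2 ⟨Or.inl ⟨rfl, rfl⟩, h'.symm⟩)
  have hlab' : ∀ z, lab x r e ℓ' z ∈ (Sum.inl '' C : Set (U ⊕ Fin 4))ᶜ := by
    rintro z ⟨c, hc, h1⟩
    exact hx ((lab_eq_inl.1 h1.symm).2 ▸ hc)
  have hinl : ∀ {z}, z ∉ C → (.inl z : U ⊕ Fin 4) ∈ (Sum.inl '' C : Set (U ⊕ Fin 4))ᶜ := by
    rintro z hz ⟨c, hc, h1⟩
    exact hz (by simpa [← Sum.inl_injective h1] using hc)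
  have hinr : ∀ {j}, (.inr j : U ⊕ Fin 4) ∈ (Sum.inl '' C : Set (U ⊕ Fin 4))ᶜ := by simp
  have hŵ : ŵ ∈ (Sum.inl '' C : Set (U ⊕ Fin 4))ᶜ := by
    simp only [ŵ]
    split_ifs
    exacts [hinr, hinl hw]
  have hxi : (starPlus (restr P Cᶜ ⊔ edge x w) x r e ℓ).Adj (.inl x) (.inr i) := by
    simp only [i]
    split_ifs with h1 h2
    · exact starPlus_adj.2 (by simp)
    · exact starPlus_adj.2 (by simp)
    · rw [not_or] at h2
      exact starPlus_stem (hxw h2.2) h1 h2.1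
  have hiw : w ≠ x → (starPlus (restr P Cᶜ ⊔ edge x w) x r e ℓ).Adj (.inr i) (.inl w) := by
    intro hwx
    simp only [i]
    split_ifs with h1 h2
    · exact starPlus_adj.2 (by simp [h1])
    · exact starPlus_adj.2 (by simp [h2.resolve_right hwx])
    · rw [not_or] at h2
      have := starPlus_leaf (r := r) (e := e) (ℓ := ℓ) (hxw hwx)
      rwa [lab_of_ne h1 h2.1] at this
  refine ⟨ℓ', KF.two_sum (V₁ := (Sum.inl '' C)ᶜ) (V₂ := Sum.inl '' C ∪ {.inr i, ŵ}) (u := .inr i)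
    (w := ŵ) ?_ hinr hŵ (by simp) (by simp) ?_ ?_ ?_⟩
  · rintro s ⟨h1, h2 | h2⟩
    · exact absurd h2 h1
    · exact h2
  · have hbase : ∀ a b, P.Adj a b → b ≠ x → a ∈ C →
        (.inl a : U ⊕ Fin 4) ∈ Sum.inl '' C ∪ {.inr i, ŵ} ∧
          (.inl b : U ⊕ Fin 4) ∈ Sum.inl '' C ∪ {.inr i, ŵ} := by
      intro a b hab hb haC
      refine ⟨Or.inl ⟨a, haC, rfl⟩, ?_⟩
      rcases h.adj_left hsupp haC hab with h1 | h1 | h1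
      · exact Or.inl ⟨b, h1, rfl⟩
      · exact absurd h1 hb
      · subst h1
        simp [ŵ, hb]
    refine starPlus_induction (fun s t h => h.imp And.symm And.symm) (fun a b hab ha hb => ?_)
      (fun z hz => ?_)
      (fun z hz _ _ => Or.inl ⟨hinl hx, hinr⟩) (Or.inl ⟨hinl hx, hinr⟩)
      (Or.inl ⟨hinl hx, hinr⟩) (Or.inl ⟨hinr, hinl heC⟩) (Or.inl ⟨hinr, hinl hrC⟩)
    · by_cases haC : a ∈ C
      · exact Or.inr (hbase a b hab hb haC)
      · by_cases hbC : b ∈ C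
        · exact Or.inr (hbase b a hab.symm ha hbC).symm
        · exact Or.inl ⟨hinl haC, hinl hbC⟩
    · by_cases hzC : z ∈ C
      · rw [hlabC hzC]
        exact Or.inr ⟨by simp, Or.inl ⟨z, hzC, rfl⟩⟩
      · exact Or.inl ⟨hlab' z, hinl hzC⟩
  · refine hk.mono (sup_le ?_ ?_)
    · rintro s t ⟨hst, hs, ht⟩
      revert hs ht
      refine starPlus_induction (p := fun s t => s ∈ (Sum.inl '' C : Set (U ⊕ Fin 4))ᶜ →
        t ∈ (Sum.inl '' C : Set (U ⊕ Fin 4))ᶜ →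
        (starPlus (restr P Cᶜ ⊔ edge x w) x r e ℓ).Adj s t) (fun s t h h1 h2 => (h h2 h1).symm)
        (fun a b hab ha hb h1 h2 => starPlus_base (Or.inl ⟨hab, fun h' => h1 ⟨a, h', rfl⟩,
          fun h' => h2 ⟨b, h', rfl⟩⟩) ha hb) (fun z hz _ h2 => ?_)
        (fun z hz hr he _ _ => ?_)
        (fun _ _ => starPlus_adj.2 (by simp)) (fun _ _ => starPlus_adj.2 (by simp))
        (fun _ _ => starPlus_adj.2 (by simp)) (fun _ _ => starPlus_adj.2 (by simp)) s t hst
      · have hzC : z ∉ C := fun h' => h2 ⟨z, h', rfl⟩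
        rw [hlab hzC]
        exact starPlus_leaf (hN' hz hzC)
      · by_cases hzC : z ∈ C
        · simp only [ℓ', if_pos hzC]
          exact hxi
        · simp only [ℓ', if_neg hzC]
          exact starPlus_stem (hN' hz hzC) hr he
    · rw [edge_le_iff]
      by_cases hwx : w = x
      · exact Or.inl (by simp [ŵ, hwx])
      · right
        simp only [ŵ, if_neg hwx]
        exact hiw hwx
  · have hV : ∀ {s}, s ∈ Sum.inl '' C ∪ {.inr i, ŵ} →
        s = .inr i ∨ ∃ t, s = .inl t ∧ t ∉ D ∧ t ≠ x := by
      rintro s (⟨t, ht, rfl⟩ | rfl | rfl)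
      · exact Or.inr ⟨t, rfl, hDC ht, by rintro rfl; exact hx ht⟩
      · exact Or.inl rfl
      · simp only [ŵ]
        split_ifs with hwx
        · exact Or.inl rfl
        · exact Or.inr ⟨w, rfl, hwD, hwx⟩
    have hV' : ∀ {s t}, (restr (starPlus P x r e ℓ') (Sum.inl '' C ∪ {.inr i, ŵ}) ⊔
        edge (.inr i) ŵ).Adj s t → s ∈ Sum.inl '' C ∪ {.inr i, ŵ} := by
      rintro s t (⟨-, h1, -⟩ | h1)
      · exact h1
      · obtain ⟨⟨rfl, rfl⟩ | ⟨rfl, rfl⟩, -⟩ := (edge_adj _ _ _ _).1 h1 <;> simp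
    have hVx : ∀ {s}, s ∈ Sum.inl '' C ∪ {.inr i, ŵ} →
        s ≠ .inl x ∧ Sum.elim id (fun _ => x) s ∈ Dᶜ := by
      intro s hs
      rcases hV hs with rfl | ⟨t, rfl, h1, h2⟩
      · exact ⟨by simp, hxD⟩
      · exact ⟨by simpa using h2, h1⟩
    have hŵx : Sum.elim id (fun _ => x) ŵ = w := by
      simp only [ŵ]
      split_ifs with hwx
      exacts [hwx.symm, rfl]
    refine h.kfD.of_hom (Sum.elim id fun _ => x) ?_ ?_
    · rintro s ⟨s', hs⟩ t ⟨t', ht⟩ hst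
      rcases hV (hV' hs) with rfl | ⟨a, rfl, -, ha⟩ <;> rcases hV (hV' ht) with rfl | ⟨b, rfl, -, hb⟩
      · rfl
      · exact absurd hst.symm hb
      · exact absurd hst ha
      · simpa using hst
    · rintro s t (⟨h1, h2, h3⟩ | h1)
      · exact Or.inl ⟨starPlus_elim hr he _ _ h1 (hVx h2).1 (hVx h3).1, (hVx h2).2, (hVx h3).2⟩
      · right
        obtain ⟨⟨rfl, rfl⟩ | ⟨rfl, rfl⟩, h2⟩ := (edge_adj _ _ _ _).1 h1
        · refine (edge_adj _ _ _ _).2 ⟨Or.inl ⟨rfl, hŵx⟩, ?_⟩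
          rw [hŵx]
          rintro h3
          exact h2 (by simp [ŵ, ← h3])
        · refine (edge_adj _ _ _ _).2 ⟨Or.inr ⟨hŵx, rfl⟩, ?_⟩
          rw [hŵx]
          rintro h3
          exact h2 (by simp [ŵ, h3])

/-- A vertex `x` of a finite `K₃,₃`-free graph may be replaced by a star with at most four leaves
that are not joined to the neighbours `r` and `e`, provided no vertex separates these in the
complement of `x`. -/
theorem exists_starPlus (hS : S.Finite) (hsupp : ∀ a b, P.Adj a b → a ∈ S) (hG : KF P)
    (hr : P.Adj x r) (he : P.Adj x e) (hre : r ≠ e) (h1 : ReachIn P (S \ {x}) r e)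
    (h2 : ∀ w, w ≠ x → w ≠ r → w ≠ e → ReachIn P (S \ {x, w}) r e) :
    ∃ ℓ, KF (starPlus P x r e ℓ) := by
  induction hn : S.ncard using Nat.strong_induction_on generalizing S P with
  | _ n ih =>
  subst hn
  have hrS := hsupp _ _ hr.symm
  have heS := hsupp _ _ he.symm
  by_cases h3 : ∀ u w, ConnOn P (S \ {u, w})
  · rcases exists_isVK_or_complete hS hsupp hG h3 with ⟨τ, Φ, h⟩ | ⟨hc, -⟩
    · exact exists_starPlus_of_isVK h hS (fun z hz => hsupp _ _ hz.symm) h3 hr he hre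
    · exact exists_starPlus_of_complete hS hsupp hc hr he hre
  obtain ⟨u, w, C, D, h⟩ := exists_sep hG h3
  have step : ∀ {u w C D}, Sep P S u w C D → x ∉ C → r ∉ C → e ∉ C →
      ∃ ℓ, KF (starPlus (restr P Cᶜ ⊔ edge u w) x r e ℓ) := by
    intro u w C D h hx hrC heC
    refine ih _ (ncard_lt_ncard ?_ hS) (hS.subset sdiff_subset) (fun a b hab => h.support hsupp hab)
      h.kfC (Or.inl ⟨hr, hx, hrC⟩) (Or.inl ⟨he, hx, heC⟩) (h.reachIn hsupp heC h1)
      (fun w' hx' hr' he' => h.reachIn hsupp heC (h2 w' hx' hr' he')) rfl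
    obtain ⟨c, hc⟩ := h.neC
    exact ⟨sdiff_subset, fun h' => (h' (h.subset hc)).2 hc⟩
  have hA : ∀ {u w C D}, Sep P S u w C D → x ∈ D → ∃ ℓ, KF (starPlus P x r e ℓ) := by
    intro u w C D h hx
    have hN : ∀ {z}, P.Adj x z → z ∉ C := fun hz hzC => h.notAdj _ hzC _ hx hz.symm
    obtain ⟨ℓ, hℓ⟩ := step h (fun h' => h.disj.le_bot ⟨h', hx⟩) (hN hr) (hN he)
    exact ⟨ℓ, h.starPlus_of_mem hsupp hx hr he hℓ⟩
  have hB' : ∀ {w C D}, Sep P S x w C D → r ∉ C → e ∉ C → ∃ ℓ, KF (starPlus P x r e ℓ) := by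
    intro w C D h hrC heC
    obtain ⟨ℓ, hℓ⟩ := step h h.notMem.1 hrC heC
    exact h.exists_starPlus hsupp hr he hrC heC hℓ
  have hB : ∀ {w}, Sep P S x w C D → ∃ ℓ, KF (starPlus P x r e ℓ) := by
    intro w h
    have hsep : ∀ {C D}, Sep P S x w C D → r ∈ C → e ∉ D := by
      intro C D h hrC heD
      have hwr : w ≠ r := fun h' => h.notMem.2 (h' ▸ hrC)
      have hwe : w ≠ e := fun h' => h.symm.notMem.2 (h' ▸ heD)
      have : ReachIn P (S \ {x, w}) r e := by
        by_cases hwx : w = x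
        · rw [hwx, pair_eq_singleton]
          exact h1
        · exact h2 w hwx hwr hwe
      have := this C (h.union ▸ subset_union_left) hrC fun c hc d hd hcd => by
        rw [← h.union] at hd
        exact hd.resolve_right fun h' => h.notAdj c hc d h' hcd
      exact h.disj.le_bot ⟨this, heD⟩
    by_cases hrC : r ∈ C
    · exact hB' h.symm (fun h' => h.disj.le_bot ⟨hrC, h'⟩) (hsep h hrC)
    · by_cases heC : e ∈ C
      · refine hB' h.symm (fun h' => hsep h.symm h' heC) fun h' => h.disj.le_bot ⟨heC, h'⟩
      · exact hB' h hrC heC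
  rcases h.mem_or (hsupp _ _ hr) with hx | hx | rfl | rfl
  · exact hA h.symm hx
  · exact hA h hx
  · exact hB h
  · exact hB h.comm

end FiniteCore

section Expand

variable {U : Type*} {P : SimpleGraph U} {S T A B C D K : Set U}
  {a a' b b' c d e r u v w x y z : U} {α α₁ α₂ : U → List (Fin 6)}

/-- The edges of the graph obtained from `P` by replacing `x` by a tree of lists, with the
neighbour `z` of `x` attached to `α z`. -/
inductive ExpandRel (P : SimpleGraph U) (x : U) (α : U → List (Fin 6)) :
    U ⊕ List (Fin 6) → U ⊕ List (Fin 6) → Prop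
  | base {a b : U} : P.Adj a b → a ≠ x → b ≠ x → ExpandRel P x α (.inl a) (.inl b)
  | leaf {z : U} : P.Adj x z → ExpandRel P x α (.inr (α z)) (.inl z)
  | tree {z : U} {i : Fin 6} {l : List (Fin 6)} : P.Adj x z → i :: l <:+ α z →
      ExpandRel P x α (.inr l) (.inr (i :: l))

/-- `P` with the vertex `x` replaced by a tree of lists, whose vertex `α z` is joined to the
neighbour `z` of `x`. -/
def expand (P : SimpleGraph U) (x : U) (α : U → List (Fin 6)) : SimpleGraph (U ⊕ List (Fin 6)) :=
  fromRel (ExpandRel P x α)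

lemma ExpandRel.adj {s t : U ⊕ List (Fin 6)} (h : ExpandRel P x α s t) : (expand P x α).Adj s t := by
  refine (fromRel_adj _ _ _).2 ⟨?_, Or.inl h⟩
  cases h with
  | base h _ _ => simpa using h.ne
  | leaf => simp
  | tree => simp

lemma expand_induction {p : U ⊕ List (Fin 6) → U ⊕ List (Fin 6) → Prop}
    (hs : ∀ s t, p s t → p t s)
    (hbase : ∀ a b, P.Adj a b → a ≠ x → b ≠ x → p (.inl a) (.inl b))
    (hleaf : ∀ z, P.Adj x z → p (.inr (α z)) (.inl z))
    (htree : ∀ z i l, P.Adj x z → i :: l <:+ α z → p (.inr l) (.inr (i :: l)))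
    (s t : U ⊕ List (Fin 6)) (hst : (expand P x α).Adj s t) : p s t := by
  have key : ∀ s t, ExpandRel P x α s t → p s t := by
    intro s t h
    cases h with
    | @base a b hab ha hb => exact hbase a b hab ha hb
    | @leaf z hz => exact hleaf z hz
    | @tree z i l hz h => exact htree z i l hz h
  obtain ⟨-, h | h⟩ := (fromRel_adj _ _ _).1 hst
  · exact key s t h
  · exact hs _ _ (key t s h)

lemma exists_suffix_of_expand {l : List (Fin 6)} {t : U ⊕ List (Fin 6)}
    (h : (expand P x α).Adj (.inr l) t) : ∃ z, P.Adj x z ∧ l <:+ α z := by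
  have := expand_induction (P := P) (x := x) (α := α) (p := fun s t =>
    (∀ l, s = .inr l → ∃ z, P.Adj x z ∧ l <:+ α z) ∧ ∀ l, t = .inr l → ∃ z, P.Adj x z ∧ l <:+ α z)
    (fun s t h => h.symm) (by simp) (fun z hz => ⟨fun l hl => ⟨z, hz, by simp [Sum.inr_injective hl]⟩,
      by simp⟩) (fun z i l hz h => ⟨fun l' hl => ⟨z, hz, ?_⟩, fun l' hl => ⟨z, hz, ?_⟩⟩) _ _ h
  · exact this.1 l rfl
  · rw [← Sum.inr_injective hl]
    exact (List.suffix_cons i l).trans h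
  · rw [← Sum.inr_injective hl]
    exact h

lemma expand_mono {Q : SimpleGraph U} (h : P ≤ Q) : expand P x α ≤ expand Q x α :=
  fun s t => expand_induction (p := (expand Q x α).Adj) (fun _ _ h => h.symm)
    (fun _ _ hab ha hb => (ExpandRel.base (h hab) ha hb).adj)
    (fun _ hz => (ExpandRel.leaf (h hz)).adj)
    (fun _ _ _ hz hl => (ExpandRel.tree (h hz) hl).adj) s t

lemma suffix_append_cons {l k t : List (Fin 6)} {i : Fin 6} (h : l <:+ k ++ i :: t) :
    l <:+ t ∨ l = i :: t ∨ ∃ j k', l = j :: k' ++ i :: t ∧ j :: k' <:+ k := by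
  rcases List.suffix_or_suffix_of_suffix h (List.suffix_append k (i :: t)) with h' | ⟨k', rfl⟩
  · rcases List.suffix_cons_iff.1 h' with h' | h'
    exacts [Or.inr (Or.inl h'), Or.inl h']
  · rw [List.suffix_append_self_iff] at h
    cases k' with
    | nil => simp
    | cons j k' => exact Or.inr (Or.inr ⟨j, k', rfl, h⟩)

lemma not_cons_suffix {l : List (Fin 6)} {i : Fin 6} : ¬ i :: l <:+ l := fun h => by
  simpa using h.length_le

lemma kf_expand_ears {i j : Fin 6} (hij : i ≠ j) (hw : P.Adj x w)
    (hi : ∀ z, P.Adj x z → ¬ i :: α w <:+ α z) (hj : ∀ z, P.Adj x z → ¬ j :: α w <:+ α z)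
    (h : KF (expand P x α)) :
    KF (expand P x α ⊔ (edge (.inr (i :: α w)) (.inr (α w)) ⊔ edge (.inr (i :: α w)) (.inl w)) ⊔
      (edge (.inr (j :: α w)) (.inr (α w)) ⊔ edge (.inr (j :: α w)) (.inl w))) := by
  have step : ∀ {H : SimpleGraph (U ⊕ List (Fin 6))} {i : Fin 6}, expand P x α ≤ H →
      (∀ t, ¬ H.Adj (.inr (i :: α w)) t) → KF H → KF (H ⊔ (edge (.inr (i :: α w)) (.inr (α w)) ⊔
        edge (.inr (i :: α w)) (.inl w))) := by
    intro H i hle hH h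
    refine KF.add_vertex (v := .inr (i :: α w)) (u := .inr (α w)) (w := .inl w) (by simp) (by simp)
      ?_ (Or.inr (Or.inl (hle (ExpandRel.leaf hw).adj))) (h.mono ?_)
    · rintro s (hs | hs)
      · exact absurd hs (hH s)
      · simp only [sup_adj, edge_adj] at hs
        grind
    · rintro s t ⟨hst, h1, h2⟩
      refine hst.resolve_right fun h3 => ?_
      simp only [sup_adj, edge_adj, mem_compl_iff, mem_singleton_iff] at h1 h2 h3
      grind
  have hn : ∀ {i : Fin 6}, (∀ z, P.Adj x z → ¬ i :: α w <:+ α z) → ∀ t,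
      ¬ (expand P x α).Adj (.inr (i :: α w)) t := by
    intro i hi t ht
    obtain ⟨z, hz, h1⟩ := exists_suffix_of_expand ht
    exact hi z hz h1
  refine step le_sup_left ?_ (step le_rfl (hn hi) h)
  rintro t (ht | ht)
  · exact hn hj t ht
  · simp only [sup_adj, edge_adj] at ht
    have h1 : j :: α w ≠ α w := by simp
    have h2 : j :: α w ≠ i :: α w := by simpa using hij.symm
    grind

open Classical in
/-- The addresses obtained by combining those of the two sides of a separation of order two. -/
noncomputable def combine (K : Set U) (w : U) (α₁ α₂ : U → List (Fin 6)) (z : U) : List (Fin 6) :=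
  if z ∈ K then α₁ z ++ 4 :: α₂ w else if z = w then 5 :: α₂ w else α₂ z

lemma combine_mem (h : z ∈ K) : combine K w α₁ α₂ z = α₁ z ++ 4 :: α₂ w := if_pos h

lemma combine_self (h : w ∉ K) : combine K w α₁ α₂ w = 5 :: α₂ w := by
  simp [combine, h]

lemma combine_notMem (h : z ∉ K) (hw : z ≠ w) : combine K w α₁ α₂ z = α₂ z := by
  simp [combine, h, hw]

lemma kf_expand_combine (hxK : x ∉ K) (hwK : w ∉ K) (hwx : w ≠ x)
    (hK : ∀ c ∈ K, ∀ d, P.Adj c d → d ∈ K ∨ d = x ∨ d = w) (hα₁ : α₁ w = [])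
    (h₁ : KF (expand (restr P (K ∪ {x, w}) ⊔ edge x w) x α₁))
    (h₂ : KF (expand (restr P Kᶜ ⊔ edge x w) x α₂))
    (h4 : ∀ z, (restr P Kᶜ ⊔ edge x w).Adj x z → ¬ 4 :: α₂ w <:+ α₂ z ∧ ¬ 5 :: α₂ w <:+ α₂ z) :
    KF (expand P x (combine K w α₁ α₂)) := by
  set P₁ := restr P (K ∪ {x, w}) ⊔ edge x w
  set P₂ := restr P Kᶜ ⊔ edge x w
  set l₄ : List (Fin 6) := 4 :: α₂ w with hl₄
  have hxw : (edge x w).Adj x w := (edge_adj _ _ _ _).2 ⟨Or.inl ⟨rfl, rfl⟩, hwx.symm⟩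
  have hxw₁ : P₁.Adj x w := Or.inr hxw
  have hxw₂ : P₂.Adj x w := Or.inr hxw
  have hP₁ : ∀ {z}, P.Adj x z → z ∈ K → P₁.Adj x z := fun hz hzK =>
    Or.inl ⟨hz, by simp, Or.inl hzK⟩
  have hP₂ : ∀ {z}, P.Adj x z → z ∉ K → P₂.Adj x z := fun hz hzK => Or.inl ⟨hz, hxK, hzK⟩
  have hbaseK : ∀ {a b}, P.Adj a b → b ≠ x → a ∈ K → b ∈ K ∪ {w} := by
    intro a b hab hb ha
    rcases hK a ha b hab with h | h | h
    exacts [Or.inl h, absurd h hb, Or.inr h]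
  have h5 : ¬ l₄ <:+ 5 :: α₂ w := by
    rw [List.suffix_cons_iff]
    rintro (h | h)
    · simp [hl₄] at h
    · exact not_cons_suffix h
  have hnot : ∀ {z}, P.Adj x z → z ∉ K → ¬ l₄ <:+ combine K w α₁ α₂ z := by
    intro z hz hzK
    by_cases hzw : z = w
    · subst hzw
      rw [combine_self hwK]
      exact h5
    · rw [combine_notMem hzK hzw]
      exact (h4 z (hP₂ hz hzK)).1
  let V₁ : Set (U ⊕ List (Fin 6)) := {s | (∃ t, s = .inl t ∧ t ∈ K ∪ {w}) ∨ ∃ l, s = .inr l ∧ l₄ <:+ l}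
  let V₂ : Set (U ⊕ List (Fin 6)) :=
    {s | (∃ t, s = .inl t ∧ t ∉ K) ∨ ∃ l, s = .inr l ∧ (¬ l₄ <:+ l ∨ l = l₄)}
  have i₁ : ∀ {t}, .inl t ∈ V₁ ↔ t ∈ K ∪ {w} := by simp [V₁]
  have j₁ : ∀ {l}, .inr l ∈ V₁ ↔ l₄ <:+ l := by simp [V₁]
  have i₂ : ∀ {t}, .inl t ∈ V₂ ↔ t ∉ K := by simp [V₂]
  have j₂ : ∀ {l}, .inr l ∈ V₂ ↔ ¬ l₄ <:+ l ∨ l = l₄ := by simp [V₂]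
  have htree : ∀ {z i l}, P.Adj x z → i :: l <:+ combine K w α₁ α₂ z →
      (i :: l <:+ α₂ w) ∨ (l = α₂ w ∧ (i = 4 ∨ i = 5)) ∨
      (z ∉ K ∧ z ≠ w ∧ ¬ l₄ <:+ i :: l ∧ i :: l <:+ α₂ z) ∨
      z ∈ K ∧ ∃ k, l = k ++ l₄ ∧ i :: k <:+ α₁ z := by
    intro z i l hz h
    by_cases hzK : z ∈ K
    · rw [combine_mem hzK] at h
      rcases suffix_append_cons h with h | h | ⟨j, k, h, h'⟩
      · exact Or.inl h
      · rw [List.cons.injEq] at h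
        exact Or.inr (Or.inl ⟨h.2, Or.inl h.1⟩)
      · rw [List.cons_append, List.cons.injEq] at h
        exact Or.inr (Or.inr (Or.inr ⟨hzK, k, h.2, h.1 ▸ h'⟩))
    · by_cases hzw : z = w
      · subst hzw
        rw [combine_self hwK, List.suffix_cons_iff, List.cons.injEq] at h
        exact h.elim (fun h => Or.inr (Or.inl ⟨h.2, Or.inr h.1⟩)) Or.inl
      · have hn := hnot hz hzK
        rw [combine_notMem hzK hzw] at h hn
        exact Or.inr (Or.inr (Or.inl ⟨hzK, hzw, fun h' => hn (h'.trans h), h⟩))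
  have hα₂ : ∀ {l : List (Fin 6)}, l <:+ α₂ w → ¬ l₄ <:+ l := fun h h' => not_cons_suffix (h'.trans h)
  refine KF.two_sum (V₁ := V₁) (V₂ := V₂) (u := .inr l₄) (w := .inl w) ?_ (j₁.2 List.suffix_rfl)
    (i₁.2 (Or.inr rfl)) (j₂.2 (Or.inr rfl)) (i₂.2 hwK) ?_ ?_ ?_
  · rintro (t | l) ⟨h1, h2⟩
    · rcases i₁.1 h1 with h | rfl
      · exact absurd h (i₂.1 h2)
      · simp
    · rcases j₂.1 h2 with h | rfl
      · exact absurd (j₁.1 h1) h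
      · simp
  · refine expand_induction (fun s t h => h.imp And.symm And.symm) (fun a b hab ha hb => ?_)
      (fun z hz => ?_) (fun z i l hz h => ?_)
    · by_cases haK : a ∈ K
      · exact Or.inl ⟨i₁.2 (Or.inl haK), i₁.2 (hbaseK hab hb haK)⟩
      · by_cases hbK : b ∈ K
        · exact Or.inl ⟨i₁.2 (hbaseK hab.symm ha hbK), i₁.2 (Or.inl hbK)⟩
        · exact Or.inr ⟨i₂.2 haK, i₂.2 hbK⟩
    · by_cases hzK : z ∈ K
      · exact Or.inl ⟨j₁.2 (by rw [combine_mem hzK]; exact List.suffix_append _ _), i₁.2 (Or.inl hzK)⟩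
      · exact Or.inr ⟨j₂.2 (Or.inl (hnot hz hzK)), i₂.2 hzK⟩
    · rcases htree hz h with h | ⟨rfl, rfl | rfl⟩ | ⟨_, _, h, -⟩ | ⟨-, k, rfl, h⟩
      · exact Or.inr ⟨j₂.2 (Or.inl (hα₂ ((List.suffix_cons _ _).trans h))), j₂.2 (Or.inl (hα₂ h))⟩
      · exact Or.inr ⟨j₂.2 (Or.inl (hα₂ List.suffix_rfl)), j₂.2 (Or.inr rfl)⟩
      · exact Or.inr ⟨j₂.2 (Or.inl (hα₂ List.suffix_rfl)), j₂.2 (Or.inl h5)⟩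
      · exact Or.inr ⟨j₂.2 (Or.inl fun h' => h (h'.trans (List.suffix_cons _ _))), j₂.2 (Or.inl h)⟩
      · exact Or.inl ⟨j₁.2 (List.suffix_append _ _), j₁.2 (List.suffix_append (i :: k) _)⟩
  · let g : List (Fin 6) → List (Fin 6) := fun l => l.take (l.length - l₄.length)
    have hg : ∀ k, g (k ++ l₄) = k := fun k => by simp [g]
    have hV : ∀ {s t}, (restr (expand P x (combine K w α₁ α₂)) V₁ ⊔
        edge (.inr l₄) (.inl w)).Adj s t → s ∈ V₁ := by
      rintro s t (⟨-, h1, -⟩ | h1)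
      · exact h1
      · obtain ⟨⟨rfl, rfl⟩ | ⟨rfl, rfl⟩, -⟩ := (edge_adj _ _ _ _).1 h1
        exacts [j₁.2 List.suffix_rfl, i₁.2 (Or.inr rfl)]
    have hedge : (expand P₁ x α₁).Adj (Sum.map id g (.inr l₄)) (Sum.map id g (.inl w)) := by
      have := (ExpandRel.leaf (α := α₁) hxw₁).adj
      rw [hα₁, ← hg []] at this
      exact this
    refine h₁.of_hom (Sum.map id g) ?_ ?_
    · rintro (s | s) ⟨s', hs⟩ (t | t) ⟨t', ht⟩ hst
      · simpa using hst
      · simp at hst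
      · simp at hst
      · obtain ⟨k, rfl⟩ := j₁.1 (hV hs)
        obtain ⟨k', rfl⟩ := j₁.1 (hV ht)
        simp only [Sum.map_inr, hg, Sum.inr.injEq] at hst
        rw [hst]
    · rintro s t (⟨hst, h1, h2⟩ | hst)
      · revert h1 h2
        refine expand_induction (p := fun s t => s ∈ V₁ → t ∈ V₁ →
          (expand P₁ x α₁).Adj (Sum.map id g s) (Sum.map id g t))
          (fun s t h h1 h2 => (h h2 h1).symm) (fun a b hab ha hb h1 h2 => ?_)
          (fun z hz h1 h2 => ?_) (fun z i l hz h h1 h2 => ?_) s t hst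
        · have : ∀ {t}, t ∈ K ∪ {w} → t ∈ K ∪ {x, w} := by
            rintro t (h | h)
            exacts [Or.inl h, Or.inr (Or.inr h)]
          exact (ExpandRel.base (Or.inl ⟨hab, this (i₁.1 h1), this (i₁.1 h2)⟩) ha hb).adj
        · by_cases hzK : z ∈ K
          · rw [combine_mem hzK]
            have := (ExpandRel.leaf (α := α₁) (hP₁ hz hzK)).adj
            rw [← hg (α₁ z)] at this
            exact this
          · exact absurd (j₁.1 h1) (hnot hz hzK)
        · rcases htree hz h with h | ⟨rfl, -⟩ | ⟨_, _, h, -⟩ | ⟨hzK, k, rfl, hk⟩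
          · exact absurd (j₁.1 h2) (hα₂ h)
          · exact absurd (j₁.1 h1) (hα₂ List.suffix_rfl)
          · exact absurd (j₁.1 h2) h
          · simp only [Sum.map_inr]
            rw [hg k, show g (i :: (k ++ l₄)) = i :: k from hg (i :: k)]
            exact (ExpandRel.tree (hP₁ hz hzK) hk).adj
      · obtain ⟨⟨rfl, rfl⟩ | ⟨rfl, rfl⟩, -⟩ := (edge_adj _ _ _ _).1 hst
        exacts [hedge, hedge.symm]
  · refine (kf_expand_ears (i := 4) (j := 5) (by decide) hxw₂ (fun z hz => (h4 z hz).1)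
      (fun z hz => (h4 z hz).2) h₂).mono (sup_le ?_ ?_)
    · rintro s t ⟨hst, h1, h2⟩
      revert h1 h2
      have e4 : (edge (.inr (4 :: α₂ w)) (.inr (α₂ w)) : SimpleGraph (U ⊕ List (Fin 6))).Adj
          (.inr (α₂ w)) (.inr (4 :: α₂ w)) := (edge_adj _ _ _ _).2 ⟨Or.inr ⟨rfl, rfl⟩, by simp⟩
      have e5 : (edge (.inr (5 :: α₂ w)) (.inr (α₂ w)) : SimpleGraph (U ⊕ List (Fin 6))).Adj
          (.inr (α₂ w)) (.inr (5 :: α₂ w)) := (edge_adj _ _ _ _).2 ⟨Or.inr ⟨rfl, rfl⟩, by simp⟩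
      refine expand_induction (p := fun s t => s ∈ V₂ → t ∈ V₂ → SimpleGraph.Adj (_ ⊔ _ ⊔ _) s t)
        (fun s t h h1 h2 => (h h2 h1).symm) (fun a b hab ha hb h1 h2 => ?_)
        (fun z hz h1 h2 => ?_) (fun z i l hz h h1 h2 => ?_) s t hst
      · exact Or.inl (Or.inl (ExpandRel.base (Or.inl ⟨hab, i₂.1 h1, i₂.1 h2⟩) ha hb).adj)
      · by_cases hzw : z = w
        · subst hzw
          rw [combine_self hwK]
          exact Or.inr (Or.inr ((edge_adj _ _ _ _).2 ⟨Or.inl ⟨rfl, rfl⟩, by simp⟩))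
        · rw [combine_notMem (i₂.1 h2) hzw]
          exact Or.inl (Or.inl (ExpandRel.leaf (hP₂ hz (i₂.1 h2))).adj)
      · rcases htree hz h with h | ⟨rfl, rfl | rfl⟩ | ⟨hzK, _, _, h⟩ | ⟨hzK, k, rfl, h⟩
        · exact Or.inl (Or.inl (ExpandRel.tree hxw₂ h).adj)
        · exact Or.inl (Or.inr (Or.inl e4))
        · exact Or.inr (Or.inl e5)
        · exact Or.inl (Or.inl (ExpandRel.tree (hP₂ hz hzK) h).adj)
        · refine absurd ((j₂.1 h2).resolve_left fun h => h (List.suffix_append (i :: k) _)) ?_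
          intro h
          have := congrArg List.length h
          simp only [List.length_cons, List.length_append] at this
          omega
    · rw [edge_le_iff]
      exact Or.inr (Or.inl (Or.inr (Or.inr ((edge_adj _ _ _ _).2 ⟨Or.inl ⟨rfl, rfl⟩, by simp⟩))))

end Expand

section Spreading

variable {U : Type*} {P : SimpleGraph U} {K S T A B C D : Set U}
  {a a' b b' c d e r u v w x y z : U} {α α₁ α₂ : U → List (Fin 6)} {ℓ : U → Fin 4}

lemma exists_finite_reachIn (hr : r ≠ x) (h : ReachIn P {x}ᶜ r e) :
    ∃ A : Set U, A.Finite ∧ x ∉ A ∧ r ∈ A ∧ ∀ B, A ⊆ B → ReachIn (restr P B) A r e := by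
  obtain ⟨A, hA, hAx, hc, hrA, heA⟩ := h.exists_finite hr
  exact ⟨A, hA, fun hx => hAx hx rfl, hrA, fun B hB =>
    (hc.mono (H := restr P B) fun c hc d hd hcd => ⟨hcd, hB hc, hB hd⟩).reachIn heA⟩

lemma finite_separators (hr : r ≠ x) (h : ReachIn P {x}ᶜ r e) :
    {w | w ≠ x ∧ w ≠ r ∧ w ≠ e ∧ ¬ ReachIn P {x, w}ᶜ r e}.Finite := by
  obtain ⟨A, hA, hxA, hrA, hB⟩ := exists_finite_reachIn hr h
  refine hA.subset fun w hw => ?_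
  by_contra hwA
  refine hw.2.2.2 ((hB A Subset.rfl).mono (fun _ _ _ _ h => restr_le h) ?_ hrA)
  rintro t ht (rfl | rfl)
  exacts [hxA ht, hwA ht]

lemma exists_starPlus_restr (hG : KF P) (hr : P.Adj x r) (he : P.Adj x e) (hre : r ≠ e)
    (h1 : ReachIn P {x}ᶜ r e) (h2 : ∀ w, w ≠ x → w ≠ r → w ≠ e → ReachIn P {x, w}ᶜ r e) :
    ∃ F₀ : Finset U, ∀ F : Finset U, F₀ ⊆ F → ∃ ℓ, KF (starPlus (restr P F) x r e ℓ) := by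
  classical
  obtain ⟨A, hA, hxA, hrA, hAB⟩ := exists_finite_reachIn hr.ne' h1
  have h3 : ∀ w, ∃ B : Set U, B.Finite ∧ (w ≠ x → w ≠ r → w ≠ e →
      B ⊆ {x, w}ᶜ ∧ r ∈ B ∧ e ∈ B ∧ ConnOn P B) := by
    intro w
    by_cases hw : w ≠ x ∧ w ≠ r ∧ w ≠ e
    · obtain ⟨B, hB, hBs, hc, hrB, heB⟩ := (h2 w hw.1 hw.2.1 hw.2.2).exists_finite
        (show r ∈ ({x, w} : Set U)ᶜ by simp [hr.ne', hw.2.1.symm])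
      exact ⟨B, hB, fun _ _ _ => ⟨hBs, hrB, heB, hc⟩⟩
    · exact ⟨∅, finite_empty, fun a b c => absurd ⟨a, b, c⟩ hw⟩
  choose B hB hBw using h3
  have hfin : (insert x (A ∪ ⋃ w ∈ A, B w)).Finite :=
    (hA.union (hA.biUnion fun w _ => hB w)).insert x
  refine ⟨hfin.toFinset, fun F hF => ?_⟩
  rw [Set.Finite.toFinset_subset] at hF
  have hxF : x ∈ F := hF (mem_insert _ _)
  have hAF : A ⊆ F := fun t ht => hF (Or.inr (Or.inl ht))
  have hBF : ∀ w ∈ A, B w ⊆ F := fun w hw t ht => hF (Or.inr (Or.inr (mem_biUnion hw ht)))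
  have heA : e ∈ A := (hAB A Subset.rfl).mem hrA
  refine exists_starPlus F.finite_toSet (fun a b h => h.2.1) (hG.mono restr_le)
    ⟨hr, hxF, hAF hrA⟩ ⟨he, hxF, hAF heA⟩ hre ?_ fun w hwx hwr hwe => ?_
  · refine (hAB F hAF).mono (fun _ _ _ _ h => h) (fun t ht => ⟨hAF ht, ?_⟩) hrA
    rintro rfl
    exact hxA ht
  · by_cases hwA : w ∈ A
    · obtain ⟨h3, h4, h5, h6⟩ := hBw w hwx hwr hwe
      exact ReachIn.mono (G := P) (fun c hc d hd h => ⟨h, hBF w hwA hc, hBF w hwA hd⟩)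
        (fun t ht => ⟨hBF w hwA ht, h3 ht⟩) h4 (h6.reachIn h5)
    · refine (hAB F hAF).mono (fun _ _ _ _ h => h) (fun t ht => ⟨hAF ht, ?_⟩) hrA
      rintro (rfl | rfl)
      exacts [hxA ht, hwA ht]

lemma exists_starPlus_of_finite
    (h : ∃ F₀ : Finset U, ∀ F : Finset U, F₀ ⊆ F → ∃ ℓ, KF (starPlus (restr P F) x r e ℓ)) :
    ∃ ℓ, KF (starPlus P x r e ℓ) := by
  classical
  obtain ⟨F₀, h⟩ := h
  choose! L hL using h
  let 𝒰 : Ultrafilter (Finset U) := Ultrafilter.of Filter.atTop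
  have hlim : ∀ z, ∃ i, ∀ᶠ F in 𝒰, L F z = i := fun z =>
    Ultrafilter.eventually_exists_iff.1 (Filter.Eventually.of_forall fun F => ⟨L F z, rfl⟩)
  choose ℓ hℓ using hlim
  refine ⟨ℓ, kf_of_finite fun T hT => ?_⟩
  have hg : ∀ i : Fin 4, ∃ z, (∃ z, P.Adj x z ∧ z ≠ r ∧ z ≠ e ∧ ℓ z = i) →
      P.Adj x z ∧ z ≠ r ∧ z ≠ e ∧ ℓ z = i := fun i => by
    by_cases hz : ∃ z, P.Adj x z ∧ z ≠ r ∧ z ≠ e ∧ ℓ z = i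
    · exact hz.imp fun z hz _ => hz
    · exact ⟨x, fun h => absurd h hz⟩
  choose g hg using hg
  have hTf : ((Sum.inl : U → U ⊕ Fin 4) ⁻¹' T ∪ range g ∪ {x}).Finite :=
    ((hT.preimage Sum.inl_injective.injOn).union (finite_range g)).union (finite_singleton x)
  have h1 : ∀ᶠ F in 𝒰, F₀ ∪ hTf.toFinset ⊆ F :=
    (Filter.eventually_ge_atTop (F₀ ∪ hTf.toFinset)).filter_mono (Ultrafilter.of_le _)
  have h2 : ∀ᶠ F in 𝒰, ∀ z ∈ hTf.toFinset, L F z = ℓ z :=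
    (Filter.eventually_all_finset _).2 fun z _ => hℓ z
  obtain ⟨F, hF, hLF⟩ := (h1.and h2).exists
  rw [Finset.union_subset_iff, Finite.toFinset_subset] at hF
  simp only [Finite.mem_toFinset] at hLF
  have hxF : x ∈ F := hF.2 (Or.inr rfl)
  have hTF : ∀ {z}, Sum.inl z ∈ T → z ∈ F := fun hz => hF.2 (Or.inl (Or.inl hz))
  refine (hL F hF.1).mono ?_
  rintro s t ⟨hst, hs, ht⟩
  revert hs ht
  refine starPlus_induction (p := fun s t => s ∈ T → t ∈ T →
    (starPlus (restr P F) x r e (L F)).Adj s t) (fun s t h h1 h2 => (h h2 h1).symm)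
    (fun a b hab ha hb h1 h2 => starPlus_base ⟨hab, hTF h1, hTF h2⟩ ha hb)
    (fun z hz h1 h2 => ?_) (fun z hz hzr hze h1 h2 => ?_) (fun _ _ => starPlus_adj.2 (by simp))
    (fun _ _ => starPlus_adj.2 (by simp)) (fun _ _ => starPlus_adj.2 (by simp))
    (fun _ _ => starPlus_adj.2 (by simp)) s t hst
  · have : lab x r e ℓ z = lab x r e (L F) z := by
      simp only [lab, hLF z (Or.inl (Or.inl h2))]
    rw [this]
    exact starPlus_leaf ⟨hz, hxF, hTF h2⟩
  · obtain ⟨h3, h4, h5, h6⟩ := hg (ℓ z) ⟨z, hz, hzr, hze, rfl⟩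
    have h7 : g (ℓ z) ∈ (Sum.inl : U → U ⊕ Fin 4) ⁻¹' T ∪ range g ∪ {x} :=
      Or.inl (Or.inr ⟨_, rfl⟩)
    have := starPlus_stem (P := restr P F) (ℓ := L F) ⟨h3, hxF, hF.2 h7⟩ h4 h5
    rwa [hLF _ h7, h6] at this

/-- The addresses `α` keep the branches at the neighbours of `x` other than `r` apart, and leave
room for two new branches at the address of `e`. -/
structure Spread (P : SimpleGraph U) (x r e : U) (α : U → List (Fin 6)) : Prop where
  root : α r = []
  eq_of_suffix : ∀ z, P.Adj x z → z ≠ r → z ≠ e → ∀ z', P.Adj x z' → z' ≠ r → α z <:+ α z' →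
    α z' = α z ∧ z' ≠ e
  free : ∀ z, P.Adj x z → z ≠ r → ¬ 4 :: α e <:+ α z ∧ ¬ 5 :: α e <:+ α z

lemma exists_spread_of_reach (hG : KF P) (hr : P.Adj x r) (he : P.Adj x e) (hre : r ≠ e)
    (h1 : ReachIn P {x}ᶜ r e) (h2 : ∀ w, w ≠ x → w ≠ r → w ≠ e → ReachIn P {x, w}ᶜ r e) :
    ∃ α, Spread P x r e α ∧ KF (expand P x α) := by
  classical
  obtain ⟨ℓ, hℓ⟩ := exists_starPlus_of_finite (exists_starPlus_restr hG hr he hre h1 h2)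
  let α : U → List (Fin 6) := fun z => if z = r ∨ z = e then [] else [(ℓ z).castLE (by decide)]
  have hα₀ : ∀ {z}, z = r ∨ z = e → α z = [] := fun h => if_pos h
  have hα₁ : ∀ {z}, z ≠ r → z ≠ e → α z = [(ℓ z).castLE (by decide)] := fun h h' =>
    if_neg fun h'' => h''.elim h h'
  refine ⟨α, ⟨hα₀ (Or.inl rfl), fun z hz hzr hze z' hz' hzr' h => ?_, fun z hz hzr => ?_⟩, ?_⟩
  · rw [hα₁ hzr hze] at h ⊢
    by_cases hze' : z' = e
    · rw [hα₀ (Or.inr hze')] at h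
      simp at h
    · rw [hα₁ hzr' hze'] at h ⊢
      exact ⟨(h.eq_of_length rfl).symm, hze'⟩
  · rw [hα₀ (Or.inr rfl)]
    by_cases hze : z = e
    · rw [hα₀ (Or.inr hze)]
      simp
    · rw [hα₁ hzr hze]
      constructor
      · intro h
        have := h.eq_of_length rfl
        simp only [List.cons.injEq, and_true, Fin.ext_iff, Fin.val_castLE] at this
        have h4 := (ℓ z).isLt
        change 4 = _ at this
        omega
      · intro h
        have := h.eq_of_length rfl
        simp only [List.cons.injEq, and_true, Fin.ext_iff, Fin.val_castLE] at this
        have h4 := (ℓ z).isLt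
        change 5 = _ at this
        omega
  · let m : List (Fin 6) → U ⊕ Fin 4 := fun l => match l with
      | [] => .inl x
      | c :: _ => .inr (Fin.ofNat 4 c)
    have hm : ∀ {z}, m (α z) = lab x r e ℓ z := by
      intro z
      by_cases hz : z = r ∨ z = e
      · rw [hα₀ hz, lab_root hz]
      · push Not at hz
        rw [hα₁ hz.1 hz.2, lab_of_ne hz.1 hz.2]
        simp [m]
    have hsuf : ∀ {z i l}, i :: l <:+ α z → z ≠ r ∧ z ≠ e ∧ i = (ℓ z).castLE (by decide) ∧ l = [] := by
      intro z i l h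
      by_cases hz : z = r ∨ z = e
      · rw [hα₀ hz] at h
        simp at h
      · push Not at hz
        rw [hα₁ hz.1 hz.2, List.suffix_cons_iff] at h
        simpa [hz.1, hz.2] using h
    have hsupp : ∀ s t, (expand P x α).Adj s t →
        s ≠ .inl x ∧ t ≠ .inl x ∧ (starPlus P x r e ℓ).Adj (Sum.elim .inl m s) (Sum.elim .inl m t) ∧
        (∀ l, s = .inr l → l = [] ∨ ∃ i : Fin 4, l = [i.castLE (by decide)]) ∧
        (∀ l, t = .inr l → l = [] ∨ ∃ i : Fin 4, l = [i.castLE (by decide)]) := by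
      have hα : ∀ z, α z = [] ∨ ∃ i : Fin 4, α z = [i.castLE (by decide)] := by
        intro z
        by_cases hz : z = r ∨ z = e
        · exact Or.inl (hα₀ hz)
        · push Not at hz
          exact Or.inr ⟨_, hα₁ hz.1 hz.2⟩
      refine expand_induction (fun s t h => ⟨h.2.1, h.1, h.2.2.1.symm, h.2.2.2.2, h.2.2.2.1⟩)
        (fun a b hab ha hb => ⟨by simpa using ha, by simpa using hb, starPlus_base hab ha hb,
          by simp, by simp⟩) (fun z hz => ⟨by simp, by simpa using hz.ne', ?_, ?_, by simp⟩)
        (fun z i l hz h => ?_)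
      · simp only [Sum.elim_inr, Sum.elim_inl, hm]
        exact starPlus_leaf hz
      · rintro l h
        rw [← Sum.inr_injective h]
        exact hα z
      · obtain ⟨hzr, hze, rfl, rfl⟩ := hsuf h
        refine ⟨by simp, by simp, ?_, ?_, ?_⟩
        · simp only [Sum.elim_inr]
          rw [← hα₁ hzr hze, hm, lab_of_ne hzr hze]
          exact starPlus_stem hz hzr hze
        · rintro l h
          exact Or.inl (Sum.inr_injective h).symm
        · rintro l h
          exact Or.inr ⟨_, (Sum.inr_injective h).symm⟩
    refine hℓ.of_hom (Sum.elim .inl m) ?_ fun s t h => (hsupp s t h).2.2.1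
    rintro s ⟨s', hs⟩ t ⟨t', ht⟩ hst
    obtain ⟨h1, -, -, h2, -⟩ := hsupp _ _ hs
    obtain ⟨h3, -, -, h4, -⟩ := hsupp _ _ ht
    have hmi : ∀ i : Fin 4, m [i.castLE (by decide)] = .inr i := fun i => by
      simp [m]
    have hm0 : m [] = .inl x := rfl
    rcases s with s | s <;> rcases t with t | t
    · simpa using hst
    · rcases h4 t rfl with rfl | ⟨i, rfl⟩
      · exact absurd (by simpa [hm0] using hst) h1
      · simp [hmi] at hst
    · rcases h2 s rfl with rfl | ⟨i, rfl⟩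
      · exact absurd (by simpa [hm0] using hst.symm) h3
      · simp [hmi] at hst
    · rcases h4 t rfl with rfl | ⟨i, rfl⟩ <;> rcases h2 s rfl with rfl | ⟨j, rfl⟩
      · rfl
      · simp [hmi, hm0] at hst
      · simp [hmi, hm0] at hst
      · simp only [Sum.elim_inr, hmi, Sum.inr.injEq] at hst
        rw [hst]

end Spreading

section Spreading

variable {U : Type*} {P : SimpleGraph U} {K S T A B C D : Set U}
  {a a' b b' c d e r u v w x y z : U} {α α₁ α₂ : U → List (Fin 6)} {ℓ : U → Fin 4}

lemma spread_combine (hwK : w ∉ K) (hrK : r ∉ K) (heK : e ∈ K) (hxK : x ∉ K) (hrw : r ≠ w)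
    (h₁ : Spread (restr P (K ∪ {x, w}) ⊔ edge x w) x w e α₁)
    (h₂ : Spread (restr P Kᶜ ⊔ edge x w) x r w α₂) (hwx : w ≠ x) :
    Spread P x r e (combine K w α₁ α₂) := by
  have h45 : ∀ {i j : Fin 6}, i ≠ j → ¬ i :: α₂ w <:+ j :: α₂ w := by
    intro i j hij h
    have := h.eq_of_length rfl
    simp only [List.cons.injEq, and_true] at this
    exact hij this
  have hxw₂ : (restr P Kᶜ ⊔ edge x w).Adj x w :=
    Or.inr ((edge_adj _ _ _ _).2 ⟨Or.inl ⟨rfl, rfl⟩, hwx.symm⟩)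
  have hP₁ : ∀ {z}, P.Adj x z → z ∈ K → (restr P (K ∪ {x, w}) ⊔ edge x w).Adj x z ∧ z ≠ w :=
    fun hz hzK => ⟨Or.inl ⟨hz, by simp, Or.inl hzK⟩, fun h => hwK (h ▸ hzK)⟩
  have hP₂ : ∀ {z}, P.Adj x z → z ∉ K → (restr P Kᶜ ⊔ edge x w).Adj x z := fun hz hzK =>
    Or.inl ⟨hz, hxK, hzK⟩
  have hne : ∀ {z}, z ∉ K → z ≠ e := fun hz h => hz (h ▸ heK)
  have h₄ : ∀ {z}, P.Adj x z → z ∉ K → z ≠ r → ¬ 4 :: α₂ w <:+ α₂ z ∧ ¬ 5 :: α₂ w <:+ α₂ z :=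
    fun hz hzK hzr => h₂.free _ (hP₂ hz hzK) hzr
  refine ⟨?_, fun z hz hzr hze z' hz' hzr' h => ?_, fun z hz hzr => ?_⟩
  · rw [combine_notMem hrK hrw, h₂.root]
  · by_cases hzK : z ∈ K
    · rw [combine_mem hzK] at h ⊢
      have h4 : 4 :: α₂ w <:+ combine K w α₁ α₂ z' := (List.suffix_append _ _).trans h
      by_cases hzK' : z' ∈ K
      · rw [combine_mem hzK'] at h ⊢
        rw [List.suffix_append_self_iff] at h
        obtain ⟨h5, h6⟩ := h₁.eq_of_suffix z (hP₁ hz hzK).1 (hP₁ hz hzK).2 hze z'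
          (hP₁ hz' hzK').1 (hP₁ hz' hzK').2 h
        exact ⟨by rw [h5], h6⟩
      · by_cases hzw' : z' = w
        · subst hzw'
          rw [combine_self hwK] at h4
          exact absurd h4 (h45 (by decide))
        · rw [combine_notMem hzK' hzw'] at h4
          exact absurd h4 (h₄ hz' hzK' hzr').1
    · by_cases hzw : z = w
      · subst hzw
        rw [combine_self hwK] at h ⊢
        by_cases hzK' : z' ∈ K
        · rw [combine_mem hzK'] at h
          rcases suffix_append_cons h with h | h | ⟨j, k, h, -⟩
          · exact absurd h not_cons_suffix
          · simp at h
          · have := congrArg List.length h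
            simp only [List.length_cons, List.length_append] at this
            omega
        · by_cases hzw' : z' = z
          · subst hzw'
            rw [combine_self hwK]
            exact ⟨rfl, hze⟩
          · rw [combine_notMem hzK' hzw'] at h
            exact absurd h (h₄ hz' hzK' hzr').2
      · rw [combine_notMem hzK hzw] at h ⊢
        have key : ¬ α₂ z <:+ α₂ w := fun h' =>
          (h₂.eq_of_suffix z (hP₂ hz hzK) hzr hzw w hxw₂ hrw.symm h').2 rfl
        by_cases hzK' : z' ∈ K
        · rw [combine_mem hzK'] at h
          rcases suffix_append_cons h with h | h | ⟨j, k, h, -⟩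
          · exact absurd h key
          · exact absurd (h ▸ List.suffix_rfl) (h₄ hz hzK hzr).1
          · exact absurd (h ▸ List.suffix_append (j :: k) _) (h₄ hz hzK hzr).1
        · by_cases hzw' : z' = w
          · subst hzw'
            rw [combine_self hwK, List.suffix_cons_iff] at h
            rcases h with h | h
            · exact absurd (h ▸ List.suffix_rfl) (h₄ hz hzK hzr).2
            · exact absurd h key
          · rw [combine_notMem hzK' hzw'] at h ⊢
            exact ⟨(h₂.eq_of_suffix z (hP₂ hz hzK) hzr hzw z' (hP₂ hz' hzK') hzr' h).1, hne hzK'⟩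
  · rw [combine_mem heK]
    by_cases hzK : z ∈ K
    · rw [combine_mem hzK, ← List.cons_append, ← List.cons_append, List.suffix_append_self_iff,
        List.suffix_append_self_iff]
      exact h₁.free z (hP₁ hz hzK).1 (hP₁ hz hzK).2
    · have h4 : ∀ i, i :: (α₁ e ++ 4 :: α₂ w) <:+ combine K w α₁ α₂ z →
          4 :: α₂ w <:+ combine K w α₁ α₂ z := fun i h =>
        (List.suffix_append (i :: α₁ e) _).trans h
      have h5 : ¬ 4 :: α₂ w <:+ combine K w α₁ α₂ z := by
        by_cases hzw : z = w
        · subst hzw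
          rw [combine_self hwK]
          exact h45 (by decide)
        · rw [combine_notMem hzK hzw]
          exact (h₄ hz hzK hzr).1
      exact ⟨fun h => h5 (h4 _ h), fun h => h5 (h4 _ h)⟩

/-- The vertices that `x` and `w` together separate from `r`. -/
def cutOff (P : SimpleGraph U) (x w r : U) : Set U := {z | z ≠ x ∧ z ≠ w ∧ ¬ ReachIn P {x, w}ᶜ r z}

lemma cutOff_closed (hc : c ∈ cutOff P x w r) (h : P.Adj c d) :
    d ∈ cutOff P x w r ∨ d = x ∨ d = w := by
  by_contra! hd
  refine hd.1 ⟨hd.2.1, hd.2.2, fun hrd => hc.2.2 (hrd.trans (ReachIn.of_adj ?_ h.symm))⟩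
  simp [hc.1, hc.2.1]

lemma exists_spread_of_reachIn (hG : KF P) (hr : P.Adj x r) (he : P.Adj x e) (hre : r ≠ e)
    (h1 : ReachIn P {x}ᶜ r e) : ∃ α, Spread P x r e α ∧ KF (expand P x α) := by
  induction hn : {w | w ≠ x ∧ w ≠ r ∧ w ≠ e ∧ ¬ ReachIn P {x, w}ᶜ r e}.ncard
    using Nat.strong_induction_on generalizing P r e with
  | _ n ih =>
  subst hn
  by_cases h2 : ∀ w, w ≠ x → w ≠ r → w ≠ e → ReachIn P {x, w}ᶜ r e
  · exact exists_spread_of_reach hG hr he hre h1 h2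
  push Not at h2
  obtain ⟨w, hwx, hwr, hwe, hw⟩ := h2
  have hrxw : r ∈ ({x, w} : Set U)ᶜ := by simp [hr.ne', hwr.symm]
  have hexw : e ∈ ({x, w} : Set U)ᶜ := by simp [he.ne', hwe.symm]
  set K := cutOff P x w r with hKdef
  have hxK : x ∉ K := fun h => h.1 rfl
  have hwK : w ∉ K := fun h => h.2.1 rfl
  have hrK : r ∉ K := fun h => h.2.2 ReachIn.refl
  have heK : e ∈ K := ⟨he.ne', hwe.symm, hw⟩
  have hK : ∀ c ∈ K, ∀ d, P.Adj c d → d ∈ K ∨ d = x ∨ d = w := fun c hc d h => cutOff_closed hc h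
  have hcr : ∀ t ∈ comp P {x, w}ᶜ r, t ∉ K := fun t ht h => h.2.2 ht.2
  have hce : ∀ t ∈ comp P {x, w}ᶜ e, t ∈ K := fun t ht =>
    ⟨fun h => ht.1 (Or.inl h), fun h => ht.1 (Or.inr h), fun h => hw (h.trans (ht.2.symm hexw))⟩
  have hrw : ∃ c ∈ comp P {x, w}ᶜ r, P.Adj c w := by
    by_contra! hn
    refine hcr e (h1 _ (fun t ht h => ht.1 (Or.inl h)) (mem_comp_self hrxw)
      fun c hc d hd hcd => comp_closed c hc d ?_ hcd) heK
    rintro (rfl | rfl)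
    exacts [hd rfl, hn c hc hcd]
  have hew : ∃ c ∈ comp P {x, w}ᶜ e, P.Adj c w := by
    by_contra! hn
    refine hrK (hce r (h1.symm hr.ne' _ (fun t ht h => ht.1 (Or.inl h)) (mem_comp_self hexw)
      fun c hc d hd hcd => comp_closed c hc d ?_ hcd))
    rintro (rfl | rfl)
    exacts [hd rfl, hn c hc hcd]
  set P₁ := restr P (K ∪ {x, w}) ⊔ edge x w with hP₁
  set P₂ := restr P Kᶜ ⊔ edge x w with hP₂
  have hxw : (edge x w).Adj x w := (edge_adj _ _ _ _).2 ⟨Or.inl ⟨rfl, rfl⟩, hwx.symm⟩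
  have hG₁ : KF P₁ := by
    refine hG.restr_sup_edge (comp_connOn hrxw) ?_ (by simp) (by simp) hwx.symm
      ⟨r, mem_comp_self hrxw, hr⟩ hrw
    rw [Set.disjoint_left]
    rintro t ht (h | h)
    exacts [hcr t ht h, ht.1 h]
  have hG₂ : KF P₂ := hG.restr_sup_edge (comp_connOn hexw)
    (Set.disjoint_left.2 fun t ht h => h (hce t ht)) hxK hwK hwx.symm
    ⟨e, mem_comp_self hexw, he⟩ hew
  have hr₁ : ∀ v, v ≠ w → v ∉ K → ReachIn P₁ {x, v}ᶜ w e := by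
    intro v hvw hvK
    obtain ⟨c, hc, hcw⟩ := hew
    have h3 : ReachIn P₁ {x, v}ᶜ e c :=
      ((comp_connOn hexw).reachIn hc).mono (fun a ha b hb h =>
        Or.inl ⟨h, Or.inl (hce a ha), Or.inl (hce b hb)⟩) (fun t ht => by
          rintro (rfl | rfl)
          exacts [hxK (hce _ ht), hvK (hce _ ht)]) (mem_comp_self hexw)
    refine (h3.trans (ReachIn.of_adj (by simp [hwx, hvw.symm]) ?_)).symm ?_
    · exact Or.inl ⟨hcw, Or.inl (hce c hc), by simp⟩
    · rintro (h | h)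
      exacts [he.ne' h, hvK (h ▸ heK)]
  have hr₂ : ∀ v, v ≠ w → v ∈ K ∨ v = x → ReachIn P₂ {x, v}ᶜ r w := by
    intro v hvw hvK
    obtain ⟨c, hc, hcw⟩ := hrw
    have hne : ∀ t ∈ comp P {x, w}ᶜ r, t ∈ ({x, v} : Set U)ᶜ := by
      rintro t ht (rfl | rfl)
      exacts [ht.1 (Or.inl rfl), hvK.elim (hcr t ht) fun h => ht.1 (Or.inl h)]
    refine (((comp_connOn hrxw).reachIn hc).mono (fun a ha b hb h =>
        Or.inl ⟨h, hcr a ha, hcr b hb⟩) hne (mem_comp_self hrxw)).trans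
      (ReachIn.of_adj (by simp [hwx, hvw.symm]) ?_)
    exact Or.inl ⟨hcw, hcr c hc, hwK⟩
  have hs₁ : ∀ v ∈ K, ReachIn P {x, v}ᶜ r e → ReachIn P₁ {x, v}ᶜ w e := by
    intro v hvK h Z hZ hwZ hcl
    refine (h (Z ∪ {t | t ∉ K ∧ t ≠ x}) ?_ (Or.inr ⟨hrK, hr.ne'⟩) ?_).resolve_right
      fun h => h.1 heK
    · rintro t (ht | ⟨h3, h4⟩)
      · exact hZ ht
      · rintro (h | h)
        exacts [h4 h, h3 (h ▸ hvK)]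
    · intro c hc d hd hcd
      by_cases hdK : d ∈ K
      · left
        by_cases hcK : c ∈ K
        · exact hcl c (hc.resolve_right fun h => h.1 hcK) d hd
            (Or.inl ⟨hcd, Or.inl hcK, Or.inl hdK⟩)
        · rcases hK d hdK c hcd.symm with h3 | h3 | h3
          · exact absurd h3 hcK
          · subst h3
            rcases hc with hc | hc
            exacts [absurd (Or.inl rfl) (hZ hc), absurd rfl hc.2]
          · subst h3
            exact hcl c hwZ d hd (Or.inl ⟨hcd, by simp, Or.inl hdK⟩)
      · exact Or.inr ⟨hdK, fun h => hd (Or.inl h)⟩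
  have hs₂ : ∀ v ∉ K, ReachIn P {x, v}ᶜ r e → ReachIn P₂ {x, v}ᶜ r w := by
    intro v hvK h Z hZ hrZ hcl
    by_contra hwZ
    refine (h (Z ∩ Kᶜ) (inter_subset_left.trans hZ) ⟨hrZ, hrK⟩ ?_).2 heK
    rintro c ⟨hc, hcK⟩ d hd hcd
    have hdK : d ∉ K := by
      intro hdK
      rcases hK d hdK c hcd.symm with h3 | h3 | h3
      exacts [hcK h3, hZ hc (Or.inl h3), hwZ (h3 ▸ hc)]
    exact ⟨hcl c hc d hd (Or.inl ⟨hcd, hcK, hdK⟩), hdK⟩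
  have hfin := finite_separators hr.ne' h1
  have hw' : w ∈ {w | w ≠ x ∧ w ≠ r ∧ w ≠ e ∧ ¬ ReachIn P {x, w}ᶜ r e} := ⟨hwx, hwr, hwe, hw⟩
  obtain ⟨α₁, h₁, h₁'⟩ := ih _ (ncard_lt_ncard (ssubset_of_subset_of_ne (fun v hv => by
      have hvK : v ∈ K := by
        by_contra hvK
        exact hv.2.2.2 (hr₁ v hv.2.1 hvK)
      exact ⟨hv.1, fun h => hrK (h ▸ hvK), hv.2.2.1, fun h => hv.2.2.2 (hs₁ v hvK h)⟩)
      fun h => (h.symm ▸ hw').2.1 rfl) hfin) hG₁ (r := w) (e := e) (Or.inr hxw)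
      (Or.inl ⟨he, by simp, Or.inl heK⟩) hwe (by simpa using hr₁ x hwx.symm hxK) rfl
  obtain ⟨α₂, h₂, h₂'⟩ := ih _ (ncard_lt_ncard (ssubset_of_subset_of_ne (fun v hv => by
      have hvK : v ∉ K := fun hvK => hv.2.2.2 (hr₂ v hv.2.2.1 (Or.inl hvK))
      exact ⟨hv.1, hv.2.1, fun h => hvK (h ▸ heK), fun h => hv.2.2.2 (hs₂ v hvK h)⟩)
      fun h => (h.symm ▸ hw').2.2.1 rfl) hfin) hG₂ (r := r) (e := w)
      (Or.inl ⟨hr, hxK, hrK⟩) (Or.inr hxw) hwr.symm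
      (by simpa using hr₂ x hwx.symm (Or.inr rfl)) rfl
  refine ⟨combine K w α₁ α₂, spread_combine hwK hrK heK hxK hwr.symm h₁ h₂ hwx,
    kf_expand_combine hxK hwK hwx hK h₁.root h₁' h₂' fun z hz => ?_⟩
  by_cases hzr : z = r
  · rw [hzr, h₂.root]
    simp
  · exact h₂.free z hz hzr

theorem exists_spread (hG : KF P) (hr : P.Adj x r) (he : P.Adj x e) (hre : r ≠ e) :
    ∃ α, Spread P x r e α ∧ KF (expand P x α) := by
  by_cases h1 : ReachIn P {x}ᶜ r e
  · exact exists_spread_of_reachIn hG hr he hre h1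
  have hadj : (edge r e).Adj r e := (edge_adj _ _ _ _).2 ⟨Or.inl ⟨rfl, rfl⟩, hre⟩
  have hre' : ∀ w, w ≠ r → w ≠ e → ReachIn (P ⊔ edge r e) {x, w}ᶜ r e := fun w h h' =>
    ReachIn.of_adj (by simp [he.ne', h'.symm]) (Or.inr hadj)
  have hx : ∀ z, (P ⊔ edge r e).Adj x z ↔ P.Adj x z := by
    intro z
    simp [edge_adj, hr.ne, he.ne]
  have hGe : KF (P ⊔ edge r e) := by
    have hrx : r ∈ ({x}ᶜ : Set U) := hr.ne'
    have he' : e ∉ comp P {x}ᶜ r := fun h => h1 h.2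
    have hxc : x ∉ comp P {x}ᶜ r := fun h => h.1 rfl
    have hrc := mem_comp_self (G := P) hrx
    have hcl : ∀ a b, P.Adj a b → a ∈ comp P {x}ᶜ r → b ∈ comp P {x}ᶜ r ∨ b = x := by
      intro a b hab ha
      by_cases hb : b = x
      · exact Or.inr hb
      · exact Or.inl (comp_closed a ha b hb hab)
    refine KF.two_sum (V₁ := comp P {x}ᶜ r ∪ {x, e}) (V₂ := (comp P {x}ᶜ r)ᶜ) (u := x) (w := e)
      ?_ (by simp) (by simp) hxc he' ?_ ?_ (hG.mono ?_)
    · rintro t ⟨h | h, h'⟩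
      exacts [absurd h h', h]
    · rintro a b (hab | hab)
      · by_cases ha : a ∈ comp P {x}ᶜ r
        · exact Or.inl ⟨Or.inl ha, (hcl a b hab ha).imp id fun h => Or.inl h⟩
        · by_cases hb : b ∈ comp P {x}ᶜ r
          · exact Or.inl ⟨(hcl b a hab.symm hb).imp id fun h => Or.inl h, Or.inl hb⟩
          · exact Or.inr ⟨ha, hb⟩
      · obtain ⟨⟨rfl, rfl⟩ | ⟨rfl, rfl⟩, -⟩ := (edge_adj _ _ _ _).1 hab
        exacts [Or.inl ⟨Or.inl hrc, by simp⟩, Or.inl ⟨by simp, Or.inl hrc⟩]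
    · refine KF.add_vertex (v := e) (u := x) (w := r) he.ne' hre.symm ?_
        (Or.inr (Or.inl ⟨Or.inl hr, by simp, Or.inl hrc⟩)) (hG.mono ?_)
      · rintro b (⟨hb | hb, -, hb'⟩ | hb)
        · rcases hb' with hb' | hb' | hb'
          · exact absurd ((hcl b e hb.symm hb').resolve_right he.ne') he'
          · exact Or.inl hb'
          · exact absurd hb'.symm hb.ne
        · simp only [edge_adj] at hb
          grind
        · simp only [edge_adj] at hb
          grind
      · rintro s t ⟨(⟨hst | hst, -⟩ | hst), hs, ht⟩
        · exact hst
        · simp only [edge_adj, mem_compl_iff, mem_singleton_iff] at hst hs ht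
          grind
        · simp only [edge_adj, mem_compl_iff, mem_singleton_iff] at hst hs ht
          grind
    · refine sup_le ?_ ((edge_le_iff _).2 (Or.inr he))
      rintro s t ⟨hst | hst, hs, ht⟩
      · exact hst
      · obtain ⟨⟨rfl, rfl⟩ | ⟨rfl, rfl⟩, -⟩ := (edge_adj _ _ _ _).1 hst
        exacts [absurd hrc hs, absurd hrc ht]
  obtain ⟨α, h2, h3⟩ := exists_spread_of_reach (P := P ⊔ edge r e) (x := x) (r := r) (e := e) hGe
    (Or.inl hr) (Or.inl he) hre (by simpa using hre' x hr.ne he.ne) fun w _ h h' => hre' w h h'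
  refine ⟨α, ⟨h2.root, ?_, ?_⟩, h3.mono (expand_mono le_sup_left)⟩
  · simpa only [hx] using h2.eq_of_suffix
  · simpa only [hx] using h2.free

end Spreading

section Split

variable {U : Type*} {P : SimpleGraph U} {e x : U}

lemma exists_spread_unrooted (hG : KF P) (he : P.Adj x e) : ∃ α : U → List (Fin 6),
    KF (expand P x α) ∧ ∀ z, P.Adj x z → z ≠ e → ∀ z', P.Adj x z' → α z <:+ α z' →
      α z' = α z ∧ z' ≠ e := by
  let Q : SimpleGraph (Option U) := P.map Function.Embedding.some ⊔ edge (some x) none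
  have hPQ : ∀ {a b}, P.Adj a b → Q.Adj (some a) (some b) := fun {a b} h =>
    Or.inl ((map_adj _ _ _ _).2 ⟨a, b, h, rfl, rfl⟩)
  have hQP : ∀ {a b}, Q.Adj (some a) (some b) → P.Adj a b := by
    rintro a b (h | h)
    · obtain ⟨a', b', h, ha, hb⟩ := (map_adj _ _ _ _).1 h
      rw [← Option.some_injective _ ha, ← Option.some_injective _ hb]
      exact h
    · simp [edge_adj] at h
  have hQ : KF Q := by
    refine KF.add_vertex (v := none) (u := some x) (w := some x) (by simp) (by simp) ?_ (Or.inl rfl)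
      (hG.of_hom (fun o => o.getD x) ?_ ?_)
    · rintro b (h | h)
      · obtain ⟨a', b', h, ha, hb⟩ := (map_adj _ _ _ _).1 h
        cases ha
      · simp only [edge_adj] at h
        grind
    · rintro (_ | a) ⟨a', -, ha, -⟩ (_ | b) ⟨b', -, hb, -⟩ hab
      exacts [rfl, absurd rfl ha, absurd rfl hb, congrArg some hab]
    · rintro (_ | a) (_ | b) ⟨h, ha, hb⟩
      exacts [absurd rfl ha, absurd rfl ha, absurd rfl hb, hQP h]
  obtain ⟨α, h1, h2⟩ := exists_spread hQ (x := some x) (r := none) (e := some e)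
    (Or.inr ((edge_adj _ _ _ _).2 ⟨Or.inl ⟨rfl, rfl⟩, by simp⟩)) (hPQ he) (by simp)
  refine ⟨fun z => α (some z), h2.of_hom (Sum.map some id) ?_ ?_, fun z hz hze z' hz' h => ?_⟩
  · exact ((Option.some_injective U).sumMap Function.injective_id).injOn
  · exact expand_induction (fun s t h => h.symm)
      (fun a b hab ha hb => (ExpandRel.base (hPQ hab) (by simpa) (by simpa)).adj)
      (fun z hz => (ExpandRel.leaf (hPQ hz)).adj)
      (fun z i l hz h => (ExpandRel.tree (hPQ hz) h).adj)
  · obtain ⟨h3, h4⟩ := h1.eq_of_suffix (some z) (hPQ hz) (by simp) (by simpa) (some z') (hPQ hz')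
      (by simp) h
    exact ⟨h3, by simpa using h4⟩

end Split

section Blow

variable {V : Type*} {G : SimpleGraph V} {u v w : V} {δ δ' : V → V → List (Fin 6)}
  {D : V → V → Prop}

/-- The edges of the graph in which every vertex `v` of `G` is replaced by a tree of lists, and
every edge `uv` joins the vertices `δ u v` and `δ v u` of the corresponding trees. -/
inductive BlowRel (G : SimpleGraph V) (δ : V → V → List (Fin 6)) :
    V × List (Fin 6) → V × List (Fin 6) → Prop
  | tree {v w : V} {i : Fin 6} {l : List (Fin 6)} : G.Adj v w → i :: l <:+ δ v w →
      BlowRel G δ (v, l) (v, i :: l)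
  | dart {v w : V} : G.Adj v w → BlowRel G δ (v, δ v w) (w, δ w v)

/-- The graph in which every vertex `v` of `G` is replaced by a tree of lists, and
every edge `uv` joins the vertices `δ u v` and `δ v u` of the corresponding trees. -/
def blow (G : SimpleGraph V) (δ : V → V → List (Fin 6)) : SimpleGraph (V × List (Fin 6)) :=
  fromRel (BlowRel G δ)

lemma BlowRel.adj {s t : V × List (Fin 6)} (h : BlowRel G δ s t) : (blow G δ).Adj s t := by
  refine (fromRel_adj _ _ _).2 ⟨?_, Or.inl h⟩
  cases h with
  | tree => simp
  | dart h => simp [h.ne]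

lemma blow_induction {p : V × List (Fin 6) → V × List (Fin 6) → Prop} (hs : ∀ s t, p s t → p t s)
    (htree : ∀ v w i l, G.Adj v w → i :: l <:+ δ v w → p (v, l) (v, i :: l))
    (hdart : ∀ v w, G.Adj v w → p (v, δ v w) (w, δ w v))
    (s t : V × List (Fin 6)) (hst : (blow G δ).Adj s t) : p s t := by
  have key : ∀ s t, BlowRel G δ s t → p s t := by
    intro s t h
    cases h with
    | @tree v w i l h h' => exact htree v w i l h h'
    | @dart v w h => exact hdart v w h
  obtain ⟨-, h | h⟩ := (fromRel_adj _ _ _).1 hst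
  · exact key s t h
  · exact hs _ _ (key t s h)

/-- The invariant of the construction, `D u v` stating that the address `δ u v` is final. -/
structure Stage (G : SimpleGraph V) (δ : V → V → List (Fin 6)) (D : V → V → Prop) : Prop where
  kf : KF (blow G δ)
  open_eq : ∀ u w, G.Adj u w → ¬ D u w → ∀ w', G.Adj u w' → δ u w <:+ δ u w' →
    ¬ D u w' ∧ δ u w' = δ u w
  closed_inj : ∀ u w w', G.Adj u w → G.Adj u w' → D u w → D u w' → δ u w = δ u w' → w = w'

lemma stage_zero (hG : KF G) : Stage G (fun _ _ => []) (fun _ _ => False) := by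
  refine ⟨hG.of_hom Prod.fst ?_ ?_, fun _ _ _ _ _ _ _ => ⟨id, rfl⟩, fun _ _ _ _ _ h => h.elim⟩
  · have : ∀ s t, (blow G (fun _ _ => [])).Adj s t → s.2 = [] ∧ t.2 = [] :=
      blow_induction (fun s t h => h.symm) (by simp) (by simp)
    rintro s ⟨s', hs⟩ t ⟨t', ht⟩ hst
    exact Prod.ext hst ((this _ _ hs).1.trans (this _ _ ht).1.symm)
  · have : ∀ s t, (blow G (fun _ _ => [])).Adj s t → G.Adj s.1 t.1 :=
      blow_induction (fun s t h => h.symm) (by simp) (fun _ _ h => h)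
    exact this

open Classical in
/-- The addresses obtained by splitting the vertex `s` of the tree of `u` according to `α`. -/
noncomputable def splitAt (δ : V → V → List (Fin 6)) (u : V) (s : List (Fin 6))
    (α : V × List (Fin 6) → List (Fin 6)) (a b : V) : List (Fin 6) :=
  if a = u ∧ δ u b = s then α (b, δ b u) ++ s else δ a b

section SplitAt

variable {s : List (Fin 6)} {α : V × List (Fin 6) → List (Fin 6)} {a b : V}

lemma splitAt_pos (h : δ u b = s) : splitAt δ u s α u b = α (b, δ b u) ++ s := if_pos ⟨rfl, h⟩

lemma splitAt_neg (h : δ u b ≠ s) : splitAt δ u s α u b = δ u b := if_neg fun h' => h h'.2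

lemma splitAt_ne (h : a ≠ u) : splitAt δ u s α a b = δ a b := if_neg fun hv => h hv.1

/-- The address `s` of the dart `uv` is not a proper suffix of an address at `u`. -/
lemma Stage.eq_of_suffix (hS : Stage G δ D) (huv : G.Adj u v) (hD : ¬ D u v) (huw : G.Adj u w)
    (h : δ u v <:+ δ u w) : δ u w = δ u v := (hS.open_eq u v huv hD w huw h).2

lemma Stage.kf_splitAt (hS : Stage G δ D) (huv : G.Adj u v) (hD : ¬ D u v)
    (hα : KF (expand (blow G δ) (u, δ u v) α)) (hroot : ∀ i l, δ u v = i :: l → α (u, l) = []) :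
    KF (blow G (splitAt δ u (δ u v) α)) := by
  classical
  set s := δ u v with hs
  have hsuf : ∀ {w}, G.Adj u w → s <:+ δ u w → δ u w = s := fun hw h => hS.eq_of_suffix huv hD hw h
  let f : V × List (Fin 6) → (V × List (Fin 6)) ⊕ List (Fin 6) := fun p =>
    if p.1 = u ∧ s <:+ p.2 then .inr (p.2.take (p.2.length - s.length)) else .inl p
  have f_pos : ∀ b, f (u, b ++ s) = .inr b := fun b => by simp [f]
  have f_pos' : f (u, s) = .inr [] := f_pos []
  have f_neg : ∀ {a l}, (a = u → ¬ s <:+ l) → f (a, l) = .inl (a, l) := fun h =>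
    if_neg fun h' => h h'.1 h'.2
  have hbase : ∀ {a b : V} {l k : List (Fin 6)}, (blow G δ).Adj (a, l) (b, k) →
      (a = u → ¬ s <:+ l) → (b = u → ¬ s <:+ k) →
      (expand (blow G δ) (u, s) α).Adj (f (a, l)) (f (b, k)) := by
    intro a b l k h ha hb
    rw [f_neg ha, f_neg hb]
    refine (ExpandRel.base h ?_ ?_).adj
    · intro h
      rw [Prod.mk.injEq] at h
      exact ha h.1 (h.2 ▸ List.suffix_rfl)
    · intro h
      rw [Prod.mk.injEq] at h
      exact hb h.1 (h.2 ▸ List.suffix_rfl)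
  have hdart : ∀ {w}, G.Adj u w → δ u w = s → (blow G δ).Adj (u, s) (w, δ w u) := by
    intro w hw h
    have := (BlowRel.dart (δ := δ) hw).adj
    rwa [h] at this
  refine hα.of_hom f (Function.Injective.injOn ?_) ?_
  · rintro ⟨a, l⟩ ⟨b, k⟩ h
    by_cases ha : a = u ∧ s <:+ l
    · obtain ⟨rfl, l, rfl⟩ := ha
      rw [f_pos] at h
      by_cases hb : b = a ∧ s <:+ k
      · obtain ⟨rfl, k, rfl⟩ := hb
        rw [f_pos, Sum.inr.injEq] at h
        rw [h]
      · rw [f_neg fun h h' => hb ⟨h, h'⟩] at h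
        cases h
    · rw [f_neg fun h h' => ha ⟨h, h'⟩] at h
      by_cases hb : b = u ∧ s <:+ k
      · obtain ⟨rfl, k, rfl⟩ := hb
        rw [f_pos] at h
        cases h
      · rw [f_neg fun h h' => hb ⟨h, h'⟩] at h
        exact Sum.inl_injective h
  · refine blow_induction (fun s t h => h.symm) (fun a w i l hw h => ?_) (fun a w hw => ?_)
    · by_cases hau : a = u
      · subst hau
        by_cases hsl : s <:+ l
        · obtain ⟨b, rfl⟩ := hsl
          have hws : δ a w = s := by
            by_contra hne
            rw [splitAt_neg hne] at h
            exact hne (hsuf hw ((List.suffix_append (i :: b) s).trans h))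
          rw [splitAt_pos hws, ← List.cons_append, List.suffix_append_self_iff] at h
          rw [f_pos, ← List.cons_append, f_pos]
          exact (ExpandRel.tree (hdart hw hws) h).adj
        · by_cases his : i :: l = s
          · rw [f_neg fun _ => hsl, his, f_pos', ← hroot i l his.symm]
            have h1 : (blow G δ).Adj (a, s) (a, l) := by
              rw [← his]
              exact (BlowRel.tree huv (his ▸ List.suffix_rfl)).adj.symm
            exact (ExpandRel.leaf h1).adj.symm
          · have hsi : ¬ s <:+ i :: l := fun h' =>
              (List.suffix_cons_iff.1 h').elim (fun h => his h.symm) hsl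
            refine hbase (BlowRel.tree hw ?_).adj (fun _ => hsl) fun _ => hsi
            by_cases hws : δ a w = s
            · rw [splitAt_pos hws] at h
              rw [hws]
              exact (List.suffix_or_suffix_of_suffix h (List.suffix_append _ _)).resolve_right hsi
            · rwa [splitAt_neg hws] at h
      · rw [splitAt_ne hau] at h
        exact hbase (BlowRel.tree hw h).adj (fun h => absurd h hau) (fun h => absurd h hau)
    · have key : ∀ {w}, G.Adj u w → (expand (blow G δ) (u, s) α).Adj
          (f (u, splitAt δ u s α u w)) (f (w, splitAt δ u s α w u)) := by
        intro w hw
        rw [splitAt_ne hw.ne']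
        by_cases hws : δ u w = s
        · rw [splitAt_pos hws, f_pos, f_neg fun h => absurd h hw.ne']
          exact (ExpandRel.leaf (hdart hw hws)).adj
        · rw [splitAt_neg hws]
          exact hbase (BlowRel.dart hw).adj (fun _ h => hws (hsuf hw h)) fun h => absurd h hw.ne'
      by_cases hau : a = u
      · subst hau
        exact key hw
      · by_cases hwu : w = u
        · subst hwu
          exact (key hw.symm).symm
        · rw [splitAt_ne hau, splitAt_ne hwu]
          exact hbase (BlowRel.dart hw).adj (fun h => absurd h hau) fun h => absurd h hwu

lemma Stage.exists_addresses (hS : Stage G δ D) (huv : G.Adj u v) :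
    ∃ α, KF (expand (blow G δ) (u, δ u v) α) ∧ (∀ i l, δ u v = i :: l → α (u, l) = []) ∧
      ∀ w, G.Adj u w → δ u w = δ u v → w ≠ v → ∀ w', G.Adj u w' → δ u w' = δ u v →
        α (w, δ w u) <:+ α (w', δ w' u) → α (w', δ w' u) = α (w, δ w u) ∧ w' ≠ v := by
  have hdart : ∀ {w}, G.Adj u w → δ u w = δ u v → (blow G δ).Adj (u, δ u v) (w, δ w u) := by
    intro w hw h
    have := (BlowRel.dart (δ := δ) hw).adj
    rwa [h] at this
  have hv : ∀ {w : V}, w ≠ v → (w, δ w u) ≠ (v, δ v u) := fun h h' => h (congrArg Prod.fst h')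
  cases hs : δ u v with
  | nil =>
    rw [hs] at hdart
    obtain ⟨α, h1, h2⟩ := exists_spread_unrooted hS.kf (hdart huv hs)
    refine ⟨α, h1, by simp, fun w hw hws hwv w' hw' hws' h => ?_⟩
    obtain ⟨h3, h4⟩ := h2 _ (hdart hw hws) (hv hwv) _ (hdart hw' hws') h
    exact ⟨h3, fun h5 => h4 (by rw [h5])⟩
  | cons i l =>
    rw [hs] at hdart
    have hr : (blow G δ).Adj (u, i :: l) (u, l) :=
      (BlowRel.tree huv (hs ▸ List.suffix_rfl)).adj.symm
    have hu : ∀ {w}, G.Adj u w → (w, δ w u) ≠ (u, l) := fun h h' => h.ne' (congrArg Prod.fst h')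
    obtain ⟨α, h1, h2⟩ := exists_spread hS.kf hr (hdart huv hs) (hu huv).symm
    refine ⟨α, h2, ?_, fun w hw hws hwv w' hw' hws' h => ?_⟩
    · rintro j k h
      rw [← (List.cons.inj h).2]
      exact h1.root
    · obtain ⟨h3, h4⟩ := h1.eq_of_suffix _ (hdart hw hws) (hu hw) (hv hwv) _ (hdart hw' hws')
        (hu hw') h
      exact ⟨h3, fun h5 => h4 (by rw [h5])⟩

lemma Stage.exists_next (hS : Stage G δ D) (huv : G.Adj u v) (hD : ¬ D u v) :
    ∃ δ', Stage G δ' (fun a b => D a b ∨ (a = u ∧ b = v)) ∧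
      ∀ a b, G.Adj a b → D a b → δ' a b = δ a b := by
  obtain ⟨α, h1, h2, h3⟩ := hS.exists_addresses huv
  have hsuf : ∀ {w}, G.Adj u w → δ u v <:+ δ u w → δ u w = δ u v := fun hw h =>
    hS.eq_of_suffix huv hD hw h
  have hopen : ∀ {w}, G.Adj u w → δ u w = δ u v → ¬ D u w := fun hw h =>
    (hS.open_eq u v huv hD _ hw (h ▸ List.suffix_rfl)).1
  have hold : ∀ {a b}, G.Adj a b → D a b → splitAt δ u (δ u v) α a b = δ a b := by
    intro a b hab hDab
    by_cases ha : a = u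
    · subst ha
      exact splitAt_neg fun h => hopen hab h hDab
    · exact splitAt_ne ha
  refine ⟨splitAt δ u (δ u v) α, ⟨hS.kf_splitAt huv hD h1 h2, ?_, ?_⟩, fun a b => hold⟩
  · intro a w hw hn w' hw' h
    push Not at hn
    obtain ⟨hDw, hwv⟩ := hn
    by_cases ha : a = u
    · subst ha
      by_cases hws : δ a w = δ a v
      · rw [splitAt_pos hws] at h ⊢
        by_cases hws' : δ a w' = δ a v
        · rw [splitAt_pos hws'] at h ⊢
          rw [List.suffix_append_self_iff] at h
          obtain ⟨h4, h5⟩ := h3 w hw hws (hwv rfl) w' hw' hws' h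
          refine ⟨?_, by rw [h4]⟩
          rintro (h6 | h6)
          exacts [hopen hw' hws' h6, h5 h6.2]
        · rw [splitAt_neg hws'] at h
          exact absurd (hsuf hw' ((List.suffix_append _ _).trans h)) hws'
      · rw [splitAt_neg hws] at h ⊢
        by_cases hws' : δ a w' = δ a v
        · rw [splitAt_pos hws'] at h
          rcases List.suffix_or_suffix_of_suffix h (List.suffix_append _ _) with h | h
          · exact absurd (hS.open_eq a w hw hDw v huv h).2.symm hws
          · exact absurd (hsuf hw h) hws
        · rw [splitAt_neg hws'] at h ⊢
          obtain ⟨h4, h5⟩ := hS.open_eq a w hw hDw w' hw' h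
          refine ⟨?_, h5⟩
          rintro (h6 | h6)
          exacts [h4 h6, hws' (by rw [h6.2])]
    · rw [splitAt_ne ha, splitAt_ne ha] at *
      obtain ⟨h4, h5⟩ := hS.open_eq a w hw hDw w' hw' h
      exact ⟨fun h6 => h6.elim h4 fun h6 => ha h6.1, h5⟩
  · have key : ∀ {w}, G.Adj u w → D u w →
        splitAt δ u (δ u v) α u w ≠ splitAt δ u (δ u v) α u v := by
      intro w hw hDw h
      rw [hold hw hDw, splitAt_pos rfl] at h
      exact hopen hw (hsuf hw (h ▸ List.suffix_append _ _)) hDw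
    rintro a w w' hw hw' (hDw | ⟨rfl, rfl⟩) (hDw' | ⟨h4, h5⟩) h
    · rw [hold hw hDw, hold hw' hDw'] at h
      exact hS.closed_inj a w w' hw hw' hDw hDw' h
    · subst h4 h5
      exact absurd h (key hw hDw)
    · exact absurd h.symm (key hw' hDw')
    · exact h5.symm

end SplitAt

end Blow

section Limit

variable {V : Type*} {G : SimpleGraph V} {δ : V → V → List (Fin 6)} {D : V → V → Prop}

lemma Stage.congr {D' : V → V → Prop} (hS : Stage G δ D) (h : ∀ u v, G.Adj u v → (D u v ↔ D' u v)) :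
    Stage G δ D' := by
  refine ⟨hS.kf, fun u w hw hD w' hw' hs => ?_, fun u w w' hw hw' hD hD' => ?_⟩
  · rw [← h u w hw] at hD
    rw [← h u w' hw']
    exact hS.open_eq u w hw hD w' hw' hs
  · rw [← h _ _ hw] at hD
    rw [← h _ _ hw'] at hD'
    exact hS.closed_inj u w w' hw hw' hD hD'

lemma Stage.exists_succ {f : V × V → ℕ} (hf : Function.Injective f) {n : ℕ}
    (hS : Stage G δ fun u v => f (u, v) < n) : ∃ δ', Stage G δ' (fun u v => f (u, v) < n + 1) ∧
      ∀ u v, G.Adj u v → f (u, v) < n → δ' u v = δ u v := by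
  by_cases h : ∃ u v, G.Adj u v ∧ f (u, v) = n
  · obtain ⟨u, v, huv, rfl⟩ := h
    obtain ⟨δ', h1, h2⟩ := hS.exists_next huv (lt_irrefl _)
    refine ⟨δ', h1.congr fun a b _ => ?_, h2⟩
    rw [Nat.lt_succ_iff_lt_or_eq, hf.eq_iff, Prod.mk.injEq]
  · push Not at h
    refine ⟨δ, hS.congr fun u v huv => ?_, fun _ _ _ _ => rfl⟩
    have := h u v huv
    omega

lemma exists_stages (hG : KF G) {f : V × V → ℕ} (hf : Function.Injective f) :
    ∃ σ : ℕ → V → V → List (Fin 6), ∀ n, Stage G (σ n) (fun u v => f (u, v) < n) ∧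
      ∀ u v, G.Adj u v → f (u, v) < n → σ (n + 1) u v = σ n u v := by
  choose next hnext using fun (n : ℕ) (s : {δ // Stage G δ fun u v => f (u, v) < n}) =>
    s.2.exists_succ hf
  let σ : ∀ n : ℕ, {δ // Stage G δ fun u v => f (u, v) < n} := fun n =>
    Nat.rec ⟨fun _ _ => [], (stage_zero hG).congr fun _ _ _ => by simp⟩
      (fun n s => ⟨next n s, (hnext n s).1⟩) n
  exact ⟨fun n => (σ n).1, fun n => ⟨(σ n).2, (hnext n (σ n)).2⟩⟩

lemma kf_blow_of_eventually {σ : ℕ → V → V → List (Fin 6)} (hσ : ∀ n, KF (blow G (σ n)))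
    (h : ∀ u v, G.Adj u v → ∀ᶠ n in Filter.atTop, σ n u v = δ u v) : KF (blow G δ) := by
  have key : ∀ s t, (blow G δ).Adj s t → ∀ᶠ n in Filter.atTop, (blow G (σ n)).Adj s t := by
    refine blow_induction (fun s t h => h.mono fun n hn => hn.symm) (fun v w i l hvw hl => ?_)
      (fun v w hvw => ?_)
    · filter_upwards [h v w hvw] with n hn
      exact (BlowRel.tree hvw (hn.symm ▸ hl)).adj
    · filter_upwards [h v w hvw, h w v hvw.symm] with n hn hn'
      rw [← hn, ← hn']
      exact (BlowRel.dart hvw).adj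
  refine kf_of_finite fun T hT => ?_
  have h2 : ∀ᶠ n in Filter.atTop, ∀ p ∈ T ×ˢ T, (blow G δ).Adj p.1 p.2 →
      (blow G (σ n)).Adj p.1 p.2 := by
    refine (Filter.eventually_all_finite (hT.prod hT)).2 fun p _ => ?_
    by_cases hp : (blow G δ).Adj p.1 p.2
    · exact (key _ _ hp).mono fun n hn _ => hn
    · exact Filter.Eventually.of_forall fun n h => absurd h hp
  obtain ⟨n, hn⟩ := h2.exists
  exact (hσ n).mono fun s t hst => hn (s, t) ⟨hst.2.1, hst.2.2⟩ hst.1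

theorem exists_blow [Countable V] (hG : KF G) : ∃ δ : V → V → List (Fin 6), KF (blow G δ) ∧
    ∀ u w w', G.Adj u w → G.Adj u w' → δ u w = δ u w' → w = w' := by
  obtain ⟨f, hf⟩ := Countable.exists_injective_nat (V × V)
  obtain ⟨σ, hσ⟩ := exists_stages hG hf
  have hlim : ∀ u v, G.Adj u v → ∀ n, f (u, v) < n → σ n u v = σ (f (u, v) + 1) u v := by
    intro u v huv n hn
    induction n, Nat.succ_le_of_lt hn using Nat.le_induction with
    | base => rfl
    | succ n hle ih => rw [(hσ n).2 u v huv hle, ih hle]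
  have hev : ∀ u v, G.Adj u v → ∀ᶠ n in Filter.atTop, f (u, v) < n ∧
      σ n u v = σ (f (u, v) + 1) u v := fun u v huv => by
    filter_upwards [Filter.eventually_gt_atTop (f (u, v))] with n hn
    exact ⟨hn, hlim u v huv n hn⟩
  refine ⟨fun u v => σ (f (u, v) + 1) u v, kf_blow_of_eventually (fun n => (hσ n).1.kf)
    fun u v huv => (hev u v huv).mono fun n hn => hn.2, fun u w w' hw hw' h => ?_⟩
  obtain ⟨n, ⟨h1, h2⟩, h3, h4⟩ := ((hev u w hw).and (hev u w' hw')).exists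
  exact (hσ n).1.closed_inj u w w' hw hw' h1 h3 (by rw [h2, h4]; exact h)

lemma encard_neighborSet_blow_le (hδ : ∀ u w w', G.Adj u w → G.Adj u w' → δ u w = δ u w' → w = w')
    (p : V × List (Fin 6)) : ((blow G δ).neighborSet p).encard ≤ 9 := by
  obtain ⟨u, a⟩ := p
  have hsub : (blow G δ).neighborSet (u, a) ⊆ {(u, a.tail)} ∪ range (fun i : Fin 6 => (u, i :: a)) ∪
      (fun w => (w, δ w u)) '' {w | G.Adj u w ∧ δ u w = a} := by
    have := blow_induction (G := G) (δ := δ) (p := fun s t =>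
      (∀ u a, s = (u, a) → t ∈ ({(u, a.tail)} ∪ range (fun i : Fin 6 => (u, i :: a)) ∪
        (fun w => (w, δ w u)) '' {w | G.Adj u w ∧ δ u w = a} : Set (V × List (Fin 6)))) ∧
      (∀ u a, t = (u, a) → s ∈ ({(u, a.tail)} ∪ range (fun i : Fin 6 => (u, i :: a)) ∪
        (fun w => (w, δ w u)) '' {w | G.Adj u w ∧ δ u w = a} : Set (V × List (Fin 6)))))
      (fun s t h => h.symm) ?_ ?_
    · exact fun t ht => (this _ _ ht).1 u a rfl
    · rintro v w i l - -
      constructor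
      · rintro u a h
        cases h
        exact Or.inl (Or.inr ⟨i, rfl⟩)
      · rintro u a h
        cases h
        exact Or.inl (Or.inl rfl)
    · rintro v w hvw
      constructor
      · rintro u a h
        cases h
        exact Or.inr ⟨w, ⟨hvw, rfl⟩, rfl⟩
      · rintro u a h
        cases h
        exact Or.inr ⟨v, ⟨hvw.symm, rfl⟩, rfl⟩
  have h1 : (range (fun i : Fin 6 => (u, i :: a))).encard ≤ 6 := by
    rw [← image_univ]
    refine (encard_image_le _ _).trans ?_
    simp
  have h2 : ((fun w => (w, δ w u)) '' {w | G.Adj u w ∧ δ u w = a}).encard ≤ 1 := by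
    refine (encard_image_le _ _).trans (encard_le_one_iff.2 ?_)
    rintro w w' ⟨hw, h⟩ ⟨hw', h'⟩
    exact hδ u w w' hw hw' (h.trans h'.symm)
  calc ((blow G δ).neighborSet (u, a)).encard ≤ 1 + 6 + 1 := by
        refine (encard_le_encard hsub).trans ((encard_union_le _ _).trans (add_le_add
          ((encard_union_le _ _).trans (add_le_add ?_ h1)) h2))
        rw [encard_singleton]
    _ ≤ 9 := by norm_num

lemma isMinor_blow : IsMinor G (blow G δ) := by
  refine ⟨fun v => {p | p.1 = v ∧ (p.2 = [] ∨ ∃ w, G.Adj v w ∧ p.2 <:+ δ v w)}, fun v => ?_,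
    fun u v huv => ?_, fun u v huv => ?_⟩
  · refine induce_connected_iff.2 ⟨⟨(v, []), rfl, Or.inl rfl⟩,
      connOn_of_reachIn (a := (v, [])) ?_ ⟨rfl, Or.inl rfl⟩⟩
    rintro ⟨_, l⟩ ⟨rfl, hl⟩
    induction l with
    | nil => exact ReachIn.refl
    | cons i l ih =>
      obtain hl | ⟨w, hw, hl⟩ := hl
      · cases hl
      · have hl' := (List.suffix_cons i l).trans hl
        exact (ih (Or.inr ⟨w, hw, hl'⟩)).trans
          (ReachIn.of_adj ⟨rfl, Or.inr ⟨w, hw, hl⟩⟩ (BlowRel.tree hw hl).adj)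
  · rw [Set.disjoint_left]
    rintro p ⟨rfl, -⟩ ⟨h, -⟩
    exact huv h
  · exact ⟨(u, δ u v), ⟨rfl, Or.inr ⟨v, huv, List.suffix_rfl⟩⟩, (v, δ v u),
      ⟨rfl, Or.inr ⟨u, huv.symm, List.suffix_rfl⟩⟩, (BlowRel.dart huv).adj⟩

end Limit

end K33Free

/-- Every countable `K_{3,3}`-minor-free graph is a minor of a countable
`K_{3,3}`-minor-free graph whose maximum degree is at most 9. -/
theorem K33_minor_free_is_minor_of_maxDegree_le_9 {V : Type} [Countable V]
    (G : SimpleGraph V) (hG : ¬ IsMinor (completeBipartiteGraph (Fin 3) (Fin 3)) G) :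
    ∃ (W : Type) (_ : Countable W) (H : SimpleGraph W),
      ¬ IsMinor (completeBipartiteGraph (Fin 3) (Fin 3)) H ∧
      (∀ w : W, (H.neighborSet w).encard ≤ 9) ∧
      IsMinor G H := by
  rw [K33Free.isMinor_iff_hasK33] at hG
  obtain ⟨δ, h1, h2⟩ := K33Free.exists_blow hG
  refine ⟨V × List (Fin 6), inferInstance, K33Free.blow G δ, ?_,
    K33Free.encard_neighborSet_blow_le h2, K33Free.isMinor_blow⟩
  rw [K33Free.isMinor_iff_hasK33]
  exact h1
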